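/- Let Ω = ℓ²(ℕ, ℝ) be the real separable infinite-dimensional Hilbert space of square-summable sequences with its norm metric. There exists an assignment E sending each pair (φ, L), where K and L are Z-sets in Ω and φ : K → L is continuous, to a continuous map E(φ,L) : Ω → Ω, such that for all such pairs: (a) E(id_L, L) = id_Ω, and E(ψ ∘ φ, M) = E(ψ,M) ∘ E(φ,L) for every Z-set M and continuous ψ : L → M; (b) E(φ,L)(x) = φ(x) for all x ∈ K; (c) φ is injective if and only if E(φ,L) is injective, φ is surjective onto L if and only if E(φ,L) is surjective onto Ω, and φ is a topological embedding if and only if E(φ,L) is a topological embedding; in particular, if φ is a homeomorphism of K onto L then E(φ,L) is a homeomorphism of Ω onto Ω. -/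

import Mathlib

open Topology Set

/-- The Hilbert cube `Q = ℕ → [0,1]`, with the product topology. -/
abbrev HCube : Type := ℕ → unitInterval

/-- The real separable infinite-dimensional Hilbert space `ℓ²(ℕ, ℝ)` of square-summable
sequences, with its norm metric. -/
noncomputable abbrev L2Space : Type := lp (fun _ : ℕ => ℝ) 2

/-- `A` is of type `Z` in the metric space `S`: every continuous map of the Hilbert cube `Q`
into `S` can be uniformly approximated by continuous maps of `Q` into `S \ A`. -/
def IsZType {S : Type*} [MetricSpace S] (A : Set S) : Prop :=
  ∀ ε > (0 : ℝ), ∀ f : HCube → S, Continuous f →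
    ∃ g : HCube → S, Continuous g ∧ Set.range g ∩ A = ∅ ∧ ∀ q, dist (f q) (g q) < ε

/-- A `Z`-set in a metric space is a closed set of type `Z`. -/
def IsZSet {S : Type*} [MetricSpace S] (A : Set S) : Prop := IsClosed A ∧ IsZType A

namespace Continuation

open Filter

/-! ### The spaces `ℓ¹(ι, E)` -/

/-- The Banach space of absolutely summable families in `E`. -/
noncomputable abbrev L1 (ι : Type*) (E : Type*) [NormedAddCommGroup E] : Type _ :=
  lp (fun _ : ι => E) 1

namespace L1

variable {ι κ T E F : Type*} [NormedAddCommGroup E] [NormedAddCommGroup F]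

theorem hasSum_norm (x : L1 ι E) : HasSum (fun i => ‖x i‖) ‖x‖ := by
  simpa using lp.hasSum_norm (p := 1) (by simp) x

theorem summable_norm (x : L1 ι E) : Summable fun i => ‖x i‖ := (hasSum_norm x).summable

theorem norm_eq (x : L1 ι E) : ‖x‖ = ∑' i, ‖x i‖ := (hasSum_norm x).tsum_eq.symm

theorem norm_apply_le (x : L1 ι E) (i : ι) : ‖x i‖ ≤ ‖x‖ := lp.norm_apply_le_norm (by simp) x i

theorem sum_le_norm (x : L1 ι E) (s : Finset ι) : ∑ i ∈ s, ‖x i‖ ≤ ‖x‖ :=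
  sum_le_hasSum s (fun _ _ => norm_nonneg _) (hasSum_norm x)

/-- An absolutely summable family as an element of `ℓ¹`. -/
def mk (f : ι → E) (h : Summable fun i => ‖f i‖) : L1 ι E :=
  ⟨f, memℓp_gen (by simpa using h)⟩

@[simp] theorem mk_apply (f : ι → E) (h : Summable fun i => ‖f i‖) (i : ι) : mk f h i = f i := rfl

@[ext] theorem ext {x y : L1 ι E} (h : ∀ i, x i = y i) : x = y := lp.ext (funext h)

@[simp] theorem sub_apply (x y : L1 ι E) (i : ι) : (x - y) i = x i - y i := rfl

@[simp] theorem add_apply (x y : L1 ι E) (i : ι) : (x + y) i = x i + y i := rfl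

@[simp] theorem zero_apply (i : ι) : (0 : L1 ι E) i = 0 := rfl

theorem norm_le_of_sum_le {x : L1 ι E} {C : ℝ} (h : ∀ s : Finset ι, ∑ i ∈ s, ‖x i‖ ≤ C) :
    ‖x‖ ≤ C :=
  hasSum_le_of_sum_le (hasSum_norm x) h

theorem continuous_apply (i : ι) : Continuous fun x : L1 ι E => x i :=
  (lp.lipschitzWith_one_eval (E := fun _ : ι => E) 1 i).continuous

theorem exists_finset_norm_le (x : L1 ι E) {ε : ℝ} (hε : 0 < ε) :
    ∃ s : Finset ι, ‖x‖ ≤ ∑ i ∈ s, ‖x i‖ + ε := by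
  have := (hasSum_norm x).eventually (lt_mem_nhds (sub_lt_self ‖x‖ hε))
  obtain ⟨s, hs⟩ := this.exists
  exact ⟨s, by linarith⟩

theorem norm_sub_le (x y : L1 ι E) (s : Finset ι) :
    ‖x - y‖ ≤ ∑ i ∈ s, ‖x i - y i‖ + (‖x‖ - ∑ i ∈ s, ‖x i‖) + (‖y‖ - ∑ i ∈ s, ‖y i‖) := by
  classical
  refine norm_le_of_sum_le fun t => ?_
  have h1 : ∑ i ∈ t, ‖(x - y) i‖ ≤ ∑ i ∈ s, ‖x i - y i‖ + ∑ i ∈ t \ s, ‖x i - y i‖ := by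
    calc ∑ i ∈ t, ‖(x - y) i‖ ≤ ∑ i ∈ s ∪ t \ s, ‖x i - y i‖ := by
          refine Finset.sum_le_sum_of_subset_of_nonneg (fun i hi => ?_) (fun _ _ _ => norm_nonneg _)
          by_cases h : i ∈ s <;> simp [h, hi]
      _ = _ := Finset.sum_union (Finset.disjoint_sdiff)
  have h2 : ∑ i ∈ t \ s, ‖x i - y i‖ ≤ ∑ i ∈ t \ s, ‖x i‖ + ∑ i ∈ t \ s, ‖y i‖ := by
    rw [← Finset.sum_add_distrib]
    exact Finset.sum_le_sum fun i _ => _root_.norm_sub_le _ _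
  have h3 : ∀ z : L1 ι E, ∑ i ∈ t \ s, ‖z i‖ ≤ ‖z‖ - ∑ i ∈ s, ‖z i‖ := fun z => by
    have := sum_le_norm z (s ∪ t \ s)
    rw [Finset.sum_union Finset.disjoint_sdiff] at this
    linarith
  linarith [h3 x, h3 y]

/-- Coordinatewise convergence with uniformly small tails is convergence in `ℓ¹`. -/
theorem tendsto_of_tails {l : Filter T} {f : T → L1 ι E} {g : L1 ι E}
    (hc : ∀ i, Tendsto (fun t => f t i) l (𝓝 (g i)))
    (ht : ∀ ε > (0 : ℝ), ∃ s : Finset ι, ∀ᶠ t in l, ‖f t‖ ≤ ∑ i ∈ s, ‖f t i‖ + ε) :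
    Tendsto f l (𝓝 g) := by
  classical
  rw [tendsto_iff_norm_sub_tendsto_zero]
  refine Metric.tendsto_nhds.2 fun ε hε => ?_
  obtain ⟨s₁, hs₁⟩ := ht (ε / 4) (by positivity)
  obtain ⟨s₂, hs₂⟩ := exists_finset_norm_le g (ε := ε / 4) (by positivity)
  set s := s₁ ∪ s₂
  have h0 : Tendsto (fun t => ∑ i ∈ s, ‖f t i - g i‖) l (𝓝 0) := by
    have : Tendsto (fun t => ∑ i ∈ s, ‖f t i - g i‖) l (𝓝 (∑ i ∈ s, 0)) :=
      tendsto_finsetSum _ fun i _ => tendsto_iff_norm_sub_tendsto_zero.1 (hc i)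
    simpa using this
  filter_upwards [hs₁, h0.eventually (gt_mem_nhds (show (0 : ℝ) < ε / 4 by positivity))] with t h1 h2
  have h3 := norm_sub_le (f t) g s
  have h4 : ∑ i ∈ s₁, ‖f t i‖ ≤ ∑ i ∈ s, ‖f t i‖ :=
    Finset.sum_le_sum_of_subset_of_nonneg Finset.subset_union_left fun _ _ _ => norm_nonneg _
  have h5 : ∑ i ∈ s₂, ‖g i‖ ≤ ∑ i ∈ s, ‖g i‖ :=
    Finset.sum_le_sum_of_subset_of_nonneg Finset.subset_union_right fun _ _ _ => norm_nonneg _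
  simp only [Real.dist_eq, sub_zero, abs_norm]
  linarith

/-- The Scheffé lemma: coordinatewise convergence and convergence of norms give convergence. -/
theorem tendsto_of_norm {l : Filter T} {f : T → L1 ι E} {g : L1 ι E}
    (hc : ∀ i, Tendsto (fun t => f t i) l (𝓝 (g i)))
    (hn : Tendsto (fun t => ‖f t‖) l (𝓝 ‖g‖)) : Tendsto f l (𝓝 g) := by
  refine tendsto_of_tails hc fun ε hε => ?_
  obtain ⟨s, hs⟩ := exists_finset_norm_le g (ε := ε / 2) (by positivity)
  refine ⟨s, ?_⟩
  have h1 : Tendsto (fun t => ‖f t‖ - ∑ i ∈ s, ‖f t i‖) l (𝓝 (‖g‖ - ∑ i ∈ s, ‖g i‖)) :=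
    hn.sub (tendsto_finsetSum _ fun i _ => (hc i).norm)
  filter_upwards [h1.eventually (gt_mem_nhds (show _ < ε by linarith))] with t ht
  linarith

theorem continuous_of_norm [TopologicalSpace T] {f : T → L1 ι E}
    (hc : ∀ i, Continuous fun t => f t i) (hn : Continuous fun t => ‖f t‖) : Continuous f :=
  continuous_iff_continuousAt.2 fun t =>
    tendsto_of_norm (fun i => (hc i).tendsto t) (hn.tendsto t)

theorem continuous_of_tails [TopologicalSpace T] {f : T → L1 ι E}
    (hc : ∀ i, Continuous fun t => f t i)
    (ht : ∀ t₀, ∀ ε > (0 : ℝ), ∃ s : Finset ι, ∀ᶠ t in 𝓝 t₀, ‖f t‖ ≤ ∑ i ∈ s, ‖f t i‖ + ε) :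
    Continuous f :=
  continuous_iff_continuousAt.2 fun t => tendsto_of_tails (fun i => (hc i).tendsto t) (ht t)

/-- A family of elements of `ℓ¹` dominated by a summable family depends continuously on its
coordinates. -/
theorem continuous_of_dominated [TopologicalSpace T] {f : T → L1 ι E} {b : ι → ℝ}
    (hc : ∀ i, Continuous fun t => f t i) (hb : Summable b) (h : ∀ t i, ‖f t i‖ ≤ b i) :
    Continuous f := by
  refine continuous_of_tails hc fun t₀ ε hε => ?_
  have hb0 : ∀ i, 0 ≤ b i := fun i => (norm_nonneg _).trans (h t₀ i)
  obtain ⟨s, hs⟩ := (hb.hasSum.eventually (lt_mem_nhds (sub_lt_self _ hε))).exists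
  refine ⟨s, .of_forall fun t => norm_le_of_sum_le fun u => ?_⟩
  classical
  calc ∑ i ∈ u, ‖f t i‖ ≤ ∑ i ∈ s ∪ u \ s, ‖f t i‖ := by
        refine Finset.sum_le_sum_of_subset_of_nonneg (fun i hi => ?_) (fun _ _ _ => norm_nonneg _)
        by_cases h : i ∈ s <;> simp [h, hi]
    _ = ∑ i ∈ s, ‖f t i‖ + ∑ i ∈ u \ s, ‖f t i‖ := Finset.sum_union Finset.disjoint_sdiff
    _ ≤ ∑ i ∈ s, ‖f t i‖ + ∑ i ∈ u \ s, b i := by gcongr; exact h t _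
    _ ≤ _ := by
        have := sum_le_hasSum (s ∪ u \ s) (fun i _ => hb0 i) hb.hasSum
        rw [Finset.sum_union Finset.disjoint_sdiff] at this
        linarith

/-- Reindexing. -/
noncomputable def reindex (e : ι ≃ κ) : L1 ι E ≃ₜ L1 κ E where
  toFun x := mk (fun k => x (e.symm k)) (e.symm.summable_iff.2 (summable_norm x))
  invFun x := mk (fun k => x (e k)) (e.summable_iff.2 (summable_norm x))
  left_inv x := by ext; simp
  right_inv x := by ext; simp
  continuous_toFun := by
    refine continuous_of_norm (fun i => continuous_apply _) ?_
    convert continuous_norm (E := L1 ι E) using 2 with x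
    simpa [norm_eq] using e.symm.tsum_eq fun i => ‖x i‖
  continuous_invFun := by
    refine continuous_of_norm (fun i => continuous_apply _) ?_
    convert continuous_norm (E := L1 κ E) using 2 with x
    simpa [norm_eq] using e.tsum_eq fun i => ‖x i‖

theorem summable_prod (x : L1 ι (L1 κ E)) : Summable fun p : ι × κ => ‖x p.1 p.2‖ := by
  rw [summable_prod_of_nonneg fun _ => norm_nonneg _]
  refine ⟨fun i => summable_norm (x i), ?_⟩
  simpa [← norm_eq] using summable_norm x

/-- Iterated `ℓ¹` spaces. -/
noncomputable def curry : L1 (ι × κ) E ≃ₜ L1 ι (L1 κ E) where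
  toFun x := mk (fun i => mk (fun k => x (i, k)) ((summable_norm x).prod_factor i)) (by
    simpa [norm_eq] using (summable_norm x).prod)
  invFun x := mk (fun p => x p.1 p.2) (summable_prod x)
  left_inv x := by ext; simp
  right_inv x := by ext; simp
  continuous_toFun := by
    have hn : ∀ i, Continuous fun x : L1 (ι × κ) E =>
        mk (fun k => x (i, k)) ((summable_norm x).prod_factor i) := fun i => by
      refine LipschitzWith.continuous (K := 1) (LipschitzWith.of_dist_le_mul fun x y => ?_)
      rw [dist_eq_norm, dist_eq_norm, NNReal.coe_one, one_mul]
      refine norm_le_of_sum_le fun s => ?_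
      have := sum_le_norm (x - y) (s.map ⟨fun k => (i, k), fun a b h => by simpa using h⟩)
      rwa [Finset.sum_map] at this
    refine continuous_of_norm hn ?_
    convert continuous_norm (E := L1 (ι × κ) E) using 2 with x
    simp only [norm_eq, mk_apply]
    exact ((summable_norm x).tsum_prod).symm
  continuous_invFun := by
    refine continuous_of_norm (fun i => (continuous_apply i.2).comp (continuous_apply i.1)) ?_
    convert continuous_norm (E := L1 ι (L1 κ E)) using 2 with x
    simp only [norm_eq, mk_apply]
    exact (summable_prod x).tsum_prod

end L1

/-! ### The Mazur homeomorphism `ℓ² ≃ ℓ¹` -/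

/-- The inverse of `x ↦ x * |x|`. -/
noncomputable def signedSqrt (a : ℝ) : ℝ := √a - √(-a)

theorem continuous_signedSqrt : Continuous signedSqrt := by
  unfold signedSqrt; fun_prop

theorem signedSqrt_mul_abs (x : ℝ) : signedSqrt (x * |x|) = x := by
  unfold signedSqrt
  rcases le_total 0 x with h | h
  · rw [abs_of_nonneg h, Real.sqrt_mul_self h, Real.sqrt_eq_zero_of_nonpos (by nlinarith), sub_zero]
  · rw [abs_of_nonpos h, Real.sqrt_eq_zero_of_nonpos (by nlinarith)]
    rw [show -(x * -x) = (-x) * (-x) by ring, Real.sqrt_mul_self (by linarith)]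
    ring

theorem sq_signedSqrt (a : ℝ) : signedSqrt a ^ 2 = |a| := by
  unfold signedSqrt
  rcases le_total 0 a with h | h
  · rw [Real.sqrt_eq_zero_of_nonpos (x := -a) (by linarith), sub_zero, Real.sq_sqrt h,
      abs_of_nonneg h]
  · rw [Real.sqrt_eq_zero_of_nonpos h, zero_sub, neg_sq, Real.sq_sqrt (by linarith),
      abs_of_nonpos h]

theorem signedSqrt_mul_abs_self (a : ℝ) : signedSqrt a * |signedSqrt a| = a := by
  unfold signedSqrt
  rcases le_total 0 a with h | h
  · rw [Real.sqrt_eq_zero_of_nonpos (x := -a) (by linarith), sub_zero,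
      abs_of_nonneg (Real.sqrt_nonneg _), Real.mul_self_sqrt h]
  · rw [Real.sqrt_eq_zero_of_nonpos h, zero_sub, abs_neg, abs_of_nonneg (Real.sqrt_nonneg _),
      neg_mul, Real.mul_self_sqrt (by linarith), neg_neg]

theorem signedSqrt_sub_sq_le (a b : ℝ) : (signedSqrt a - signedSqrt b) ^ 2 ≤ 2 * |a - b| := by
  set x := signedSqrt a with hx
  set y := signedSqrt b with hy
  rw [← signedSqrt_mul_abs_self a, ← signedSqrt_mul_abs_self b, ← hx, ← hy]
  rcases le_total 0 x with h1 | h1 <;> rcases le_total 0 y with h2 | h2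
  · rw [abs_of_nonneg h1, abs_of_nonneg h2]
    rcases le_total x y with h | h
    · nlinarith [neg_abs_le (x * x - y * y), mul_nonneg h1 (sub_nonneg.2 h)]
    · nlinarith [le_abs_self (x * x - y * y), mul_nonneg h2 (sub_nonneg.2 h)]
  · rw [abs_of_nonneg h1, abs_of_nonpos h2]
    nlinarith [le_abs_self (x * x - y * -y), sq_nonneg (x + y)]
  · rw [abs_of_nonpos h1, abs_of_nonneg h2]
    nlinarith [neg_abs_le (x * -x - y * y), sq_nonneg (x + y)]
  · rw [abs_of_nonpos h1, abs_of_nonpos h2]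
    rcases le_total x y with h | h
    · nlinarith [le_abs_self (x * -x - y * -y), neg_abs_le (x * -x - y * -y),
        mul_nonneg (neg_nonneg.2 h2) (sub_nonneg.2 h)]
    · nlinarith [le_abs_self (x * -x - y * -y), neg_abs_le (x * -x - y * -y),
        mul_nonneg (neg_nonneg.2 h1) (sub_nonneg.2 h)]

theorem l2_hasSum_sq (x : L2Space) : HasSum (fun i => x i ^ 2) (‖x‖ ^ 2) := by
  have := lp.hasSum_norm (p := 2) (by simp) x
  simpa using this

/-- The Mazur homeomorphism `x ↦ (x i * |x i|)`. -/
noncomputable def mazur : L2Space ≃ₜ L1 ℕ ℝ where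
  toFun x := L1.mk (fun i => x i * |x i|) (by
    simpa [← pow_two] using (l2_hasSum_sq x).summable)
  invFun a := ⟨fun i => signedSqrt (a i), memℓp_gen (by
    simpa [sq_signedSqrt] using L1.summable_norm a)⟩
  left_inv x := by
    apply lp.ext; funext i; simp [signedSqrt_mul_abs]
  right_inv a := by
    ext i; exact signedSqrt_mul_abs_self _
  continuous_toFun := by
    refine L1.continuous_of_norm (fun i => ?_) ?_
    · have : Continuous fun x : L2Space => x i :=
        (lp.lipschitzWith_one_eval (E := fun _ : ℕ => ℝ) 2 i).continuous
      exact this.mul this.abs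
    · have : Continuous fun x : L2Space => ‖x‖ ^ 2 := by fun_prop
      convert this using 2 with x
      refine (L1.hasSum_norm _).unique ?_
      simpa [← pow_two] using l2_hasSum_sq x
  continuous_invFun := by
    rw [continuous_iff_continuousAt]
    intro a
    rw [ContinuousAt, tendsto_iff_norm_sub_tendsto_zero]
    have h : Tendsto (fun b => √(2 * ‖b - a‖)) (𝓝 a) (𝓝 0) := by
      have : Continuous fun b : L1 ℕ ℝ => √(2 * ‖b - a‖) := by fun_prop
      simpa using this.tendsto a
    refine squeeze_zero (fun _ => norm_nonneg _) (fun b => ?_) h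
    apply Real.le_sqrt_of_sq_le
    have h1 := l2_hasSum_sq ((⟨fun i => signedSqrt (b i), memℓp_gen (by
      simpa [sq_signedSqrt] using L1.summable_norm b)⟩ : L2Space) - ⟨fun i => signedSqrt (a i),
      memℓp_gen (by simpa [sq_signedSqrt] using L1.summable_norm a)⟩)
    exact hasSum_le (fun i => signedSqrt_sub_sq_le (b i) (a i)) h1 ((L1.hasSum_norm (b - a)).mul_left 2)

namespace L1

variable {T E F : Type*} [NormedAddCommGroup E] [NormedAddCommGroup F]

/-- The mass of the coordinates with index at least `N`. -/
noncomputable def tail (N : ℕ) (x : L1 ℕ E) : ℝ := ‖x‖ - ∑ i ∈ Finset.range N, ‖x i‖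

theorem tail_nonneg (N : ℕ) (x : L1 ℕ E) : 0 ≤ tail N x := sub_nonneg.2 (sum_le_norm x _)

@[simp] theorem tail_zero (x : L1 ℕ E) : tail 0 x = ‖x‖ := by simp [tail]

theorem tail_eq_add (N : ℕ) (x : L1 ℕ E) : tail N x = ‖x N‖ + tail (N + 1) x := by
  simp only [tail, Finset.sum_range_succ]; ring

theorem tail_antitone (x : L1 ℕ E) : Antitone fun N => tail N x :=
  antitone_nat_of_succ_le fun N => by
    have := tail_eq_add N x
    have := norm_nonneg (x N)
    show tail (N + 1) x ≤ tail N x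
    linarith

theorem tail_le_norm (N : ℕ) (x : L1 ℕ E) : tail N x ≤ ‖x‖ := by
  simpa using tail_antitone x (Nat.zero_le N)

theorem norm_apply_le_tail (N : ℕ) (x : L1 ℕ E) : ‖x N‖ ≤ tail N x := by
  rw [tail_eq_add]; linarith [tail_nonneg (N + 1) x]

theorem continuous_tail (N : ℕ) : Continuous fun x : L1 ℕ E => tail N x :=
  continuous_norm.sub (continuous_finsetSum _ fun i _ => (continuous_apply i).norm)

theorem tendsto_tail (x : L1 ℕ E) : Tendsto (fun N => tail N x) atTop (𝓝 0) := by
  have := (hasSum_norm x).tendsto_sum_nat.const_sub ‖x‖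
  simpa [tail] using this

theorem sum_add_tail (N M : ℕ) (x : L1 ℕ E) :
    ∑ i ∈ Finset.range M, ‖x (N + i)‖ + tail (N + M) x = tail N x := by
  simp only [tail, Finset.sum_range_add]; ring

theorem hasSum_tail (N : ℕ) (x : L1 ℕ E) : HasSum (fun i => ‖x (N + i)‖) (tail N x) := by
  rw [hasSum_iff_tendsto_nat_of_nonneg fun _ => norm_nonneg _]
  have h := ((tendsto_tail x).comp (tendsto_add_atTop_nat N)).const_sub (tail N x)
  rw [sub_zero] at h
  refine h.congr fun M => ?_
  have := sum_add_tail N M x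
  simp only [Function.comp_apply, add_comm M N]
  linarith

theorem tail_le_of_sum_le {N : ℕ} {x : L1 ℕ E} {C : ℝ}
    (h : ∀ M, ∑ i ∈ Finset.range M, ‖x (N + i)‖ ≤ C) : tail N x ≤ C :=
  le_of_tendsto' (hasSum_tail N x).tendsto_sum_nat h

/-- Continuity from domination of tails. -/
theorem continuous_of_tail_le [TopologicalSpace T] {f : T → L1 ℕ E} {g : T → L1 ℕ F} {C : ℝ}
    (hc : ∀ i, Continuous fun t => f t i) (hg : Continuous g)
    (h : ∀ t N, tail (N + 2) (f t) ≤ C * tail (N + 1) (g t)) : Continuous f := by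
  refine continuous_of_tails hc fun t₀ ε hε => ?_
  have h0 : Tendsto (fun N => C * tail (N + 1) (g t₀)) atTop (𝓝 0) := by
    simpa using ((tendsto_tail (g t₀)).comp (tendsto_add_atTop_nat 1)).const_mul C
  obtain ⟨N, hN⟩ := (h0.eventually (gt_mem_nhds hε)).exists
  refine ⟨Finset.range (N + 2), ?_⟩
  have h1 : Continuous fun t => C * tail (N + 1) (g t) :=
    continuous_const.mul ((continuous_tail _).comp hg)
  filter_upwards [(h1.tendsto t₀).eventually (gt_mem_nhds hN)] with t ht
  have := h t N
  simp only [tail] at this ht ⊢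
  linarith

end L1

/-! ### Absorbing a Lipschitz-at-points retract -/

section Absorb

open L1

variable {S E : Type*} [TopologicalSpace S] [NormedAddCommGroup E] [NormedSpace ℝ E]

/-- `S` is a retract of the Banach space `E`, embedded by `emb`, with a retraction which is
Lipschitz at every point of the image of `S`. -/
structure PointedRetract (S E : Type*) [TopologicalSpace S] [NormedAddCommGroup E] where
  /-- the embedding -/
  emb : S → E
  /-- the retraction -/
  ret : E → S
  continuous_emb : Continuous emb
  continuous_ret : Continuous ret
  ret_emb : ∀ p, ret (emb p) = p
  /-- the Lipschitz constant -/
  const : ℝ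
  const_nonneg : 0 ≤ const
  norm_le : ∀ z p, ‖emb (ret z) - emb p‖ ≤ const * ‖z - emb p‖

namespace PointedRetract

variable (R : PointedRetract S E)

/-- The sequence `x` attached to a point `p` and a sequence `w`. -/
noncomputable def path (a : S × L1 ℕ E) (i : ℕ) : E := R.emb a.1 + (1 / 2 : ℝ) ^ i • a.2 i

/-- The coordinates of the image of `(p, w)`. -/
noncomputable def fwdCoord (a : S × L1 ℕ E) : ℕ → E
  | 0 => R.path a 0
  | i + 1 => (2 : ℝ) ^ (i + 1) • (R.path a (i + 1) - R.emb (R.ret (R.path a i)))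

theorem norm_fwdCoord_le (a : S × L1 ℕ E) (i : ℕ) :
    ‖R.fwdCoord a (i + 1)‖ ≤ ‖a.2 (i + 1)‖ + 2 * R.const * ‖a.2 i‖ := by
  have h1 : ‖R.path a (i + 1) - R.emb (R.ret (R.path a i))‖ ≤
      (1 / 2 : ℝ) ^ (i + 1) * ‖a.2 (i + 1)‖ + R.const * ((1 / 2 : ℝ) ^ i * ‖a.2 i‖) := by
    have h2 := R.norm_le (R.path a i) a.1
    have h3 : R.path a (i + 1) - R.emb (R.ret (R.path a i)) =
      (1 / 2 : ℝ) ^ (i + 1) • a.2 (i + 1) - (R.emb (R.ret (R.path a i)) - R.emb a.1) := by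
      simp only [path]; abel
    rw [h3]
    refine (_root_.norm_sub_le _ _).trans (add_le_add ?_ (h2.trans ?_))
    · rw [norm_smul, Real.norm_of_nonneg (by positivity)]
    · simp only [path, add_sub_cancel_left]
      rw [norm_smul, Real.norm_of_nonneg (by positivity)]
  rw [fwdCoord, norm_smul, Real.norm_of_nonneg (by positivity)]
  calc _ ≤ (2 : ℝ) ^ (i + 1) * ((1 / 2 : ℝ) ^ (i + 1) * ‖a.2 (i + 1)‖ +
        R.const * ((1 / 2 : ℝ) ^ i * ‖a.2 i‖)) := by gcongr
    _ = ((2 : ℝ) ^ (i + 1) * (1 / 2 : ℝ) ^ (i + 1)) * ‖a.2 (i + 1)‖ +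
        2 * ((2 : ℝ) ^ i * (1 / 2 : ℝ) ^ i) * (R.const * ‖a.2 i‖) := by ring
    _ = _ := by rw [← mul_pow, ← mul_pow]; norm_num; ring

theorem sum_fwdCoord_le (a : S × L1 ℕ E) (N M : ℕ) :
    ∑ i ∈ Finset.range M, ‖R.fwdCoord a (N + 1 + i)‖ ≤ (1 + 2 * R.const) * tail N a.2 := by
  have h1 := sum_add_tail (N + 1) M a.2
  have h2 := sum_add_tail N M a.2
  have h3 := tail_nonneg (N + M) a.2
  have h4 := tail_nonneg (N + 1 + M) a.2
  have h5 := tail_antitone a.2 (Nat.le_succ N)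
  have hc := R.const_nonneg
  calc _ ≤ ∑ i ∈ Finset.range M, (‖a.2 (N + 1 + i)‖ + 2 * R.const * ‖a.2 (N + i)‖) := by
        refine Finset.sum_le_sum fun i _ => ?_
        have := R.norm_fwdCoord_le a (N + i)
        rwa [show N + i + 1 = N + 1 + i by ring] at this
    _ = ∑ i ∈ Finset.range M, ‖a.2 (N + 1 + i)‖ +
        2 * R.const * ∑ i ∈ Finset.range M, ‖a.2 (N + i)‖ := by
        rw [Finset.sum_add_distrib, Finset.mul_sum]
    _ ≤ tail N a.2 + 2 * R.const * tail N a.2 := by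
        gcongr
        · simp only at h5; linarith
        · linarith
    _ = _ := by ring

theorem summable_fwdCoord (a : S × L1 ℕ E) : Summable fun i => ‖R.fwdCoord a i‖ := by
  rw [← summable_nat_add_iff 1]
  refine summable_of_sum_range_le (fun _ => norm_nonneg _) (fun M => ?_)
    (c := (1 + 2 * R.const) * tail 0 a.2)
  simpa [add_comm] using R.sum_fwdCoord_le a 0 M

/-- The map `S × ℓ¹(E) → ℓ¹(E)`. -/
noncomputable def fwd (a : S × L1 ℕ E) : L1 ℕ E := L1.mk (R.fwdCoord a) (R.summable_fwdCoord a)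

theorem continuous_path (i : ℕ) : Continuous fun a => R.path a i :=
  (R.continuous_emb.comp continuous_fst).add
    (((L1.continuous_apply i).comp continuous_snd).const_smul _)

theorem continuous_fwd : Continuous R.fwd := by
  refine continuous_of_tail_le (g := Prod.snd) (C := 1 + 2 * R.const) (fun i => ?_)
    continuous_snd fun a N => ?_
  · cases i with
    | zero => exact R.continuous_path 0
    | succ i =>
      exact ((R.continuous_path _).sub
        (R.continuous_emb.comp (R.continuous_ret.comp (R.continuous_path i)))).const_smul _
  · exact tail_le_of_sum_le fun M => R.sum_fwdCoord_le a (N + 1) M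

/-- The reconstructed path. -/
noncomputable def recon (y : L1 ℕ E) : ℕ → E
  | 0 => y 0
  | i + 1 => (1 / 2 : ℝ) ^ (i + 1) • y (i + 1) + R.emb (R.ret (recon y i))

theorem continuous_recon (i : ℕ) : Continuous fun y => R.recon y i := by
  induction i with
  | zero => exact L1.continuous_apply 0
  | succ i ih =>
    exact ((L1.continuous_apply _).const_smul _).add
      (R.continuous_emb.comp (R.continuous_ret.comp ih))

/-- The retracted points of the reconstructed path. -/
noncomputable def proj (y : L1 ℕ E) (i : ℕ) : E := R.emb (R.ret (R.recon y i))

theorem continuous_proj (i : ℕ) : Continuous fun y => R.proj y i :=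
  R.continuous_emb.comp (R.continuous_ret.comp (R.continuous_recon i))

theorem recon_succ (y : L1 ℕ E) (i : ℕ) :
    R.recon y (i + 1) = (1 / 2 : ℝ) ^ (i + 1) • y (i + 1) + R.proj y i := rfl

theorem dist_proj_succ_le (y : L1 ℕ E) (i : ℕ) :
    dist (R.proj y i) (R.proj y i.succ) ≤ R.const * ((1 / 2 : ℝ) ^ (i + 1) * ‖y (i + 1)‖) := by
  rw [dist_comm, dist_eq_norm]
  refine (R.norm_le _ _).trans ?_
  rw [recon_succ, proj, add_sub_cancel_right, norm_smul, Real.norm_of_nonneg (by positivity)]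

theorem summable_bound (y : L1 ℕ E) :
    Summable fun i => R.const * ((1 / 2 : ℝ) ^ (i + 1) * ‖y (i + 1)‖) := by
  refine Summable.mul_left _ (Summable.of_nonneg_of_le (fun _ => by positivity) (fun i => ?_)
    ((summable_nat_add_iff 1).2 (summable_norm y)))
  exact mul_le_of_le_one_left (norm_nonneg _) (pow_le_one₀ (by norm_num) (by norm_num))

variable [CompleteSpace E]

theorem exists_limit (y : L1 ℕ E) : ∃ q, Tendsto (R.proj y) atTop (𝓝 q) :=
  cauchySeq_tendsto_of_complete
    (cauchySeq_of_dist_le_of_summable _ (R.dist_proj_succ_le y) (R.summable_bound y))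

/-- The limit of the reconstructed path. -/
noncomputable def limit (y : L1 ℕ E) : E := (R.exists_limit y).choose

theorem tendsto_proj (y : L1 ℕ E) : Tendsto (R.proj y) atTop (𝓝 (R.limit y)) :=
  (R.exists_limit y).choose_spec

theorem dist_proj_limit_le (y : L1 ℕ E) (i : ℕ) :
    dist (R.proj y i) (R.limit y) ≤ R.const * ((1 / 2 : ℝ) ^ (i + 1) * tail (i + 1) y) := by
  refine (dist_le_tsum_of_dist_le_of_tendsto _ (R.dist_proj_succ_le y) (R.summable_bound y)
    (R.tendsto_proj y) i).trans ?_
  have h := ((hasSum_tail (i + 1) y).mul_left ((1 / 2 : ℝ) ^ (i + 1))).mul_left R.const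
  refine Summable.tsum_le_of_sum_le ((summable_nat_add_iff i).2 (R.summable_bound y) |>.congr
    fun m => by rw [add_comm m i]) fun s => ?_
  refine le_trans (Finset.sum_le_sum fun m _ => ?_) (sum_le_hasSum s (fun m _ => ?_) h)
  · rw [show i + m + 1 = i + 1 + m by ring]
    gcongr R.const * (?_ * _)
    · exact R.const_nonneg
    · exact pow_le_pow_of_le_one (by norm_num) (by norm_num) (by omega)
  · have := R.const_nonneg
    positivity

theorem continuous_limit : Continuous R.limit := by
  refine TendstoLocallyUniformly.continuous (F := fun i y => R.proj y i) (p := atTop) ?_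
    (Frequently.of_forall fun i => R.continuous_proj i)
  rw [Metric.tendstoLocallyUniformly_iff]
  intro ε hε y
  refine ⟨{z | ‖z‖ < ‖y‖ + 1}, (isOpen_lt continuous_norm continuous_const).mem_nhds (by simp), ?_⟩
  have h : Tendsto (fun i : ℕ => R.const * ((1 / 2 : ℝ) ^ (i + 1) * (‖y‖ + 1))) atTop (𝓝 0) := by
    have := (tendsto_pow_atTop_nhds_zero_of_lt_one (r := (1 / 2 : ℝ)) (by norm_num)
      (by norm_num)).comp (tendsto_add_atTop_nat 1)
    simpa using (this.mul_const (‖y‖ + 1)).const_mul R.const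
  filter_upwards [h.eventually (gt_mem_nhds hε)] with i hi z hz
  rw [dist_comm]
  refine (R.dist_proj_limit_le z i).trans_lt (lt_of_le_of_lt ?_ hi)
  have := R.const_nonneg
  gcongr
  exact (tail_le_norm _ z).trans (le_of_lt hz)

theorem tendsto_recon (y : L1 ℕ E) : Tendsto (R.recon y) atTop (𝓝 (R.limit y)) := by
  rw [← tendsto_add_atTop_iff_nat 1]
  have h : Tendsto (fun i => (1 / 2 : ℝ) ^ (i + 1) • y (i + 1)) atTop (𝓝 0) := by
    refine squeeze_zero_norm (fun i => ?_) ((tendsto_tail y).comp (tendsto_add_atTop_nat 1))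
    rw [norm_smul, Real.norm_of_nonneg (by positivity)]
    exact (mul_le_of_le_one_left (norm_nonneg _) (pow_le_one₀ (by norm_num) (by norm_num))).trans
      (norm_apply_le_tail _ y)
  simpa [recon_succ] using h.add (R.tendsto_proj y)

theorem emb_ret_limit (y : L1 ℕ E) : R.emb (R.ret (R.limit y)) = R.limit y :=
  tendsto_nhds_unique (((R.continuous_emb.comp R.continuous_ret).tendsto _).comp
    (R.tendsto_recon y)) (R.tendsto_proj y)

/-- The coordinates of the `ℓ¹` component of the inverse map. -/
noncomputable def bwdCoord (y : L1 ℕ E) (i : ℕ) : E := (2 : ℝ) ^ i • (R.recon y i - R.limit y)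

theorem sum_bwdCoord_le (y : L1 ℕ E) (N M : ℕ) :
    ∑ i ∈ Finset.range M, ‖R.bwdCoord y (N + 1 + i)‖ ≤ (1 + 3 * R.const) * tail (N + 1) y := by
  have hc := R.const_nonneg
  set g : ℕ → ℝ := fun i => (2 : ℝ) ^ (i + 1) * ‖R.proj y i - R.limit y‖ with hg
  have hgt : ∀ i, g i ≤ R.const * tail (i + 1) y := fun i => by
    have := R.dist_proj_limit_le y i
    rw [dist_eq_norm] at this
    calc g i ≤ 2 ^ (i + 1) * (R.const * ((1 / 2 : ℝ) ^ (i + 1) * tail (i + 1) y)) := by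
          simp only [hg]; gcongr
      _ = (2 ^ (i + 1) * (1 / 2 : ℝ) ^ (i + 1)) * (R.const * tail (i + 1) y) := by ring
      _ = _ := by rw [← mul_pow]; norm_num
  have hgs : ∀ i, g i ≤ R.const * ‖y (i + 1)‖ + g (i + 1) / 2 := fun i => by
    have h1 := R.dist_proj_succ_le y i
    rw [dist_eq_norm] at h1
    have h2 := norm_sub_le_norm_sub_add_norm_sub (R.proj y i) (R.proj y i.succ) (R.limit y)
    have h3 : (2 : ℝ) ^ (i + 1) * (1 / 2 : ℝ) ^ (i + 1) = 1 := by rw [← mul_pow]; norm_num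
    calc g i ≤ 2 ^ (i + 1) * (R.const * ((1 / 2 : ℝ) ^ (i + 1) * ‖y (i + 1)‖) +
          ‖R.proj y (i + 1) - R.limit y‖) := by
          simp only [hg]; gcongr; exact h2.trans (by gcongr)
      _ = (2 ^ (i + 1) * (1 / 2 : ℝ) ^ (i + 1)) * (R.const * ‖y (i + 1)‖) + g (i + 1) / 2 := by
          simp only [hg]; ring
      _ = _ := by rw [h3, one_mul]
  have hw : ∀ i, ‖R.bwdCoord y (i + 1)‖ ≤ ‖y (i + 1)‖ + g i := fun i => by
    have h3 : (2 : ℝ) ^ (i + 1) * (1 / 2 : ℝ) ^ (i + 1) = 1 := by rw [← mul_pow]; norm_num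
    have h4 : R.bwdCoord y (i + 1) =
        y (i + 1) + (2 : ℝ) ^ (i + 1) • (R.proj y i - R.limit y) := by
      rw [bwdCoord, recon_succ, add_sub_assoc, smul_add, smul_smul, h3, one_smul]
    rw [h4]
    refine (norm_add_le _ _).trans ?_
    rw [norm_smul, Real.norm_of_nonneg (by positivity)]
  have hG : ∑ i ∈ Finset.range M, g (N + i) ≤
      2 * R.const * ∑ i ∈ Finset.range M, ‖y (N + 1 + i)‖ + g (N + M) := by
    have h5 : ∑ i ∈ Finset.range M, g (N + i) ≤
        R.const * ∑ i ∈ Finset.range M, ‖y (N + 1 + i)‖ +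
          (∑ i ∈ Finset.range M, g (N + i + 1)) / 2 := by
      rw [Finset.mul_sum, Finset.sum_div, ← Finset.sum_add_distrib]
      refine Finset.sum_le_sum fun i _ => ?_
      rw [show N + 1 + i = N + i + 1 by ring]
      exact hgs (N + i)
    have h6 : ∑ i ∈ Finset.range M, g (N + i + 1) + g N = 
        ∑ i ∈ Finset.range M, g (N + i) + g (N + M) := by
      have := Finset.sum_range_succ (fun i => g (N + i)) M
      rw [← this, Finset.sum_range_succ']
      simp [add_assoc]
    have h7 : 0 ≤ g N := by simp only [hg]; positivity
    linarith
  have h8 := sum_add_tail (N + 1) M y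
  have h9 := hgt (N + M)
  rw [show N + M + 1 = N + 1 + M by ring] at h9
  have h10 := tail_nonneg (N + 1 + M) y
  have h11 : (0 : ℝ) ≤ ∑ i ∈ Finset.range M, ‖y (N + 1 + i)‖ :=
    Finset.sum_nonneg fun _ _ => norm_nonneg _
  calc _ ≤ ∑ i ∈ Finset.range M, (‖y (N + 1 + i)‖ + g (N + i)) := by
        refine Finset.sum_le_sum fun i _ => ?_
        have := hw (N + i)
        rwa [show N + i + 1 = N + 1 + i by ring] at this
    _ ≤ _ := by
        rw [Finset.sum_add_distrib, ← h8]
        nlinarith [mul_nonneg hc h11, mul_nonneg hc h10]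

theorem summable_bwdCoord (y : L1 ℕ E) : Summable fun i => ‖R.bwdCoord y i‖ := by
  rw [← summable_nat_add_iff 1]
  refine summable_of_sum_range_le (fun _ => norm_nonneg _) (fun M => ?_)
    (c := (1 + 3 * R.const) * tail 1 y)
  simpa [add_comm] using R.sum_bwdCoord_le y 0 M

/-- The inverse map `ℓ¹(E) → S × ℓ¹(E)`. -/
noncomputable def bwd (y : L1 ℕ E) : S × L1 ℕ E :=
  (R.ret (R.limit y), L1.mk (R.bwdCoord y) (R.summable_bwdCoord y))

theorem continuous_bwd : Continuous R.bwd := by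
  refine (R.continuous_ret.comp R.continuous_limit).prodMk ?_
  refine continuous_of_tail_le (g := fun y => y) (C := 1 + 3 * R.const) (fun i => ?_)
    continuous_id fun y N => ?_
  · exact ((R.continuous_recon i).sub R.continuous_limit).const_smul _
  · refine (tail_le_of_sum_le fun M => R.sum_bwdCoord_le y (N + 1) M).trans ?_
    have := R.const_nonneg
    gcongr
    exact tail_antitone y (by omega)

theorem path_bwd (y : L1 ℕ E) (i : ℕ) : R.path (R.bwd y) i = R.recon y i := by
  have h3 : (1 / 2 : ℝ) ^ i * (2 : ℝ) ^ i = 1 := by rw [← mul_pow]; norm_num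
  simp only [path, bwd, L1.mk_apply, bwdCoord, smul_smul, h3, one_smul, emb_ret_limit]
  abel

theorem fwd_bwd (y : L1 ℕ E) : R.fwd (R.bwd y) = y := by
  ext i
  cases i with
  | zero => simp [fwd, fwdCoord, path_bwd, recon]
  | succ i =>
    have h3 : (2 : ℝ) ^ (i + 1) * (1 / 2 : ℝ) ^ (i + 1) = 1 := by rw [← mul_pow]; norm_num
    simp only [fwd, L1.mk_apply, fwdCoord, path_bwd, recon, add_sub_cancel_right, smul_smul, h3,
      one_smul]

theorem recon_fwd (a : S × L1 ℕ E) (i : ℕ) : R.recon (R.fwd a) i = R.path a i := by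
  induction i with
  | zero => rfl
  | succ i ih =>
    have h3 : (1 / 2 : ℝ) ^ (i + 1) * (2 : ℝ) ^ (i + 1) = 1 := by rw [← mul_pow]; norm_num
    rw [recon_succ, proj, ih]
    change (1 / 2 : ℝ) ^ (i + 1) • ((2 : ℝ) ^ (i + 1) • (R.path a (i + 1) -
      R.emb (R.ret (R.path a i)))) + _ = _
    rw [smul_smul, h3, one_smul, sub_add_cancel]

theorem limit_fwd (a : S × L1 ℕ E) : R.limit (R.fwd a) = R.emb a.1 := by
  refine tendsto_nhds_unique (R.tendsto_recon _) ?_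
  have h : Tendsto (fun i => (1 / 2 : ℝ) ^ i • a.2 i) atTop (𝓝 0) := by
    refine squeeze_zero_norm (fun i => ?_) (tendsto_tail a.2)
    rw [norm_smul, Real.norm_of_nonneg (by positivity)]
    exact (mul_le_of_le_one_left (norm_nonneg _) (pow_le_one₀ (by norm_num) (by norm_num))).trans
      (norm_apply_le_tail _ _)
  have := h.const_add (R.emb a.1)
  rw [add_zero] at this
  exact this.congr fun i => (R.recon_fwd a i).symm

theorem bwd_fwd (a : S × L1 ℕ E) : R.bwd (R.fwd a) = a := by
  refine Prod.ext ?_ ?_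
  · simp only [bwd, limit_fwd, ret_emb]
  · ext i
    have h3 : (2 : ℝ) ^ i * (1 / 2 : ℝ) ^ i = 1 := by rw [← mul_pow]; norm_num
    simp only [bwd, L1.mk_apply, bwdCoord, limit_fwd, recon_fwd, path, add_sub_cancel_left,
      smul_smul, h3, one_smul]

/-- A retract which is Lipschitz at points is absorbed by `ℓ¹(E)`. -/
noncomputable def homeo : S × L1 ℕ E ≃ₜ L1 ℕ E where
  toFun := R.fwd
  invFun := R.bwd
  left_inv := R.bwd_fwd
  right_inv := R.fwd_bwd
  continuous_toFun := R.continuous_fwd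
  continuous_invFun := R.continuous_bwd

end PointedRetract

/-- The space `ℓ¹` absorbs every retract, Lipschitz at points, of an `ℓ¹` space. -/
theorem PointedRetract.nonempty_homeo {ι : Type*} [Countable ι] [Infinite ι]
    (R : PointedRetract S (L1 ι ℝ)) : Nonempty (S × L1 ℕ ℝ ≃ₜ L1 ℕ ℝ) := by
  obtain ⟨e⟩ : Nonempty (ℕ × ι ≃ ℕ) := by
    have : Infinite (ℕ × ι) := inferInstance
    exact nonempty_equiv_of_countable
  let h : L1 ℕ (L1 ι ℝ) ≃ₜ L1 ℕ ℝ := L1.curry.symm.trans (L1.reindex e)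
  exact ⟨((Homeomorph.refl S).prodCongr h.symm).trans (R.homeo.trans h)⟩

end Absorb

/-! ### Dugundji extension -/

section Dugundji

variable {X E : Type*} [NormedAddCommGroup E] [NormedSpace ℝ E]

/-- The Dugundji extension theorem, with control of the values off the closed set. -/
theorem exists_dugundji [PseudoMetricSpace X] {A : Set X} (hA : IsClosed A) (hne : A.Nonempty)
    {f : X → E} (hf : ContinuousOn f A) :
    ∃ g : X → E, Continuous g ∧ (∀ x ∈ A, g x = f x) ∧
      ∀ x ∉ A, g x ∈ convexHull ℝ (f '' (A ∩ Metric.ball x (2 * Metric.infDist x A))) := by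
  classical
  obtain ⟨h, hh⟩ := exists_continuous_forall_mem_convex_of_local_const (X := (Aᶜ : Set X))
    (t := fun x : (Aᶜ : Set X) =>
      convexHull ℝ (f '' (A ∩ Metric.ball (x : X) (2 * Metric.infDist (x : X) A))))
    (fun x => convex_convexHull ℝ _) (fun x => by
      have hpos : 0 < Metric.infDist (x : X) A := (hA.notMem_iff_infDist_pos hne).1 x.2
      obtain ⟨a, ha, hxa⟩ := (Metric.infDist_lt_iff hne).1
        (show Metric.infDist (x : X) A < 2 * Metric.infDist (x : X) A by linarith)
      refine ⟨f a, ?_⟩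
      have : ∀ᶠ y : X in 𝓝 (x : X), dist y a < 2 * Metric.infDist y A :=
        (isOpen_lt (by fun_prop) ((Metric.continuous_infDist_pt A).const_mul 2)).mem_nhds hxa
      filter_upwards [continuous_subtype_val.continuousAt.eventually this] with y hy
      exact subset_convexHull ℝ _ ⟨a, ⟨ha, by rwa [Metric.mem_ball, dist_comm]⟩, rfl⟩)
  refine ⟨fun x => if hx : x ∈ A then f x else h ⟨x, hx⟩, ?_, fun x hx => dif_pos hx,
    fun x hx => by simpa only [dif_neg hx] using hh ⟨x, hx⟩⟩
  refine continuous_iff_continuousAt.2 fun x => ?_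
  by_cases hx : x ∈ A
  · refine Metric.continuousAt_iff'.2 fun ε hε => ?_
    obtain ⟨δ, hδ, H⟩ := Metric.continuousOn_iff.1 hf x hx (ε / 2) (by positivity)
    filter_upwards [Metric.ball_mem_nhds x (show 0 < δ / 3 by positivity)] with y hy
    rw [Metric.mem_ball] at hy
    simp only [dif_pos hx]
    by_cases hyA : y ∈ A
    · simp only [dif_pos hyA]
      exact (H y hyA (by linarith)).trans (by linarith)
    · simp only [dif_neg hyA]
      have h1 : convexHull ℝ (f '' (A ∩ Metric.ball y (2 * Metric.infDist y A))) ⊆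
          Metric.closedBall (f x) (ε / 2) := by
        refine convexHull_min ?_ (convex_closedBall _ _)
        rintro _ ⟨a, ⟨ha, hya⟩, rfl⟩
        refine (H a ha ?_).le
        have h2 : Metric.infDist y A ≤ dist y x := Metric.infDist_le_dist_of_mem hx
        rw [Metric.mem_ball] at hya
        have := dist_triangle a y x
        linarith
      have := h1 (hh ⟨y, hyA⟩)
      rw [Metric.mem_closedBall] at this
      linarith
  · have h1 : ContinuousOn (fun x => if hx : x ∈ A then f x else h ⟨x, hx⟩) Aᶜ := by
      rw [continuousOn_iff_continuous_domRestrict]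
      convert h.continuous using 1
      ext y
      exact dif_neg y.2
    exact h1.continuousAt (hA.isOpen_compl.mem_nhds hx)

/-- A closed convex subset of a Banach space is a retract, Lipschitz at its points. -/
theorem exists_pointedRetract_of_convex {C : Set E} (hC : IsClosed C) (hconv : Convex ℝ C)
    (hne : C.Nonempty) : ∃ R : PointedRetract C E, R.emb = Subtype.val := by
  obtain ⟨g, hg, hgC, hgn⟩ := exists_dugundji hC hne (f := id) continuousOn_id
  have hmem : ∀ x, g x ∈ C := fun x => by
    by_cases hx : x ∈ C
    · rw [hgC x hx]; exact hx
    · refine convexHull_min ?_ hconv (hgn x hx)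
      rintro _ ⟨a, ha, rfl⟩
      exact ha.1
  refine ⟨⟨Subtype.val, fun z => ⟨g z, hmem z⟩, continuous_subtype_val, hg.subtype_mk _,
    fun p => Subtype.ext (hgC _ p.2), 3, by norm_num, fun z p => ?_⟩, rfl⟩
  have h1 : ‖g z - z‖ ≤ 2 * ‖z - (p : E)‖ := by
    by_cases hz : z ∈ C
    · rw [hgC z hz, id, sub_self, norm_zero]; positivity
    · have h2 : g z ∈ Metric.ball z (2 * Metric.infDist z C) := by
        refine convexHull_min ?_ (convex_ball _ _) (hgn z hz)
        rintro _ ⟨a, ha, rfl⟩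
        exact ha.2
      rw [mem_ball_iff_norm] at h2
      have h3 := Metric.infDist_le_dist_of_mem (x := z) p.2
      rw [dist_eq_norm] at h3
      linarith
  have h4 : g z - p = (g z - z) + (z - p) := by abel
  calc ‖g z - (p : E)‖ ≤ ‖g z - z‖ + ‖z - p‖ := by rw [h4]; exact norm_add_le _ _
    _ ≤ 3 * ‖z - p‖ := by linarith

end Dugundji

/-! ### Truncations of summable sequences -/

namespace L1

/-- Truncation after the first `m` coordinates. -/
noncomputable def trunc (m : ℕ) : L1 ℕ ℝ →L[ℝ] L1 ℕ ℝ :=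
  LinearMap.mkContinuous
    { toFun := fun x => mk (fun i => if i < m then x i else 0)
        ((summable_norm x).of_nonneg_of_le (fun _ => norm_nonneg _) fun i => by
          split_ifs <;> simp)
      map_add' := fun x y => by ext i; simp; split_ifs <;> simp
      map_smul' := fun c x => by ext i; simp }
    1 fun x => by
      rw [one_mul]
      refine norm_le_of_sum_le fun s => (Finset.sum_le_sum fun i _ => ?_).trans (sum_le_norm x s)
      simp only [LinearMap.coe_mk, AddHom.coe_mk, mk_apply]
      split_ifs <;> simp

@[simp] theorem trunc_apply (m : ℕ) (x : L1 ℕ ℝ) (i : ℕ) :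
    trunc m x i = if i < m then x i else 0 := rfl

theorem norm_trunc_le (m : ℕ) (x : L1 ℕ ℝ) : ‖trunc m x‖ ≤ ‖x‖ :=
  norm_le_of_sum_le fun s => (Finset.sum_le_sum fun i _ => by
    rw [trunc_apply]; split_ifs <;> simp).trans (sum_le_norm x s)

theorem norm_sub_trunc (m : ℕ) (x : L1 ℕ ℝ) : ‖x - trunc m x‖ = tail m x := by
  have h1 : HasSum (fun i => ‖trunc m x i‖) (∑ i ∈ Finset.range m, ‖x i‖) := by
    have : ∑ i ∈ Finset.range m, ‖x i‖ = ∑ i ∈ Finset.range m, ‖trunc m x i‖ :=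
      Finset.sum_congr rfl fun i hi => by simp [Finset.mem_range.1 hi]
    rw [this]
    exact hasSum_sum_of_ne_finset_zero fun i hi => by
      rw [Finset.mem_range] at hi; simp [hi]
  have h2 := ((hasSum_norm (x - trunc m x)).add h1).unique
    (by
      convert hasSum_norm x using 2 with i
      rw [sub_apply, trunc_apply]
      split_ifs <;> simp)
  rw [tail]; linarith

/-- The permutation of `ℕ` exchanging the first two blocks of length `m`. -/
def blockSwap (m : ℕ) : Equiv.Perm ℕ :=
  Function.Involutive.toPerm
    (fun i => if i < m then m + i else if i < 2 * m then i - m else i) fun i => by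
      dsimp only; split_ifs <;> omega

theorem blockSwap_apply (m i : ℕ) :
    blockSwap m i = if i < m then m + i else if i < 2 * m then i - m else i := rfl

/-- Exchange of the first two blocks of `m` coordinates. -/
noncomputable def swapFun (m : ℕ) (x : L1 ℕ ℝ) : L1 ℕ ℝ :=
  mk (fun i => x (blockSwap m i))
    ((blockSwap m).summable_iff (f := fun i => ‖x i‖) |>.2 (summable_norm x))

theorem norm_swapFun (m : ℕ) (x : L1 ℕ ℝ) : ‖swapFun m x‖ = ‖x‖ := by
  rw [norm_eq, norm_eq]
  exact (blockSwap m).tsum_eq fun i => ‖x i‖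

/-- Exchange of the first two blocks of `m` coordinates, as a linear map. -/
noncomputable def swap (m : ℕ) : L1 ℕ ℝ →L[ℝ] L1 ℕ ℝ :=
  LinearMap.mkContinuous
    { toFun := swapFun m
      map_add' := fun x y => by ext i; rfl
      map_smul' := fun c x => by ext i; rfl }
    1 fun x => by
      rw [one_mul]
      exact (norm_swapFun m x).le

@[simp] theorem swap_apply (m : ℕ) (x : L1 ℕ ℝ) (i : ℕ) : swap m x i = x (blockSwap m i) := rfl

theorem norm_swap (m : ℕ) (x : L1 ℕ ℝ) : ‖swap m x‖ = ‖x‖ := norm_swapFun m x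

theorem trunc_trunc (m : ℕ) (x : L1 ℕ ℝ) : trunc m (trunc m x) = trunc m x := by
  ext i; simp only [trunc_apply]; split_ifs <;> rfl

theorem swap_swap (m : ℕ) (x : L1 ℕ ℝ) : swap m (swap m x) = x := by
  ext i
  have h : blockSwap m (blockSwap m i) = i := by
    simp only [blockSwap_apply]
    split_ifs <;> omega
  rw [swap_apply, swap_apply, h]

theorem trunc_swap_trunc (m : ℕ) (x : L1 ℕ ℝ) : trunc m (swap m (trunc m x)) = 0 := by
  ext i
  simp only [trunc_apply, swap_apply, zero_apply, blockSwap_apply]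
  split_ifs <;> first | rfl | omega

theorem norm_trunc_swap_le (m : ℕ) (x : L1 ℕ ℝ) : ‖trunc m (swap m x)‖ ≤ tail m x := by
  have : trunc m (swap m x) = trunc m (swap m (x - trunc m x)) := by
    rw [map_sub, map_sub, trunc_swap_trunc, sub_zero]
  rw [this, ← norm_sub_trunc, ← norm_swap m (x - trunc m x)]
  exact norm_trunc_le _ _

theorem exists_tail_lt {D : Set (L1 ℕ ℝ)} (hD : IsCompact D) {δ : ℝ} (hδ : 0 < δ) :
    ∃ N, ∀ u ∈ D, tail N u < δ := by
  obtain ⟨N, hN⟩ := hD.elim_directed_cover (fun n => {u | tail n u < δ})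
    (fun n => isOpen_lt (continuous_tail n) continuous_const)
    (fun u _ => by
      obtain ⟨n, hn⟩ := ((tendsto_tail u).eventually (gt_mem_nhds hδ)).exists
      exact mem_iUnion.2 ⟨n, hn⟩)
    (Monotone.directed_le fun n m h u hu => (tail_antitone u h).trans_lt hu)
  exact ⟨N, hN⟩

end L1

/-! ### Radial retractions -/

section Radial

variable {E : Type*} [NormedAddCommGroup E] [NormedSpace ℝ E]

/-- The radial retraction onto the ball of radius `r`. -/
noncomputable def radial (r : ℝ) (x : E) : E := (r / max r ‖x‖) • x

theorem radial_of_le {r : ℝ} (hr : 0 < r) {x : E} (hx : ‖x‖ ≤ r) : radial r x = x := by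
  rw [radial, max_eq_left hx, div_self hr.ne', one_smul]

theorem norm_radial_le {r : ℝ} (hr : 0 < r) (x : E) : ‖radial r x‖ ≤ r := by
  have h : 0 < max r ‖x‖ := lt_max_of_lt_left hr
  rw [radial, norm_smul, Real.norm_of_nonneg (by positivity), div_mul_eq_mul_div, div_le_iff₀ h]
  exact mul_le_mul_of_nonneg_left (le_max_right _ _) hr.le

theorem lipschitzWith_radial {r : ℝ} (hr : 0 < r) :
    LipschitzWith 2 (radial r : E → E) := by
  refine LipschitzWith.of_dist_le_mul fun x y => ?_
  rw [dist_eq_norm, dist_eq_norm]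
  set a := max r ‖x‖ with ha
  set b := max r ‖y‖ with hb
  have ha0 : 0 < a := lt_max_of_lt_left hr
  have hb0 : 0 < b := lt_max_of_lt_left hr
  have h1 : radial r x - radial r y = (r / a) • (x - y) + (r / a - r / b) • y := by
    simp only [radial, ← ha, ← hb, smul_sub, sub_smul]; abel
  have h2 : r / a ≤ 1 := (div_le_one ha0).2 (le_max_left _ _)
  have h3 : ‖y‖ / b ≤ 1 := (div_le_one hb0).2 (le_max_right _ _)
  have h4 : |b - a| ≤ ‖x - y‖ := by
    rw [hb, ha]
    refine (abs_max_sub_max_le_max _ _ _ _).trans (max_le (by simp) ?_)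
    rw [norm_sub_rev]
    exact abs_norm_sub_norm_le y x
  have h5 : |r / a - r / b| * ‖y‖ ≤ ‖x - y‖ := by
    have : r / a - r / b = r / a * ((b - a) / b) := by field_simp
    rw [this, abs_mul, abs_div (b - a), abs_of_pos hb0, abs_of_nonneg (by positivity : 0 ≤ r / a)]
    calc r / a * (|b - a| / b) * ‖y‖ = r / a * |b - a| * (‖y‖ / b) := by ring
      _ ≤ 1 * ‖x - y‖ * 1 := by gcongr
      _ = _ := by ring
  rw [h1]
  refine (norm_add_le _ _).trans ?_
  rw [norm_smul, norm_smul, Real.norm_of_nonneg (by positivity : 0 ≤ r / a), Real.norm_eq_abs]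
  have h6 : r / a * ‖x - y‖ ≤ 1 * ‖x - y‖ := by gcongr
  norm_num
  linarith

end Radial

/-! ### Pushing closed sets off compacta -/

/-- The shear homeomorphism `x ↦ x + G (π x)`. -/
def shear {E : Type*} [NormedAddCommGroup E] [NormedSpace ℝ E] (π : E →L[ℝ] E) {G : E → E}
    (hG : Continuous G) (h : ∀ x, π (G x) = 0) : E ≃ₜ E where
  toFun x := x + G (π x)
  invFun x := x - G (π x)
  left_inv x := by simp [h]
  right_inv x := by simp [h]
  continuous_toFun := by fun_prop
  continuous_invFun := by fun_prop

/-- A uniformly continuous map which moves the points of a compactum off a closed set and by less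
than `ε` can be replaced by a homeomorphism. -/
theorem exists_homeo_push {D K : Set (L1 ℕ ℝ)} (hD : IsCompact D) (hK : IsClosed K)
    {φ : L1 ℕ ℝ → L1 ℕ ℝ} (hφ : UniformContinuous φ) {ε : ℝ} (hε : 0 < ε)
    (hφε : ∀ u ∈ D, ‖φ u - u‖ ≤ ε) (hφK : ∀ u ∈ D, φ u ∉ K) :
    ∃ g : L1 ℕ ℝ ≃ₜ L1 ℕ ℝ, (∀ x, ‖g x - x‖ ≤ 2 * ε) ∧ (∀ x, ‖g.symm x - x‖ ≤ 2 * ε) ∧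
      UniformContinuous g.symm ∧ ∀ u ∈ D, g u ∉ K := by
  obtain ⟨δ, hδ, hδK⟩ := (hD.image hφ.continuous).exists_thickening_subset_open hK.isOpen_compl
    (by rintro _ ⟨u, hu, rfl⟩; exact hφK u hu)
  obtain ⟨R, hR, hDR⟩ := hD.isBounded.exists_pos_norm_le
  set ξ : L1 ℕ ℝ → L1 ℕ ℝ := fun u => radial ε (φ u - u) with hξ
  have hξu : UniformContinuous ξ :=
    (lipschitzWith_radial hε).uniformContinuous.comp (hφ.sub uniformContinuous_id)
  have hξD : ∀ u ∈ D, ξ u = φ u - u := fun u hu => radial_of_le hε (hφε u hu)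
  obtain ⟨ω, hω, hωξ⟩ := Metric.uniformContinuous_iff.1 hξu (δ / 3) (by positivity)
  set η : ℝ := min (ε / R) (δ / 4 / R) with hη
  have hη0 : 0 < η := by positivity
  have hη1 : η * R ≤ ε := by rw [← le_div_iff₀ hR]; exact min_le_left _ _
  have hη2 : η * R ≤ δ / 4 := by rw [← le_div_iff₀ hR]; exact min_le_right _ _
  obtain ⟨m₁, hm₁⟩ := L1.exists_tail_lt hD (δ := ω / (η⁻¹ + 1)) (by positivity)
  obtain ⟨m₂, hm₂⟩ := L1.exists_tail_lt (hD.image hξu.continuous) (δ := δ / 4) (by positivity)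
  set m := max m₁ m₂
  have ht₁ : ∀ u ∈ D, (η⁻¹ + 1) * L1.tail m u < ω := fun u hu => by
    rw [mul_comm, ← lt_div_iff₀ (by positivity)]
    exact (L1.tail_antitone u (le_max_left _ _)).trans_lt (hm₁ u hu)
  have ht₂ : ∀ u ∈ D, L1.tail m (ξ u) < δ / 4 := fun u hu =>
    (L1.tail_antitone _ (le_max_right _ _)).trans_lt (hm₂ _ ⟨u, hu, rfl⟩)
  set P := L1.trunc m
  set T := L1.swap m
  set G₁ : L1 ℕ ℝ → L1 ℕ ℝ := fun y => η • T (radial R (P y)) with hG₁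
  set G₂ : L1 ℕ ℝ → L1 ℕ ℝ := fun y => P (ξ (η⁻¹ • y)) with hG₂
  have hG₁u : UniformContinuous G₁ :=
    (T.uniformContinuous.comp
      ((lipschitzWith_radial hR).uniformContinuous.comp P.uniformContinuous)).const_smul η
  have hG₂u : UniformContinuous G₂ :=
    P.uniformContinuous.comp (hξu.comp (uniformContinuous_id.const_smul η⁻¹))
  have hG₁b : ∀ y, ‖G₁ y‖ ≤ ε := fun y => by
    simp only [hG₁]
    rw [norm_smul, L1.norm_swap, Real.norm_of_nonneg hη0.le]
    exact (mul_le_mul_of_nonneg_left (norm_radial_le hR _) hη0.le).trans hη1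
  have hG₂b : ∀ y, ‖G₂ y‖ ≤ ε := fun y =>
    (L1.norm_trunc_le _ _).trans (norm_radial_le hε _)
  have hP : ∀ y, P (P y) = P y := L1.trunc_trunc m
  have hPTP : ∀ y, P (T (P y)) = 0 := L1.trunc_swap_trunc m
  let α := shear P hG₁u.continuous fun x => by
    simp only [hG₁, radial, map_smul, hPTP, smul_zero]
  let β := shear (P.comp T) hG₂u.continuous fun x => hPTP _
  have hα : ∀ x, α x = x + G₁ (P x) := fun _ => rfl
  have hβ : ∀ x, β x = x + G₂ (P (T x)) := fun _ => rfl
  have hα' : ∀ x, α.symm x = x - G₁ (P x) := fun _ => rfl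
  have hβ' : ∀ x, β.symm x = x - G₂ (P (T x)) := fun _ => rfl
  refine ⟨α.trans β, fun x => ?_, fun x => ?_, ?_, fun u hu => ?_⟩
  · rw [Homeomorph.trans_apply, hβ, hα]
    set z := x + G₁ (P x) with hz
    have : z + G₂ (P (T z)) - x = G₁ (P x) + G₂ (P (T z)) := by
      rw [hz]; abel
    rw [this]
    refine (norm_add_le _ _).trans ?_
    linarith [hG₁b (P x), hG₂b (P (T z))]
  · change ‖α.symm (β.symm x) - x‖ ≤ _
    rw [hα']
    set z := β.symm x with hz
    rw [hβ'] at hz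
    have : z - G₁ (P z) - x = -(G₁ (P z) + G₂ (P (T x))) := by
      rw [hz]; abel
    rw [this, norm_neg]
    refine (norm_add_le _ _).trans ?_
    linarith [hG₁b (P z), hG₂b (P (T x))]
  · have h1 : UniformContinuous α.symm :=
      uniformContinuous_id.sub (hG₁u.comp P.uniformContinuous)
    have h2 : UniformContinuous β.symm :=
      uniformContinuous_id.sub (hG₂u.comp (P.uniformContinuous.comp T.uniformContinuous))
    exact h1.comp h2
  · refine hδK (Metric.mem_thickening_iff.2 ⟨φ u, ⟨u, hu, rfl⟩, ?_⟩)
    have e1 : G₁ (P u) = η • T (P u) := by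
      simp only [hG₁, hP]
      rw [radial_of_le hR ((L1.norm_trunc_le _ _).trans (hDR u hu))]
    have e2 : P (T (α u)) = P (T u) + η • P u := by
      rw [hα, e1, map_add, map_add, map_smul, map_smul, L1.swap_swap, hP]
    have e3 : α.trans β u = u + η • T (P u) + P (ξ (η⁻¹ • P (T u) + P u)) := by
      rw [Homeomorph.trans_apply, hβ, e2]
      simp only [hG₂, smul_add, smul_smul, inv_mul_cancel₀ hη0.ne', one_smul]
      rw [hα, e1]
    set w := η⁻¹ • P (T u) + P u with hw
    have e4 : dist w u < ω := by
      refine lt_of_le_of_lt ?_ (ht₁ u hu)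
      rw [dist_eq_norm, hw, add_sub_assoc]
      refine (norm_add_le _ _).trans ?_
      rw [norm_smul, norm_sub_rev, L1.norm_sub_trunc, Real.norm_of_nonneg (by positivity), add_mul,
        one_mul]
      gcongr
      exact L1.norm_trunc_swap_le _ _
    have e5 := hωξ e4
    have e6 : α.trans β u - φ u = η • T (P u) + P (ξ w - ξ u) - (ξ u - P (ξ u)) := by
      rw [e3, map_sub, hξD u hu]; abel
    rw [dist_eq_norm, e6]
    refine (norm_sub_le _ _).trans_lt ?_
    have e7 := norm_add_le (η • T (P u)) (P (ξ w - ξ u))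
    have e8 : ‖η • T (P u)‖ ≤ η * R := by
      rw [norm_smul, L1.norm_swap, Real.norm_of_nonneg hη0.le]
      exact mul_le_mul_of_nonneg_left ((L1.norm_trunc_le _ _).trans (hDR u hu)) hη0.le
    have e9 := L1.norm_trunc_le m (ξ w - ξ u)
    have e10 := L1.norm_sub_trunc m (ξ u)
    have e11 := ht₂ u hu
    rw [dist_eq_norm] at e5
    change ‖P (ξ w - ξ u)‖ ≤ _ at e9
    change ‖ξ u - P (ξ u)‖ = _ at e10
    linarith

section Baire

open scoped BoundedContinuousFunction

/-- Pairs `(a, b)` such that `id + a` and `id + b` are mutually inverse, with uniformly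
continuous `b`. -/
def inversePairs (E : Type*) [NormedAddCommGroup E] : Set ((E →ᵇ E) × (E →ᵇ E)) :=
  {p | UniformContinuous p.2 ∧ ∀ x, p.2 x + p.1 (x + p.2 x) = 0 ∧ p.1 x + p.2 (x + p.1 x) = 0}

theorem isClosed_setOf_uniformContinuous (E : Type*) [NormedAddCommGroup E] :
    IsClosed {f : E →ᵇ E | UniformContinuous f} := by
  refine isClosed_of_closure_subset fun f hf => Metric.uniformContinuous_iff.2 fun ε hε => ?_
  obtain ⟨g, hg, hfg⟩ := Metric.mem_closure_iff.1 hf (ε / 3) (by positivity)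
  obtain ⟨δ, hδ, H⟩ := Metric.uniformContinuous_iff.1 hg (ε / 3) (by positivity)
  refine ⟨δ, hδ, fun {a b} hab => ?_⟩
  have h1 := f.dist_coe_le_dist (g := g) a
  have h2 := f.dist_coe_le_dist (g := g) b
  have h3 := H hab
  have h4 := dist_triangle4 (f a) (g a) (g b) (f b)
  rw [dist_comm (g b)] at h4
  linarith

theorem isClosed_inversePairs (E : Type*) [NormedAddCommGroup E] : IsClosed (inversePairs E) := by
  have key : ∀ (f g : (E →ᵇ E) × (E →ᵇ E) → (E →ᵇ E)) (x : E), Continuous f → Continuous g →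
      IsClosed {p | g p x + f p (x + g p x) = 0} := fun f g x hf hg => by
    have h1 : Continuous fun p => g p x := (continuous_eval_const x).comp hg
    exact isClosed_eq (h1.add (continuous_eval.comp (hf.prodMk (continuous_const.add h1))))
      continuous_const
  have h : inversePairs E = {p | UniformContinuous p.2} ∩
      ⋂ x, ({p | p.2 x + p.1 (x + p.2 x) = 0} ∩ {p | p.1 x + p.2 (x + p.1 x) = 0}) := by
    ext p; simp [inversePairs]
  rw [h]
  exact ((isClosed_setOf_uniformContinuous E).preimage continuous_snd).inter
    (isClosed_iInter fun x => (key _ _ x continuous_fst continuous_snd).inter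
      (key _ _ x continuous_snd continuous_fst))

/-- The homeomorphism determined by a pair of mutually inverse perturbations of the identity. -/
def homeoOfPair {E : Type*} [NormedAddCommGroup E] (p : inversePairs E) : E ≃ₜ E where
  toFun x := x + p.1.1 x
  invFun x := x + p.1.2 x
  left_inv x := by dsimp only; rw [add_assoc, (p.2.2 x).2, add_zero]
  right_inv x := by dsimp only; rw [add_assoc, (p.2.2 x).1, add_zero]
  continuous_toFun := by fun_prop
  continuous_invFun := by fun_prop

/-- The parametrized cube `{x : |x i| ≤ R for i < R, x i = 0 for i ≥ R}`. -/
noncomputable def cube (R : ℕ) (q : HCube) : L1 ℕ ℝ :=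
  L1.mk (fun i => if i < R then R * (2 * (q i : ℝ) - 1) else 0)
    (summable_of_ne_finset_zero (s := Finset.range R) fun i hi => by
      rw [Finset.mem_range] at hi; simp [hi])

theorem continuous_cube (R : ℕ) : Continuous (cube R) := by
  refine L1.continuous_of_dominated (b := fun i => if i < R then (R : ℝ) else 0) (fun i => ?_)
    (summable_of_ne_finset_zero (s := Finset.range R) fun i hi => by
      rw [Finset.mem_range] at hi; simp [hi]) fun q i => ?_
  · simp only [cube, L1.mk_apply]
    split_ifs <;> fun_prop
  · simp only [cube, L1.mk_apply]
    split_ifs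
    · rw [norm_mul, Real.norm_of_nonneg (Nat.cast_nonneg R), Real.norm_eq_abs]
      refine mul_le_of_le_one_right (Nat.cast_nonneg R) ?_
      rw [abs_le]
      constructor <;> linarith [(q i).2.1, (q i).2.2]
    · simp

/-- A uniformly continuous retraction of `ℓ¹` to a cube. -/
noncomputable def cubeCoord (R : ℕ) (x : L1 ℕ ℝ) : HCube :=
  fun i => projIcc 0 1 zero_le_one ((x i / R + 1) / 2)

theorem uniformContinuous_cubeCoord (R : ℕ) : UniformContinuous (cubeCoord R) := by
  rw [uniformContinuous_pi]
  intro i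
  refine (LipschitzWith.projIcc zero_le_one).uniformContinuous.comp ?_
  have h : UniformContinuous fun x : L1 ℕ ℝ => x i :=
    (lp.lipschitzWith_one_eval (E := fun _ : ℕ => ℝ) 1 i).uniformContinuous
  have h2 := ((h.const_mul' (R : ℝ)⁻¹).add (uniformContinuous_const (b := (1 : ℝ)))).const_mul'
    (2 : ℝ)⁻¹
  simpa only [div_eq_inv_mul] using h2

theorem cube_cubeCoord (R : ℕ) (q : HCube) : cube R (cubeCoord R (cube R q)) = cube R q := by
  ext i
  change (if i < R then _ else _) = if i < R then _ else _
  split_ifs with h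
  · have hR : (R : ℝ) ≠ 0 := by
      have : R ≠ 0 := by omega
      exact_mod_cast this
    have : cubeCoord R (cube R q) i = q i := by
      simp only [cubeCoord, cube, L1.mk_apply, if_pos h]
      rw [mul_div_cancel_left₀ _ hR, sub_add_cancel, mul_div_cancel_left₀ _ two_ne_zero,
        projIcc_val]
    rw [this]
  · rfl

theorem exists_cube_eq_trunc (n : ℕ) (x : L1 ℕ ℝ) : ∃ R q, cube R q = L1.trunc n x := by
  obtain ⟨M, hM⟩ := exists_nat_ge ‖x‖
  set R := max (max n M) 1
  have hR : (0 : ℝ) < R := by exact_mod_cast (by omega : 0 < R)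
  have hMR : (M : ℝ) ≤ R := by exact_mod_cast (by omega : M ≤ R)
  refine ⟨R, cubeCoord R (L1.trunc n x), ?_⟩
  ext i
  simp only [cube, L1.mk_apply]
  split_ifs with h
  · have h1 : |L1.trunc n x i| ≤ R :=
      ((L1.norm_apply_le (L1.trunc n x) i).trans ((L1.norm_trunc_le n x).trans hM)).trans hMR
    have h2 := abs_le.1 ((abs_div _ _).trans_le
      ((div_le_one (abs_pos.2 hR.ne')).2 (h1.trans (le_abs_self _))))
    rw [cubeCoord, projIcc_of_mem zero_le_one ⟨by linarith [h2.1], by linarith [h2.2]⟩]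
    field_simp
    ring
  · rw [L1.trunc_apply, if_neg (by omega)]

variable {K : Set (L1 ℕ ℝ)}

/-- The pairs for which `id + a` moves the cube off `K`. -/
def avoiding (K : Set (L1 ℕ ℝ)) (R : ℕ) : Set (inversePairs (L1 ℕ ℝ)) :=
  {p | ∀ q, homeoOfPair p (cube R q) ∉ K}

theorem isOpen_avoiding (hK : IsClosed K) (R : ℕ) : IsOpen (avoiding K R) := by
  have h : Continuous fun t : inversePairs (L1 ℕ ℝ) × HCube => homeoOfPair t.1 (cube R t.2) := by
    have h1 := (continuous_cube R).comp (continuous_snd (X := inversePairs (L1 ℕ ℝ)))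
    refine h1.add ?_
    exact continuous_eval.comp
      ((continuous_fst.comp (continuous_subtype_val.comp continuous_fst)).prodMk h1)
  have h2 := isClosedMap_fst_of_compactSpace _ (hK.preimage h)
  rw [← isOpen_compl_iff] at h2
  convert h2 using 1
  ext p
  simp [avoiding]

theorem dense_avoiding (hK : IsClosed K) (hZ : IsZType K) (R : ℕ) : Dense (avoiding K R) := by
  refine Metric.dense_iff.2 fun p r hr => ?_
  set h := homeoOfPair p with hh
  have hku : UniformContinuous h.symm := uniformContinuous_id.add p.2.1
  obtain ⟨δ, hδ, hkδ⟩ := Metric.uniformContinuous_iff.1 hku (r / 2) (by positivity)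
  set ε := min (r / 6) (δ / 3) with hε
  have hε0 : 0 < ε := by positivity
  have hε1 : ε ≤ r / 6 := min_le_left _ _
  have hε2 : ε ≤ δ / 3 := min_le_right _ _
  obtain ⟨f, hf, hfK, hfd⟩ := hZ ε hε0 (fun q => h (cube R q))
    (h.continuous.comp (continuous_cube R))
  have hφ : UniformContinuous fun u => f (cubeCoord R (h.symm u)) :=
    (CompactSpace.uniformContinuous_of_continuous hf).comp
      ((uniformContinuous_cubeCoord R).comp hku)
  obtain ⟨g, hg1, hg2, hgu, hgK⟩ := exists_homeo_push
    (D := range fun q => h (cube R q)) (isCompact_range (h.continuous.comp (continuous_cube R)))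
    hK hφ hε0 (by
      rintro _ ⟨q, rfl⟩
      have := hfd (cubeCoord R (cube R q))
      rw [cube_cubeCoord, dist_comm, dist_eq_norm] at this
      simpa using this.le)
    (by
      rintro _ ⟨q, rfl⟩ hmem
      exact (Set.eq_empty_iff_forall_notMem.1 hfK) _ ⟨⟨_, rfl⟩, hmem⟩)
  set h' := h.trans g with hh'
  have ha : ∀ x, ‖h' x - h x‖ ≤ 2 * ε := fun x => hg1 _
  have hb : ∀ x, ‖h'.symm x - h.symm x‖ ≤ r / 2 := fun x => by
    rw [← dist_eq_norm]
    refine (hkδ ?_).le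
    rw [dist_eq_norm]
    exact (hg2 x).trans_lt (by linarith)
  have h1 : ∀ x, h x = x + p.1.1 x := fun _ => rfl
  have h2 : ∀ x, h.symm x = x + p.1.2 x := fun _ => rfl
  let A : L1 ℕ ℝ →ᵇ L1 ℕ ℝ := BoundedContinuousFunction.ofNormedAddCommGroup
    (fun x => h' x - x) (by fun_prop) (2 * ε + ‖p.1.1‖) fun x => by
      have : h' x - x = h' x - h x + p.1.1 x := by rw [h1]; abel
      rw [this]
      exact (norm_add_le _ _).trans (add_le_add (ha x) (p.1.1.norm_coe_le_norm x))
  let B : L1 ℕ ℝ →ᵇ L1 ℕ ℝ := BoundedContinuousFunction.ofNormedAddCommGroup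
    (fun x => h'.symm x - x) (by fun_prop) (r / 2 + ‖p.1.2‖) fun x => by
      have : h'.symm x - x = h'.symm x - h.symm x + p.1.2 x := by rw [h2]; abel
      rw [this]
      exact (norm_add_le _ _).trans (add_le_add (hb x) (p.1.2.norm_coe_le_norm x))
  have hA : ∀ x, A x = h' x - x := fun _ => rfl
  have hB : ∀ x, B x = h'.symm x - x := fun _ => rfl
  have hmem : (A, B) ∈ inversePairs (L1 ℕ ℝ) := by
    refine ⟨(hku.comp hgu).sub uniformContinuous_id, fun x => ⟨?_, ?_⟩⟩
    · simp only [hA, hB, add_sub_cancel, Homeomorph.apply_symm_apply, sub_add_sub_cancel, sub_self]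
    · simp only [hA, hB, add_sub_cancel, Homeomorph.symm_apply_apply, sub_add_sub_cancel, sub_self]
  refine ⟨⟨(A, B), hmem⟩, ?_, fun q => ?_⟩
  · rw [Metric.mem_ball, Subtype.dist_eq, Prod.dist_eq]
    refine lt_of_le_of_lt (max_le ?_ ?_) (half_lt_self hr)
    · refine (BoundedContinuousFunction.dist_le (by positivity)).2 fun x => ?_
      rw [dist_eq_norm, hA, sub_sub, ← h1]
      linarith [ha x]
    · refine (BoundedContinuousFunction.dist_le (by positivity)).2 fun x => ?_
      rw [dist_eq_norm, hB, sub_sub, ← h2]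
      exact hb x
  · have : homeoOfPair ⟨(A, B), hmem⟩ (cube R q) = h' (cube R q) := by
      change _ + (h' _ - _) = _
      rw [add_sub_cancel]
    rw [this]
    exact hgK _ ⟨q, rfl⟩

/-- A `Z`-set in `ℓ¹` can be pushed off all finite sequences. -/
theorem exists_homeo_trunc_notMem (hK : IsClosed K) (hZ : IsZType K) :
    ∃ h : L1 ℕ ℝ ≃ₜ L1 ℕ ℝ, ∀ n x, h (L1.trunc n x) ∉ K := by
  have : CompleteSpace (inversePairs (L1 ℕ ℝ)) :=
    (isClosed_inversePairs _).completeSpace_coe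
  have : Nonempty (inversePairs (L1 ℕ ℝ)) :=
    ⟨⟨(0, 0), uniformContinuous_const, by simp⟩⟩
  obtain ⟨p, hp⟩ := (dense_iInter_of_isOpen_nat (fun R => isOpen_avoiding hK R)
    fun R => dense_avoiding hK hZ R).nonempty
  refine ⟨homeoOfPair p, fun n x => ?_⟩
  obtain ⟨R, q, h⟩ := exists_cube_eq_trunc n x
  rw [← h]
  exact mem_iInter.1 hp R q

end Baire

/-- Homeomorphisms preserve sets of type `Z`. -/
theorem IsZType.preimage {S T : Type*} [MetricSpace S] [MetricSpace T] {K : Set T}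
    (hK : IsZType K) (h : S ≃ₜ T) : IsZType (h ⁻¹' K) := by
  intro ε hε f hf
  have hC : IsCompact (range (h ∘ f)) := isCompact_range (h.continuous.comp hf)
  have h1 := hC.uniformContinuousAt_of_continuousAt h.symm
    (fun a _ => h.symm.continuous.continuousAt) (Metric.dist_mem_uniformity hε)
  obtain ⟨δ, hδ, H⟩ := Metric.mem_uniformity_dist.1 h1
  obtain ⟨g, hg, hgK, hgd⟩ := hK δ hδ (h ∘ f) (h.continuous.comp hf)
  refine ⟨h.symm ∘ g, h.symm.continuous.comp hg, ?_, fun q => ?_⟩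
  · refine Set.eq_empty_iff_forall_notMem.2 ?_
    rintro _ ⟨⟨q, rfl⟩, hq⟩
    refine Set.eq_empty_iff_forall_notMem.1 hgK (g q) ⟨⟨q, rfl⟩, ?_⟩
    simpa using hq
  · have := H (hgd q) ⟨q, rfl⟩
    simpa using this

/-! ### Absorption of a closed set missing all finite sequences -/

section Rescale

variable {X E : Type*} [TopologicalSpace X] [NormedAddCommGroup E] [NormedSpace ℝ E]

/-- Changing the norm of a vector continuously. -/
theorem continuous_rescale {v : X → E} {σ : X → ℝ} (hv : Continuous v) (hσ : Continuous σ)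
    (h0 : ∀ x, v x = 0 → σ x = 0) : Continuous fun x => (σ x / ‖v x‖) • v x := by
  refine continuous_iff_continuousAt.2 fun x => ?_
  by_cases hx : v x = 0
  · have h1 : ∀ y, ‖(σ y / ‖v y‖) • v y‖ ≤ |σ y| := fun y => by
      rw [norm_smul, norm_div, norm_norm, Real.norm_eq_abs]
      by_cases hy : v y = 0
      · simp [hy]
      · rw [div_mul_cancel₀ _ (norm_ne_zero_iff.2 hy)]
    rw [ContinuousAt, hx, smul_zero]
    refine squeeze_zero_norm h1 ?_
    have := hσ.abs.tendsto x
    rwa [h0 x hx, abs_zero] at this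
  · exact ((hσ.continuousAt.div hv.norm.continuousAt (norm_ne_zero_iff.2 hx))).smul
      hv.continuousAt

theorem norm_rescale {v : E} {σ : ℝ} (hσ : 0 ≤ σ) (h0 : v = 0 → σ = 0) :
    ‖(σ / ‖v‖) • v‖ = σ := by
  by_cases hv : v = 0
  · simp [hv, h0 hv]
  · rw [norm_smul, norm_div, norm_norm, Real.norm_of_nonneg hσ,
      div_mul_cancel₀ _ (norm_ne_zero_iff.2 hv)]

end Rescale

/-- The projective transformation of the segment `e + s = const` with weights `A`, `B`. -/
noncomputable def mob (A B e s : ℝ) : ℝ := (e + s) * (A * e / (A * e + B * s))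

section Mob

variable {A B e s : ℝ}

theorem mob_nonneg (hA : 0 < A) (hB : 0 < B) (he : 0 ≤ e) (hs : 0 ≤ s) : 0 ≤ mob A B e s := by
  unfold mob; positivity

theorem mob_add (hA : 0 < A) (hB : 0 < B) (he : 0 ≤ e) (hs : 0 ≤ s) :
    mob A B e s + (e + s) * (B * s / (A * e + B * s)) = e + s := by
  unfold mob
  rcases (add_nonneg he hs).eq_or_lt with h | h
  · rw [← h]; simp
  · have h1 : 0 < A * e + B * s := by
      rcases he.eq_or_lt with h' | h'
      · have : 0 < s := by linarith
        positivity
      · positivity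
    rw [← mul_add, ← add_div, div_self h1.ne', mul_one]

theorem mob_le (hA : 0 < A) (hB : 0 < B) (he : 0 ≤ e) (hs : 0 ≤ s) : mob A B e s ≤ e + s := by
  have h1 := mob_add hA hB he hs
  have h2 : 0 ≤ (e + s) * (B * s / (A * e + B * s)) := by positivity
  linarith

theorem mob_of_right (hA : 0 < A) : mob A B e 0 = e := by
  unfold mob
  by_cases he : e = 0
  · simp [he]
  · field_simp; simp

theorem mob_mob (hA : 0 < A) (hB : 0 < B) (he : 0 ≤ e) (hs : 0 ≤ s) :
    mob B A (mob A B e s) (e + s - mob A B e s) = e := by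
  have h1 : e + s - mob A B e s = (e + s) * (B * s / (A * e + B * s)) := by
    linarith [mob_add hA hB he hs]
  rcases (add_nonneg he hs).eq_or_lt with h | h
  · have h2 : e = 0 := by linarith
    have h3 : s = 0 := by linarith
    simp [mob, h2, h3]
  · have h2 : 0 < A * e + B * s := by
      rcases he.eq_or_lt with h' | h'
      · have : 0 < s := by linarith
        positivity
      · positivity
    have h3 : mob A B e s + (e + s - mob A B e s) = e + s := by ring
    rw [mob, h3, h1, mob]
    have h4 : B * ((e + s) * (A * e / (A * e + B * s))) +
        A * ((e + s) * (B * s / (A * e + B * s))) = A * B * (e + s) ^ 2 / (A * e + B * s) := by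
      field_simp
    have h5 := h2.ne'
    have h6 : e + s ≠ 0 := h.ne'
    have h7 : A * B * (e + s) ^ 2 / (A * e + B * s) ≠ 0 := by positivity
    rw [h4, ← mul_div_assoc, div_eq_iff h7]
    ring

theorem continuous_mob {X : Type*} [TopologicalSpace X] {A B e s : X → ℝ} (hA : Continuous A)
    (hB : Continuous B) (he : Continuous e) (hs : Continuous s) (hA0 : ∀ x, 0 < A x)
    (hB0 : ∀ x, 0 < B x) (he0 : ∀ x, 0 ≤ e x) (hs0 : ∀ x, 0 ≤ s x) :
    Continuous fun x => mob (A x) (B x) (e x) (s x) := by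
  refine continuous_iff_continuousAt.2 fun x => ?_
  rcases (add_nonneg (he0 x) (hs0 x)).eq_or_lt with h | h
  · have h1 : mob (A x) (B x) (e x) (s x) = 0 := by simp [mob, ← h]
    rw [ContinuousAt, h1]
    refine squeeze_zero (fun y => mob_nonneg (hA0 y) (hB0 y) (he0 y) (hs0 y))
      (fun y => mob_le (hA0 y) (hB0 y) (he0 y) (hs0 y)) ?_
    have : Tendsto (fun y => e y + s y) (𝓝 x) (𝓝 (e x + s x)) := (he.add hs).tendsto x
    rwa [← h] at this
  · have h2 : 0 < A x * e x + B x * s x := by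
      have := hA0 x
      have := hB0 x
      have := hs0 x
      rcases (he0 x).eq_or_lt with h' | h'
      · have : 0 < s x := by linarith
        rw [← h']; positivity
      · positivity
    unfold mob
    have := h2.ne'
    fun_prop (disch := assumption)

end Mob

namespace L1

theorem tail_sub_tail {x y : L1 ℕ ℝ} {n i : ℕ} (hni : n ≤ i) (h : ∀ j < i, x j = y j) :
    tail n x - tail i x = tail n y - tail i y := by
  have key : ∀ m ≤ i, ∑ j ∈ Finset.range m, ‖x j‖ = ∑ j ∈ Finset.range m, ‖y j‖ :=
    fun m hm => Finset.sum_congr rfl fun j hj => by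
      rw [h j ((Finset.mem_range.1 hj).trans_le hm)]
  simp only [tail, key n hni, key i le_rfl]
  ring

theorem dist_trunc_trunc_le {n m : ℕ} (hnm : n ≤ m) (x : L1 ℕ ℝ) :
    dist (trunc n x) (trunc m x) ≤ tail n x - tail m x := by
  have h1 : trunc n (trunc m x) = trunc n x := by
    ext j; simp only [trunc_apply]; split_ifs <;> first | rfl | omega
  have h2 := norm_sub_trunc n (trunc m x)
  have h3 := tail_sub_tail (x := trunc m x) (y := x) hnm fun j hj => by simp [hj]
  have h4 : tail m (trunc m x) = 0 := by rw [← norm_sub_trunc, trunc_trunc, sub_self, norm_zero]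
  rw [dist_comm, dist_eq_norm, ← h1, h2]
  linarith

end L1

/-- The excess of a tail `T` over the gap `a`. -/
noncomputable def excess (a T : ℝ) : ℝ := max (T - a) 0

/-- The weights of the squeezing transformation and its inverse. -/
noncomputable def weight (b : Bool) (a d : ℝ) : ℝ := if b then a else a + d

/-- The excess after squeezing with a block of norm `s`. -/
noncomputable def newExcess (b : Bool) (a T s : ℝ) : ℝ :=
  mob (weight b a (excess a T + s)) (weight (!b) a (excess a T + s)) (excess a T) s

section Excess

variable (b : Bool) {a T s : ℝ}

theorem excess_nonneg : 0 ≤ excess a T := le_max_right _ _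

theorem weight_pos (ha : 0 < a) (hs : 0 ≤ s) : 0 < weight b a (excess a T + s) := by
  have h2 := excess_nonneg (a := a) (T := T)
  unfold weight
  split_ifs <;> positivity

theorem newExcess_nonneg (ha : 0 < a) (hs : 0 ≤ s) : 0 ≤ newExcess b a T s :=
  mob_nonneg (weight_pos b ha hs) (weight_pos (!b) ha hs) excess_nonneg hs

theorem newExcess_le (ha : 0 < a) (hs : 0 ≤ s) : newExcess b a T s ≤ excess a T + s :=
  mob_le (weight_pos b ha hs) (weight_pos (!b) ha hs) excess_nonneg hs

theorem newExcess_zero (ha : 0 < a) : newExcess b a T 0 = excess a T :=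
  mob_of_right (weight_pos b ha le_rfl)

theorem newExcess_of_excess (h : excess a T = 0) : newExcess b a T s = 0 := by
  simp [newExcess, mob, h]

theorem excess_newExcess (ha : 0 < a) (hs : 0 ≤ s) :
    excess a (T - excess a T + newExcess b a T s) = newExcess b a T s := by
  have h0 := newExcess_nonneg b (T := T) ha hs
  rcases le_total T a with h | h
  · have h2 : excess a T = 0 := max_eq_right (by linarith)
    rw [newExcess_of_excess b h2, h2]
    exact max_eq_right (by linarith)
  · have h2 : excess a T = T - a := max_eq_left (by linarith)
    rw [h2, excess, max_eq_left] <;> linarith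

theorem newExcess_newExcess (ha : 0 < a) (hs : 0 ≤ s) :
    newExcess (!b) a (T - excess a T + newExcess b a T s) (excess a T + s - newExcess b a T s) =
      excess a T := by
  rw [newExcess, excess_newExcess b ha hs, Bool.not_not, add_sub_cancel]
  exact mob_mob (weight_pos b ha hs) (weight_pos (!b) ha hs) excess_nonneg hs

theorem newExcess_true_le (ha : 0 < a) (hs : 0 ≤ s) : newExcess true a T s ≤ excess a T := by
  have h2 := excess_nonneg (a := a) (T := T)
  simp only [newExcess, weight, mob, Bool.not_true, if_true, Bool.false_eq_true, if_false]
  rcases h2.eq_or_lt with h | h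
  · simp [← h]
  · have h4 : 0 < a * excess a T + (a + (excess a T + s)) * s := by positivity
    rw [← mul_div_assoc, div_le_iff₀ h4]
    nlinarith [mul_nonneg (mul_nonneg h2 hs) (add_nonneg h2 hs)]

theorem newExcess_true_le_left (ha : 0 < a) (hs : 0 ≤ s) (hT : T ≤ s) :
    newExcess true a T s ≤ a := by
  have h2 := excess_nonneg (a := a) (T := T)
  rcases h2.eq_or_lt with h | h
  · rw [newExcess_of_excess _ h.symm]; exact ha.le
  · have h5 : excess a T ≤ s := max_le (by linarith) hs
    simp only [newExcess, weight, mob, Bool.not_true, if_true, Bool.false_eq_true, if_false]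
    have h4 : 0 < a * excess a T + (a + (excess a T + s)) * s := by positivity
    rw [← mul_div_assoc, div_le_iff₀ h4]
    have h6 : 0 ≤ a * ((s - excess a T) * (s + excess a T)) :=
      mul_nonneg ha.le (mul_nonneg (by linarith) (by linarith))
    nlinarith [mul_pos ha ha, mul_pos (mul_pos ha ha) h, mul_nonneg (mul_pos ha ha).le hs]

theorem excess_add_pos (ha : 0 < a) : 0 < a + excess a T :=
  add_pos_of_pos_of_nonneg ha excess_nonneg

/-- The tail rescaled by the excess ratio. -/
theorem ratio_mul (ha : 0 < a) : (a + newExcess b a T s) / (a + excess a T) * T =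
    T - excess a T + newExcess b a T s := by
  rcases le_total T a with h | h
  · have h2 : excess a T = 0 := max_eq_right (by linarith)
    rw [newExcess_of_excess b h2, h2, add_zero, div_self ha.ne']
    ring
  · have h2 : T = a + excess a T := by rw [excess, max_eq_left (by linarith)]; ring
    have h3 := (excess_add_pos (T := T) ha).ne'
    rw [div_mul_eq_mul_div, div_eq_iff h3]
    have : T - excess a T = a := by linarith
    rw [this, ← h2]

end Excess

namespace L1

theorem tail_congr {x y : L1 ℕ ℝ} {n : ℕ} (h : ∀ i, n ≤ i → ‖x i‖ = ‖y i‖) :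
    tail n x = tail n y := by
  refine (hasSum_tail n x).unique ?_
  simp_rw [h _ (Nat.le_add_right n _)]
  exact hasSum_tail n y

theorem tail_mono_of_le {x y : L1 ℕ ℝ} {n : ℕ} (h : ∀ i, n ≤ i → ‖x i‖ ≤ ‖y i‖) :
    tail n x ≤ tail n y :=
  hasSum_le (fun i => h _ (Nat.le_add_right n i)) (hasSum_tail n x) (hasSum_tail n y)

theorem norm_trunc_sub_trunc {n m : ℕ} (hnm : n ≤ m) (x : L1 ℕ ℝ) :
    ‖trunc m x - trunc n x‖ = tail n x - tail m x := by
  have h1 : trunc n (trunc m x) = trunc n x := by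
    ext j; simp only [trunc_apply]; split_ifs <;> first | rfl | omega
  have h2 := norm_sub_trunc n (trunc m x)
  have h3 := tail_sub_tail (x := trunc m x) (y := x) hnm fun j hj => by simp [hj]
  have h4 : tail m (trunc m x) = 0 := by rw [← norm_sub_trunc, trunc_trunc, sub_self, norm_zero]
  rw [← h1, h2]
  linarith

theorem infDist_trunc_le (K : Set (L1 ℕ ℝ)) {n m : ℕ} (hnm : n ≤ m) (x : L1 ℕ ℝ) :
    Metric.infDist (trunc n x) K - tail n x ≤ Metric.infDist (trunc m x) K - tail m x := by
  have h1 := Metric.infDist_le_infDist_add_dist (s := K) (x := trunc n x) (y := trunc m x)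
  have h2 := dist_trunc_trunc_le hnm x
  linarith

end L1

open L1

/-! #### The gap -/

section Gap

/-- The vectors of the unit ball supported in the first `m` coordinates. -/
def finBall (m : ℕ) : Set (L1 ℕ ℝ) := {v | ‖v‖ ≤ 1 ∧ trunc m v = v}

theorem isCompact_finBall (m : ℕ) : IsCompact (finBall m) := by
  have hsum : Summable fun i : ℕ => if i < m then (1 : ℝ) else 0 :=
    summable_of_ne_finset_zero (s := Finset.range m) fun i hi => by
      rw [if_neg]; simpa using hi
  have hle : ∀ (w : ℕ → Icc (-1 : ℝ) 1) i,
      ‖if i < m then (w i : ℝ) else 0‖ ≤ if i < m then (1 : ℝ) else 0 := fun w i => by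
    split_ifs
    · exact abs_le.2 (w i).2
    · simp
  let F : (ℕ → Icc (-1 : ℝ) 1) → L1 ℕ ℝ := fun w =>
    L1.mk (fun i => if i < m then (w i : ℝ) else 0)
      (hsum.of_nonneg_of_le (fun _ => norm_nonneg _) (hle w))
  have hF : Continuous F := continuous_of_dominated (fun i => by
    change Continuous fun w : ℕ → Icc (-1 : ℝ) 1 => if i < m then (w i : ℝ) else 0
    split_ifs <;> fun_prop) hsum hle
  have hcl : IsClosed (finBall m) :=
    (isClosed_le continuous_norm continuous_const).inter
      (isClosed_eq (trunc m).continuous continuous_id)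
  refine (isCompact_range hF).of_isClosed_subset hcl fun v hv => ?_
  refine ⟨fun i => ⟨v i, abs_le.1 ((norm_apply_le v i).trans hv.1)⟩, ?_⟩
  ext i
  change (if i < m then v i else 0) = v i
  rw [← trunc_apply, hv.2]

variable (K : Set (L1 ℕ ℝ))

/-- A sixteenth of the least distance to `K` of the vectors with prescribed first `N`
coordinates, supported in the first `2 * N` coordinates and with a bounded tail. -/
noncomputable def gap (N : ℕ) (u : L1 ℕ ℝ) : ℝ :=
  sInf ((fun v => Metric.infDist (trunc N u + tail N u • v) K) '' finBall (2 * N)) / 16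

variable {K} {N : ℕ}

theorem continuous_gap : Continuous (gap K N) := by
  refine Continuous.div_const ?_ 16
  refine (isCompact_finBall (2 * N)).continuous_sInf
    (f := fun u v => Metric.infDist (trunc N u + tail N u • v) K) ?_
  refine (Metric.continuous_infDist_pt K).comp ?_
  exact ((trunc N).continuous.comp continuous_fst).add
    (((continuous_tail N).comp continuous_fst).smul continuous_snd)

theorem exists_gap (u : L1 ℕ ℝ) :
    ∃ v ∈ finBall (2 * N), 16 * gap K N u = Metric.infDist (trunc N u + tail N u • v) K := by
  have h0 : (finBall (2 * N)).Nonempty := ⟨0, by simp [finBall]⟩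
  obtain ⟨v, hv, h⟩ := ((isCompact_finBall (2 * N)).image
    (f := fun v => Metric.infDist (trunc N u + tail N u • v) K)
    ((Metric.continuous_infDist_pt K).comp (by fun_prop))).sInf_mem (h0.image _)
  exact ⟨v, hv, by rw [gap, ← h]; ring⟩

theorem gap_pos (hcl : IsClosed K) (hne : K.Nonempty) (hK : ∀ m x, trunc m x ∉ K)
    (u : L1 ℕ ℝ) : 0 < gap K N u := by
  obtain ⟨v, hv, h⟩ := exists_gap (K := K) (N := N) u
  have h1 : trunc N u + tail N u • v = trunc (2 * N) (trunc N u + tail N u • v) := by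
    rw [map_add, map_smul, hv.2]
    congr 1
    ext i
    simp only [trunc_apply]
    split_ifs <;> first | rfl | omega
  have h2 : 0 < Metric.infDist (trunc N u + tail N u • v) K := by
    rw [← hcl.notMem_iff_infDist_pos hne, h1]
    exact hK _ _
  linarith

theorem gap_congr {u w : L1 ℕ ℝ} (h1 : trunc N u = trunc N w) (h2 : tail N u = tail N w) :
    gap K N u = gap K N w := by
  rw [gap, h1, h2, gap]

theorem gap_le (u : L1 ℕ ℝ) : 16 * gap K N u ≤ Metric.infDist (trunc (2 * N) u) K := by
  rw [gap, mul_div_cancel₀ _ (by norm_num)]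
  refine csInf_le ⟨0, ?_⟩ ?_
  · rintro _ ⟨v, -, rfl⟩
    exact Metric.infDist_nonneg
  · have h3 := tail_nonneg N u
    have h4 := norm_trunc_sub_trunc (show N ≤ 2 * N by omega) u
    have h5 := tail_nonneg (2 * N) u
    have h6 : trunc (2 * N) (trunc (2 * N) u - trunc N u) = trunc (2 * N) u - trunc N u := by
      ext i; simp only [trunc_apply, L1.sub_apply]; split_ifs <;> first | omega | ring
    rcases h3.eq_or_lt with h | h
    · refine ⟨0, by simp [finBall], ?_⟩
      have : trunc (2 * N) u - trunc N u = 0 := norm_eq_zero.1 (by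
        have := norm_nonneg (trunc (2 * N) u - trunc N u); linarith)
      simp only [smul_zero, add_zero]
      rw [sub_eq_zero.1 this]
    · refine ⟨(tail N u)⁻¹ • (trunc (2 * N) u - trunc N u), ⟨?_, ?_⟩, ?_⟩
      · rw [norm_smul, Real.norm_of_nonneg (by positivity), h4, inv_mul_le_iff₀ h]
        linarith
      · rw [map_smul, h6]
      · simp only [smul_smul, mul_inv_cancel₀ h.ne', one_smul, add_sub_cancel]

theorem le_gap (u : L1 ℕ ℝ) : Metric.infDist (trunc N u) K - tail N u ≤ 16 * gap K N u := by
  obtain ⟨v, hv, h⟩ := exists_gap (K := K) (N := N) u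
  rw [h]
  have h1 := Metric.infDist_le_infDist_add_dist (s := K) (x := trunc N u)
    (y := trunc N u + tail N u • v)
  have h2 : dist (trunc N u) (trunc N u + tail N u • v) ≤ tail N u := by
    rw [dist_self_add_right, norm_smul, Real.norm_of_nonneg (tail_nonneg N u)]
    exact mul_le_of_le_one_right (tail_nonneg N u) hv.1
  linarith

end Gap

/-! #### Squeezing the tail into a block of coordinates -/

section Squeeze

variable (K : Set (L1 ℕ ℝ))

/-- The norm of the block of coordinates from `N` to `2 * N`. -/
noncomputable def blockNorm (N : ℕ) (u : L1 ℕ ℝ) : ℝ := tail N u - tail (2 * N) u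

/-- The excess of the tail. -/
noncomputable def exc (N : ℕ) (u : L1 ℕ ℝ) : ℝ := excess (gap K N u) (tail (2 * N) u)

/-- The excess of the tail after squeezing. -/
noncomputable def newExc (b : Bool) (N : ℕ) (u : L1 ℕ ℝ) : ℝ :=
  newExcess b (gap K N u) (tail (2 * N) u) (blockNorm N u)

/-- The factor by which the tail is multiplied. -/
noncomputable def ratio (b : Bool) (N : ℕ) (u : L1 ℕ ℝ) : ℝ :=
  (gap K N u + newExc K b N u) / (gap K N u + exc K N u)

/-- The factor by which the block is multiplied. -/
noncomputable def blockRatio (b : Bool) (N : ℕ) (u : L1 ℕ ℝ) : ℝ :=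
  (exc K N u + blockNorm N u - newExc K b N u) / blockNorm N u

/-- Transfer of a part of the tail to the block of coordinates from `N` to `2 * N` and back. -/
noncomputable def squeeze (b : Bool) (N : ℕ) (u : L1 ℕ ℝ) : L1 ℕ ℝ :=
  trunc N u + blockRatio K b N u • (trunc (2 * N) u - trunc N u) +
    ratio K b N u • (u - trunc (2 * N) u)

variable {K} {b : Bool} {N : ℕ} {u : L1 ℕ ℝ}

theorem norm_block : ‖trunc (2 * N) u - trunc N u‖ = blockNorm N u :=
  norm_trunc_sub_trunc (by omega) u

theorem blockNorm_nonneg : 0 ≤ blockNorm N u := by rw [← norm_block]; exact norm_nonneg _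

theorem continuous_blockNorm : Continuous (blockNorm N) :=
  (continuous_tail N).sub (continuous_tail _)

theorem squeeze_apply (i : ℕ) : squeeze K b N u i =
    if i < N then u i else if i < 2 * N then blockRatio K b N u * u i
      else ratio K b N u * u i := by
  change (trunc N u) i + blockRatio K b N u * (trunc (2 * N) u i - trunc N u i) +
    ratio K b N u * (u i - trunc (2 * N) u i) = _
  simp only [trunc_apply]
  split_ifs <;> first | omega | ring

theorem trunc_squeeze : trunc N (squeeze K b N u) = trunc N u := by
  ext j
  simp only [trunc_apply, squeeze_apply]
  split_ifs <;> rfl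

theorem squeeze_of_exc (ha : 0 < gap K N u) (h : exc K N u = 0) : squeeze K b N u = u := by
  have h1 : newExc K b N u = 0 := newExcess_of_excess b h
  have h2 : ratio K b N u = 1 := by rw [ratio, h, h1, div_self (by linarith)]
  by_cases h3 : blockNorm N u = 0
  · have h4 := norm_block (N := N) (u := u)
    rw [h3, norm_eq_zero] at h4
    rw [squeeze, h4, h2, sub_eq_zero.1 h4]; simp
  · have h4 : blockRatio K b N u = 1 := by
      rw [blockRatio, h, h1, zero_add, sub_zero, div_self h3]
    rw [squeeze, h2, h4]; simp

theorem squeeze_of_block (ha : 0 < gap K N u) (h : blockNorm N u = 0) :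
    squeeze K b N u = u := by
  have h1 : newExc K b N u = exc K N u := by rw [newExc, h, newExcess_zero b ha, exc]
  have h2 : ratio K b N u = 1 := by rw [ratio, h1]; exact div_self (excess_add_pos ha).ne'
  have h4 := norm_block (N := N) (u := u)
  rw [h, norm_eq_zero] at h4
  rw [squeeze, h4, h2, sub_eq_zero.1 h4]; simp

theorem newExc_nonneg (ha : 0 < gap K N u) : 0 ≤ newExc K b N u :=
  newExcess_nonneg b ha blockNorm_nonneg

theorem newExc_le (ha : 0 < gap K N u) : newExc K b N u ≤ exc K N u + blockNorm N u :=
  newExcess_le b ha blockNorm_nonneg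

theorem ratio_pos (ha : 0 < gap K N u) : 0 < ratio K b N u :=
  div_pos (add_pos_of_pos_of_nonneg ha (newExc_nonneg ha)) (excess_add_pos ha)

theorem tail_squeeze_two (ha : 0 < gap K N u) : tail (2 * N) (squeeze K b N u) =
    tail (2 * N) u - exc K N u + newExc K b N u := by
  have h := (hasSum_tail (2 * N) u).mul_left (ratio K b N u)
  have h1 : (fun j => ‖squeeze K b N u (2 * N + j)‖) =
      fun j => ratio K b N u * ‖u (2 * N + j)‖ := by
    funext j
    rw [squeeze_apply, if_neg (by omega), if_neg (by omega), norm_mul,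
      Real.norm_of_nonneg (ratio_pos ha).le]
  rw [(hasSum_tail (2 * N) _).unique (h1 ▸ h)]
  exact ratio_mul b ha

theorem blockNorm_squeeze (ha : 0 < gap K N u) : blockNorm N (squeeze K b N u) =
    exc K N u + blockNorm N u - newExc K b N u := by
  have h1 : trunc (2 * N) (squeeze K b N u) - trunc N (squeeze K b N u) =
      blockRatio K b N u • (trunc (2 * N) u - trunc N u) := by
    ext i
    change _ = blockRatio K b N u * (trunc (2 * N) u i - trunc N u i)
    simp only [L1.sub_apply, trunc_apply, squeeze_apply]
    split_ifs <;> first | omega | ring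
  rw [← norm_block, h1, blockRatio]
  conv_lhs => rw [← norm_block]
  rw [norm_block]
  conv_lhs => enter [1, 1, 2]; rw [← norm_block]
  refine norm_rescale (by linarith [newExc_le (b := b) ha]) fun h => ?_
  have h0 : blockNorm N u = 0 := by rw [← norm_block, h, norm_zero]
  rw [newExc, h0, newExcess_zero b ha, exc]; ring

theorem tail_squeeze (ha : 0 < gap K N u) : tail N (squeeze K b N u) = tail N u := by
  have h1 := tail_squeeze_two (b := b) ha
  have h2 := blockNorm_squeeze (b := b) ha
  simp only [blockNorm] at h2
  linarith

theorem gap_squeeze (ha : 0 < gap K N u) : gap K N (squeeze K b N u) = gap K N u :=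
  gap_congr trunc_squeeze (tail_squeeze ha)

theorem exc_squeeze (ha : 0 < gap K N u) : exc K N (squeeze K b N u) = newExc K b N u := by
  rw [exc, gap_squeeze ha, tail_squeeze_two ha]
  exact excess_newExcess b ha blockNorm_nonneg

theorem newExc_squeeze (ha : 0 < gap K N u) :
    newExc K (!b) N (squeeze K b N u) = exc K N u := by
  rw [newExc, gap_squeeze ha, tail_squeeze_two ha, blockNorm_squeeze ha]
  exact newExcess_newExcess b ha blockNorm_nonneg

theorem squeeze_squeeze (ha : 0 < gap K N u) : squeeze K (!b) N (squeeze K b N u) = u := by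
  by_cases h0 : blockNorm N u = 0
  · have h1 : squeeze K b N u = u := squeeze_of_block ha h0
    rw [h1, squeeze_of_block ha h0]
  ext j
  have ha' : 0 < gap K N (squeeze K b N u) := by rwa [gap_squeeze ha]
  rw [squeeze_apply, squeeze_apply]
  split_ifs
  · rfl
  · have h1 : blockNorm N (squeeze K b N u) ≠ 0 := fun h => by
      have h2 : squeeze K (!b) N (squeeze K b N u) = squeeze K b N u := squeeze_of_block ha' h
      have h3 := newExc_squeeze (b := b) ha
      rw [newExc, h, newExcess_zero _ ha', ← exc, exc_squeeze ha] at h3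
      rw [blockNorm_squeeze ha, h3] at h
      exact h0 (by linarith)
    rw [blockRatio, newExc_squeeze ha, exc_squeeze ha, blockRatio]
    rw [← blockNorm_squeeze ha, ← mul_assoc, div_mul_div_cancel₀ h1, blockNorm_squeeze ha]
    rw [show newExc K b N u + (exc K N u + blockNorm N u - newExc K b N u) - exc K N u =
      blockNorm N u by ring, div_self h0, one_mul]
  · rw [ratio, newExc_squeeze ha, gap_squeeze ha, exc_squeeze ha, ratio,
      ← mul_assoc, div_mul_div_cancel₀, div_self, one_mul]
    · exact (excess_add_pos ha).ne'
    · exact (add_pos_of_pos_of_nonneg ha (newExc_nonneg ha)).ne'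

theorem continuous_squeeze (ha : ∀ u, 0 < gap K N u) : Continuous (squeeze K b N) := by
  have h1 : Continuous (gap K N) := continuous_gap
  have h2 : Continuous (exc K N) := ((continuous_tail _).sub h1).max continuous_const
  have h3 : Continuous (blockNorm N) := continuous_blockNorm
  have h4 : ∀ b, Continuous fun u => weight b (gap K N u) (exc K N u + blockNorm N u) :=
    fun b => by
      unfold weight
      split_ifs <;> fun_prop
  have h5 : Continuous (newExc K b N) :=
    continuous_mob (h4 b) (h4 (!b)) h2 h3 (fun u => weight_pos b (ha u) blockNorm_nonneg)
      (fun u => weight_pos (!b) (ha u) blockNorm_nonneg) (fun u => excess_nonneg)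
      fun u => blockNorm_nonneg
  have h6 : Continuous (ratio K b N) :=
    (h1.add h5).div (h1.add h2) fun u => (excess_add_pos (ha u)).ne'
  have h7 := (trunc N).continuous
  have h8 := (trunc (2 * N)).continuous
  refine (h7.add ?_).add (h6.smul (continuous_id.sub h8))
  have h9 := continuous_rescale (v := fun u => trunc (2 * N) u - trunc N u)
    (σ := fun u => exc K N u + blockNorm N u - newExc K b N u)
    (h8.sub h7) ((h2.add h3).sub h5) fun u h => by
      have h0 : blockNorm N u = 0 := by rw [← norm_block, h, norm_zero]
      rw [newExc, h0, newExcess_zero b (ha u), exc]; ring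
  simp only [norm_block] at h9
  exact h9

theorem newExc_true_le (ha : 0 < gap K N u) : newExc K true N u ≤ exc K N u :=
  newExcess_true_le ha blockNorm_nonneg

theorem ratio_true_le (ha : 0 < gap K N u) : ratio K true N u ≤ 1 :=
  (div_le_one (excess_add_pos ha)).2 (add_le_add_right (newExc_true_le ha) _)

theorem norm_squeeze_apply_le (ha : 0 < gap K N u) {i : ℕ} (hi : 2 * N ≤ i) :
    ‖squeeze K true N u i‖ ≤ ‖u i‖ := by
  rw [squeeze_apply, if_neg (by omega), if_neg (by omega), norm_mul,
    Real.norm_of_nonneg (ratio_pos ha).le]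
  exact mul_le_of_le_one_left (norm_nonneg _) (ratio_true_le ha)

theorem blockNorm_le_squeeze (ha : 0 < gap K N u) :
    blockNorm N u ≤ blockNorm N (squeeze K true N u) := by
  rw [blockNorm_squeeze ha]
  linarith [newExc_true_le ha]

theorem tail_squeeze_le_gap (ha : 0 < gap K N u) (h : tail (2 * N) u ≤ blockNorm N u) :
    tail (2 * N) (squeeze K true N u) ≤ 2 * gap K N u := by
  rw [tail_squeeze_two ha]
  have h1 : newExc K true N u ≤ gap K N u := newExcess_true_le_left ha blockNorm_nonneg h
  have h2 : tail (2 * N) u - gap K N u ≤ exc K N u := le_max_left _ _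
  linarith

theorem norm_squeeze_sub_le (ha : 0 < gap K N u) : ‖squeeze K true N u - u‖ ≤
    2 * (blockNorm N (squeeze K true N u) - blockNorm N u) := by
  have h1 : squeeze K true N u - u = (blockRatio K true N u - 1) • (trunc (2 * N) u - trunc N u) +
      (ratio K true N u - 1) • (u - trunc (2 * N) u) := by
    rw [squeeze]; module
  have h2 := blockNorm_squeeze (b := true) ha
  have h3 := newExc_true_le ha
  have h4 : ‖(blockRatio K true N u - 1) • (trunc (2 * N) u - trunc N u)‖ ≤
      exc K N u - newExc K true N u := by
    rw [norm_smul, norm_block]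
    by_cases h0 : blockNorm N u = 0
    · rw [h0, mul_zero]; linarith
    · have h5 : blockRatio K true N u - 1 = (exc K N u - newExc K true N u) / blockNorm N u := by
        rw [blockRatio]; field_simp; ring
      rw [h5, norm_div, Real.norm_of_nonneg blockNorm_nonneg, div_mul_cancel₀ _ h0,
        Real.norm_of_nonneg (by linarith)]
  have h6 : ‖(ratio K true N u - 1) • (u - trunc (2 * N) u)‖ ≤
      exc K N u - newExc K true N u := by
    rw [norm_smul, norm_sub_trunc, Real.norm_of_nonpos (by linarith [ratio_true_le ha])]
    have h7 : ratio K true N u * tail (2 * N) u = _ := ratio_mul true ha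
    have h8 : tail (2 * N) u - excess (gap K N u) (tail (2 * N) u) +
      newExcess true (gap K N u) (tail (2 * N) u) (blockNorm N u) =
      tail (2 * N) u - exc K N u + newExc K true N u := rfl
    linarith
  rw [h1, h2]
  exact (norm_add_le _ _).trans (by linarith)

end Squeeze

end Continuation

namespace Continuation

open Filter L1

/-! #### Rotations of two blocks of coordinates -/

/-- The coordinates of a vector with two rotated blocks. -/
noncomputable def turnCoord (N : ℕ) (t : ℝ) (u : L1 ℕ ℝ) (i : ℕ) : ℝ :=
  if i < N then u i
  else if i < 2 * N then
    (Real.cos t * signedSqrt (u i) + Real.sin t * signedSqrt (u (i + N))) *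
      |Real.cos t * signedSqrt (u i) + Real.sin t * signedSqrt (u (i + N))|
  else if i < 3 * N then
    (Real.cos t * signedSqrt (u i) - Real.sin t * signedSqrt (u (i - N))) *
      |Real.cos t * signedSqrt (u i) - Real.sin t * signedSqrt (u (i - N))|
  else u i

/-- Rotation by the angle `t` of the blocks of coordinates from `N` to `2 * N` and from `2 * N`
to `3 * N`, in the coordinates of `ℓ²`. -/
noncomputable def turn (N : ℕ) (t : ℝ) (u : L1 ℕ ℝ) : L1 ℕ ℝ :=
  L1.mk (turnCoord N t u) (by
    refine (summable_congr_cofinite ?_).1 (summable_norm u)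
    refine Filter.mem_of_superset (Set.finite_lt_nat (3 * N)).compl_mem_cofinite fun i hi => ?_
    have hi : ¬ i < 3 * N := hi
    simp only [Set.mem_ofPred_eq, turnCoord]
    rw [if_neg (by omega), if_neg (by omega), if_neg hi])

variable {N : ℕ} {t : ℝ} {u : L1 ℕ ℝ} {i : ℕ}

theorem turn_apply_of_lt (hi : i < N) : turn N t u i = u i := if_pos hi

theorem turn_apply_of_ge (hi : 3 * N ≤ i) : turn N t u i = u i := by
  change turnCoord N t u i = _
  rw [turnCoord, if_neg (by omega), if_neg (by omega), if_neg (by omega)]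

theorem turn_apply_left (h1 : N ≤ i) (h2 : i < 2 * N) : turn N t u i =
    (Real.cos t * signedSqrt (u i) + Real.sin t * signedSqrt (u (i + N))) *
      |Real.cos t * signedSqrt (u i) + Real.sin t * signedSqrt (u (i + N))| := by
  change turnCoord N t u i = _
  rw [turnCoord, if_neg (by omega), if_pos h2]

theorem turn_apply_right (h1 : N ≤ i) (h2 : i < 2 * N) : turn N t u (i + N) =
    (Real.cos t * signedSqrt (u (i + N)) - Real.sin t * signedSqrt (u i)) *
      |Real.cos t * signedSqrt (u (i + N)) - Real.sin t * signedSqrt (u i)| := by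
  change turnCoord N t u (i + N) = _
  rw [turnCoord, if_neg (by omega), if_neg (by omega), if_pos (by omega), Nat.add_sub_cancel]

theorem ext_blocks {x y : L1 ℕ ℝ} (h1 : ∀ i < N, x i = y i) (h2 : ∀ i, 3 * N ≤ i → x i = y i)
    (h3 : ∀ i, N ≤ i → i < 2 * N → x i = y i ∧ x (i + N) = y (i + N)) : x = y := by
  ext i
  by_cases hi1 : i < N
  · exact h1 i hi1
  by_cases hi2 : i < 2 * N
  · exact (h3 i (by omega) hi2).1
  by_cases hi3 : i < 3 * N
  · have := (h3 (i - N) (by omega) (by omega)).2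
    rwa [Nat.sub_add_cancel (by omega)] at this
  · exact h2 i (by omega)

theorem turn_zero : turn N 0 u = u := by
  refine ext_blocks (N := N) (fun i hi => turn_apply_of_lt hi) (fun i hi => turn_apply_of_ge hi)
    fun i h1 h2 => ⟨?_, ?_⟩
  · rw [turn_apply_left h1 h2]; simp [signedSqrt_mul_abs_self]
  · rw [turn_apply_right h1 h2]; simp [signedSqrt_mul_abs_self]

theorem turn_turn : turn N (-t) (turn N t u) = u := by
  have h0 := Real.sin_sq_add_cos_sq t
  refine ext_blocks (N := N) (fun i hi => ?_) (fun i hi => ?_) fun i h1 h2 => ⟨?_, ?_⟩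
  · rw [turn_apply_of_lt hi, turn_apply_of_lt hi]
  · rw [turn_apply_of_ge hi, turn_apply_of_ge hi]
  · rw [turn_apply_left h1 h2, turn_apply_left h1 h2, turn_apply_right h1 h2, signedSqrt_mul_abs,
      signedSqrt_mul_abs, Real.cos_neg, Real.sin_neg]
    have h3 : ∀ a, a = signedSqrt (u i) → a * |a| = u i := fun a ha => by
      rw [ha, signedSqrt_mul_abs_self]
    exact h3 _ (by linear_combination signedSqrt (u i) * h0)
  · rw [turn_apply_right h1 h2, turn_apply_left h1 h2, turn_apply_right h1 h2, signedSqrt_mul_abs,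
      signedSqrt_mul_abs, Real.cos_neg, Real.sin_neg]
    have h3 : ∀ a, a = signedSqrt (u (i + N)) → a * |a| = u (i + N) := fun a ha => by
      rw [ha, signedSqrt_mul_abs_self]
    exact h3 _ (by linear_combination signedSqrt (u (i + N)) * h0)

theorem trunc_turn : trunc N (turn N t u) = trunc N u := by
  ext i
  simp only [trunc_apply]
  split_ifs with h
  · exact turn_apply_of_lt h
  · rfl

theorem tail_turn_of_ge {M : ℕ} (hM : 3 * N ≤ M) : tail M (turn N t u) = tail M u :=
  tail_congr fun _ hi => by rw [turn_apply_of_ge (hM.trans hi)]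

theorem tail_turn : tail N (turn N t u) = tail N u := by
  have h1 : ∀ x : L1 ℕ ℝ, tail N x =
      ∑ j ∈ Finset.range N, (‖x (N + j)‖ + ‖x (N + j + N)‖) + tail (3 * N) x := fun x => by
    rw [← sum_add_tail N (N + N) x, Finset.sum_range_add, Finset.sum_add_distrib,
      show N + (N + N) = 3 * N by ring]
    congr 2
    exact Finset.sum_congr rfl fun j _ => by rw [show N + (N + j) = N + j + N by ring]
  rw [h1, h1 u, tail_turn_of_ge le_rfl]
  congr 1
  refine Finset.sum_congr rfl fun j hj => ?_
  have hj := Finset.mem_range.1 hj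
  have h2 : N ≤ N + j := by omega
  have h3 : N + j < 2 * N := by omega
  have h4 : ∀ a : ℝ, ‖a * |a|‖ = a ^ 2 := fun a => by
    rw [norm_mul, Real.norm_eq_abs, Real.norm_eq_abs, abs_abs, ← sq, sq_abs]
  rw [turn_apply_left h2 h3, turn_apply_right h2 h3, h4, h4, Real.norm_eq_abs, Real.norm_eq_abs,
    ← sq_signedSqrt (u (N + j)), ← sq_signedSqrt (u (N + j + N))]
  linear_combination (signedSqrt (u (N + j)) ^ 2 + signedSqrt (u (N + j + N)) ^ 2) *
    Real.sin_sq_add_cos_sq t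

theorem norm_eq_of_trunc_tail {x y : L1 ℕ ℝ} (h1 : trunc N x = trunc N y)
    (h2 : tail N x = tail N y) : ‖x‖ = ‖y‖ := by
  have h3 : ∑ i ∈ Finset.range N, ‖x i‖ = ∑ i ∈ Finset.range N, ‖y i‖ :=
    Finset.sum_congr rfl fun i hi => by
      have := congrArg (fun z : L1 ℕ ℝ => ‖z i‖) h1
      simpa [Finset.mem_range.1 hi] using this
  simp only [tail] at h2
  linarith

theorem norm_turn : ‖turn N t u‖ = ‖u‖ := norm_eq_of_trunc_tail trunc_turn tail_turn

theorem continuous_turn {T : Type*} [TopologicalSpace T] {a : T → ℝ} {f : T → L1 ℕ ℝ}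
    (ha : Continuous a) (hf : Continuous f) : Continuous fun x => turn N (a x) (f x) := by
  have h1 : ∀ i, Continuous fun x => f x i := fun i => (L1.continuous_apply i).comp hf
  have h2 := fun i => continuous_signedSqrt.comp (h1 i)
  have h3 := Real.continuous_cos.comp ha
  have h4 := Real.continuous_sin.comp ha
  refine continuous_of_norm (fun i => ?_) (by simpa only [norm_turn] using hf.norm)
  change Continuous fun x => turnCoord N (a x) (f x) i
  unfold turnCoord
  split_ifs
  · exact h1 i
  · have h5 := (h3.mul (h2 i)).add (h4.mul (h2 (i + N)))
    exact h5.mul h5.abs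
  · have h5 := (h3.mul (h2 i)).sub (h4.mul (h2 (i - N)))
    exact h5.mul h5.abs
  · exact h1 i

theorem turn_half_left (h1 : N ≤ i) (h2 : i < 2 * N) :
    turn N (Real.pi / 2) u i = u (i + N) := by
  rw [turn_apply_left h1 h2]; simp [signedSqrt_mul_abs_self]

theorem turn_half_right (h1 : N ≤ i) (h2 : i < 2 * N) :
    turn N (Real.pi / 2) u (i + N) = -u i := by
  rw [turn_apply_right h1 h2]; simp [signedSqrt_mul_abs_self]

theorem turn_half_sub (x y : L1 ℕ ℝ) :
    turn N (Real.pi / 2) (x - y) = turn N (Real.pi / 2) x - turn N (Real.pi / 2) y := by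
  refine ext_blocks (N := N) (fun i hi => ?_) (fun i hi => ?_) fun i h1 h2 => ⟨?_, ?_⟩
  · simp only [L1.sub_apply, turn_apply_of_lt hi]
  · simp only [L1.sub_apply, turn_apply_of_ge hi]
  · simp only [L1.sub_apply, turn_half_left h1 h2]
  · simp only [L1.sub_apply, turn_half_right h1 h2]; ring

/-! #### Extension by zero along an injection -/

namespace L1

/-- Extension by zero along an injection. -/
noncomputable def ext0 {g : ℕ → ℕ} (hg : g.Injective) (x : L1 ℕ ℝ) : L1 ℕ ℝ :=
  L1.mk (Function.extend g x 0) (by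
    refine (Function.Injective.summable_iff hg fun i hi => ?_).1 ?_
    · rw [Function.extend_apply' _ _ _ (by simpa using hi)]; simp
    · have : (fun i => ‖Function.extend g x 0 i‖) ∘ g = fun i => ‖x i‖ := by
        funext i; simp [hg.extend_apply]
      rw [this]; exact summable_norm x)

variable {g : ℕ → ℕ} (hg : g.Injective) (x y : L1 ℕ ℝ)

@[simp] theorem ext0_apply (i : ℕ) : ext0 hg x (g i) = x i := hg.extend_apply _ _ _

theorem ext0_apply_of_notMem {i : ℕ} (hi : i ∉ range g) : ext0 hg x i = 0 :=
  Function.extend_apply' _ _ _ (by simpa using hi)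

theorem norm_ext0 : ‖ext0 hg x‖ = ‖x‖ := by
  have h1 : HasSum ((fun i => ‖ext0 hg x i‖) ∘ g) ‖x‖ := by
    have : (fun i => ‖ext0 hg x i‖) ∘ g = fun i => ‖x i‖ := by funext i; simp
    rw [this]; exact hasSum_norm x
  exact (hasSum_norm _).unique ((hg.hasSum_iff fun i hi => by
    rw [ext0_apply_of_notMem hg x hi, norm_zero]).1 h1)

theorem ext0_sub : ext0 hg (x - y) = ext0 hg x - ext0 hg y := by
  ext i
  by_cases hi : i ∈ range g
  · obtain ⟨j, rfl⟩ := hi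
    simp only [L1.sub_apply, ext0_apply]
  · simp only [L1.sub_apply, ext0_apply_of_notMem hg _ hi, sub_zero]

theorem isometry_ext0 : Isometry (ext0 hg) := Isometry.of_dist_eq fun x y => by
  rw [dist_eq_norm, dist_eq_norm, ← ext0_sub, norm_ext0]

variable {M M' : ℕ}

theorem trunc_ext0 (h : ∀ j, g j < M ↔ j < M') :
    trunc M (ext0 hg x) = ext0 hg (trunc M' x) := by
  ext i
  by_cases hi : i ∈ range g
  · obtain ⟨j, rfl⟩ := hi
    simp only [trunc_apply, ext0_apply, h]
  · simp only [trunc_apply, ext0_apply_of_notMem hg _ hi, ite_self]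

theorem tail_ext0 (h : ∀ j, g j < M ↔ j < M') : tail M (ext0 hg x) = tail M' x := by
  rw [← norm_sub_trunc, trunc_ext0 hg x h, ← ext0_sub, norm_ext0, norm_sub_trunc]

/-- Restriction along an injection. -/
noncomputable def restrict (x : L1 ℕ ℝ) : L1 ℕ ℝ :=
  L1.mk (fun i => x (g i)) ((summable_norm x).comp_injective hg)

theorem ext0_restrict (h : ∀ i ∉ range g, x i = 0) : ext0 hg (restrict hg x) = x := by
  ext i
  by_cases hi : i ∈ range g
  · obtain ⟨j, rfl⟩ := hi
    rw [ext0_apply]; rfl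
  · rw [ext0_apply_of_notMem hg _ hi, h i hi]

end L1

/-- The injection of `ℕ` fixing the numbers below `2 ^ n` and putting equal gaps between the
following dyadic blocks. -/
def spread (n i : ℕ) : ℕ := if i < 2 ^ n then i else i + 2 ^ Nat.log 2 i

theorem spread_of_lt {n : ℕ} (hi : i < 2 ^ n) : spread n i = i := if_pos hi

theorem spread_of_ge {n : ℕ} (hi : 2 ^ n ≤ i) :
    ∃ p, spread n i = i + p ∧ p ≤ i ∧ i < 2 * p ∧
      (i < 2 * 2 ^ n → p = 2 ^ n) ∧ (2 * 2 ^ n ≤ i → 2 * 2 ^ n ≤ p) := by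
  have h0 : i ≠ 0 := (lt_of_lt_of_le (by positivity) hi).ne'
  refine ⟨2 ^ Nat.log 2 i, if_neg (by omega), Nat.pow_log_le_self 2 h0, ?_, fun h => ?_,
    fun h => ?_⟩
  · have := Nat.lt_pow_succ_log_self (b := 2) (by norm_num) i
    rwa [pow_succ, mul_comm] at this
  · rw [(Nat.log_eq_iff (Or.inr ⟨by norm_num, h0⟩)).2 ⟨hi, by rw [pow_succ]; omega⟩]
  · rw [← pow_succ'] at h ⊢
    exact Nat.pow_le_pow_right (by norm_num) ((Nat.le_log_iff_pow_le (by norm_num) h0).2 h)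

theorem spread_strictMono (n : ℕ) : StrictMono (spread n) := by
  refine strictMono_nat_of_lt_succ fun i => ?_
  unfold spread
  have := Nat.pow_le_pow_right (n := 2) (by norm_num) (Nat.log_mono_right (b := 2) i.le_succ)
  rw [Nat.succ_eq_add_one] at this
  have := Nat.two_pow_pos (Nat.log 2 (i + 1))
  split_ifs <;> omega

theorem spread_injective (n : ℕ) : (spread n).Injective := (spread_strictMono n).injective

theorem spread_lt_iff {n : ℕ} (j : ℕ) : spread n j < 2 ^ n ↔ j < 2 ^ n := by
  by_cases h : j < 2 ^ n
  · rw [spread_of_lt h]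
  · obtain ⟨p, h1, h2, h3, h4, h5⟩ := spread_of_ge (not_lt.1 h)
    omega

theorem spread_lt_two_iff {n : ℕ} (j : ℕ) : spread n j < 2 * 2 ^ n ↔ j < 2 ^ n := by
  by_cases h : j < 2 ^ n
  · rw [spread_of_lt h]; omega
  · obtain ⟨p, h1, h2, h3, h4, h5⟩ := spread_of_ge (not_lt.1 h)
    by_cases h6 : j < 2 * 2 ^ n
    · have := h4 h6; omega
    · omega

theorem spread_lt_three_iff {n : ℕ} (j : ℕ) : spread n j < 3 * 2 ^ n ↔ j < 2 * 2 ^ n := by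
  by_cases h : j < 2 ^ n
  · rw [spread_of_lt h]; omega
  · obtain ⟨p, h1, h2, h3, h4, h5⟩ := spread_of_ge (not_lt.1 h)
    by_cases h6 : j < 2 * 2 ^ n
    · have := h4 h6; omega
    · omega

/-- Extension by zero along `spread n`. -/
noncomputable def spreadExt (n : ℕ) : L1 ℕ ℝ → L1 ℕ ℝ := ext0 (spread_injective n)

theorem trunc_spreadExt (n : ℕ) (x : L1 ℕ ℝ) :
    trunc (2 ^ n) (spreadExt n x) = trunc (2 ^ n) x := by
  ext i
  rw [trunc_apply, trunc_apply]
  split_ifs with h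
  · conv_lhs => rw [← spread_of_lt h]
    exact ext0_apply _ _ _
  · rfl

theorem tail_spreadExt (n : ℕ) (x : L1 ℕ ℝ) : tail (2 ^ n) (spreadExt n x) = tail (2 ^ n) x :=
  tail_ext0 _ _ spread_lt_iff

theorem tail_two_spreadExt (n : ℕ) (x : L1 ℕ ℝ) :
    tail (2 * 2 ^ n) (spreadExt n x) = tail (2 ^ n) x :=
  tail_ext0 _ _ spread_lt_two_iff

theorem tail_three_spreadExt (n : ℕ) (x : L1 ℕ ℝ) :
    tail (3 * 2 ^ n) (spreadExt n x) = tail (2 * 2 ^ n) x :=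
  tail_ext0 _ _ spread_lt_three_iff

theorem turn_spreadExt (n : ℕ) (x : L1 ℕ ℝ) :
    turn (2 ^ n) (Real.pi / 2) (spreadExt n x) = spreadExt (n + 1) x := by
  have hp : 2 ^ (n + 1) = 2 * 2 ^ n := pow_succ' 2 n
  have e1 : ∀ m i, spreadExt m x (spread m i) = x i := fun m i => ext0_apply _ _ _
  have e0 : ∀ m i, (∀ j, spread m j ≠ i) → spreadExt m x i = 0 := fun m i h =>
    ext0_apply_of_notMem _ _ (by rintro ⟨j, hj⟩; exact h j hj)
  have e2 : ∀ i < 2 ^ (n + 1), spreadExt (n + 1) x i = x i := fun i hi => by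
    conv_lhs => rw [← spread_of_lt hi]
    exact e1 _ _
  have e3 : ∀ j, 2 * 2 ^ n ≤ j → spread (n + 1) j = spread n j := fun j hj => by
    unfold spread
    rw [if_neg (by omega), if_neg (by omega)]
  have e4 := fun j => spread_lt_two_iff (n := n + 1) j
  have e5 := fun j => spread_lt_iff (n := n + 1) j
  have e6 := fun j => spread_lt_two_iff (n := n) j
  have e7 := fun j => spread_lt_three_iff (n := n) j
  rw [hp] at e4 e5 e2
  refine ext_blocks (N := 2 ^ n) (fun i hi => ?_) (fun i hi => ?_) fun i h1 h2 => ⟨?_, ?_⟩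
  · rw [turn_apply_of_lt hi, e2 i (by omega)]
    conv_lhs => rw [← spread_of_lt hi]
    exact e1 _ _
  · rw [turn_apply_of_ge hi]
    by_cases h : ∃ j, 2 * 2 ^ n ≤ j ∧ spread n j = i
    · obtain ⟨j, hj, rfl⟩ := h
      rw [e1, ← e3 j hj, e1]
    · push Not at h
      rw [e0, e0]
      · rintro j rfl
        have := e5 j
        exact h j (by omega) (e3 j (by omega)).symm
      · rintro j rfl
        have := e7 j
        exact h j (by omega) rfl
  · obtain ⟨p, h3, -, -, h4, -⟩ := spread_of_ge h1
    rw [h4 h2] at h3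
    rw [turn_half_left h1 h2, ← h3, e1, e2 i h2]
  · rw [turn_half_right h1 h2, e0, e0, neg_zero]
    · rintro j hj
      have := e4 j
      have := e5 j
      omega
    · rintro j rfl
      have := e6 j
      have := spread_lt_iff (n := n) j
      omega

end Continuation

namespace Continuation

open Filter L1 Metric

section Stage

variable (K : Set (L1 ℕ ℝ))

/-- The angle of rotation: zero if the tail is small compared with the gap and `π / 2` if it is
large. -/
noncomputable def angle (N : ℕ) (u : L1 ℕ ℝ) : ℝ :=
  Real.pi / 2 * max 0 (min 1 ((tail (3 * N) u - 2 * gap K N u) / (2 * gap K N u)))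

variable {K} {N : ℕ} {u : L1 ℕ ℝ}

theorem angle_turn (t : ℝ) : angle K N (turn N t u) = angle K N u := by
  rw [angle, gap_congr trunc_turn tail_turn, tail_turn_of_ge le_rfl, angle]

theorem angle_of_le (ha : 0 < gap K N u) (h : tail (3 * N) u ≤ 2 * gap K N u) :
    angle K N u = 0 := by
  have : (tail (3 * N) u - 2 * gap K N u) / (2 * gap K N u) ≤ 0 :=
    div_nonpos_of_nonpos_of_nonneg (by linarith) (by linarith)
  rw [angle, max_eq_left ((min_le_right _ _).trans this), mul_zero]

theorem angle_of_ge (ha : 0 < gap K N u) (h : 4 * gap K N u ≤ tail (3 * N) u) :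
    angle K N u = Real.pi / 2 := by
  have : 1 ≤ (tail (3 * N) u - 2 * gap K N u) / (2 * gap K N u) :=
    (one_le_div (by linarith)).2 (by linarith)
  rw [angle, min_eq_left this, max_eq_right zero_le_one, mul_one]

theorem continuous_angle (ha : ∀ u, 0 < gap K N u) : Continuous (angle K N) := by
  have h1 : Continuous (gap K N) := continuous_gap
  have h2 : Continuous fun u => tail (3 * N) u := continuous_tail (E := ℝ) (3 * N)
  refine continuous_const.mul (continuous_const.max (continuous_const.min ?_))
  exact (h2.sub (h1.const_mul 2)).div (h1.const_mul 2) fun u => by have := ha u; positivity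

variable (hK : ∀ N u, 0 < gap K N u)

/-- Squeezing followed by a rotation. -/
noncomputable def stage (N : ℕ) : L1 ℕ ℝ ≃ₜ L1 ℕ ℝ where
  toFun u := turn N (angle K N (squeeze K true N u)) (squeeze K true N u)
  invFun u := squeeze K false N (turn N (-angle K N u) u)
  left_inv u := by
    dsimp only
    rw [angle_turn, turn_turn]
    exact squeeze_squeeze (b := true) (hK N u)
  right_inv u := by
    dsimp only
    rw [show true = !false from rfl, squeeze_squeeze (hK N _), angle_turn]
    have := turn_turn (N := N) (t := -angle K N u) (u := u)
    rwa [neg_neg] at this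
  continuous_toFun :=
    continuous_turn ((continuous_angle (hK N)).comp (continuous_squeeze (hK N)))
      (continuous_squeeze (hK N))
  continuous_invFun :=
    (continuous_squeeze (hK N)).comp (continuous_turn (continuous_angle (hK N)).neg continuous_id)

theorem stage_apply : stage hK N u =
    turn N (angle K N (squeeze K true N u)) (squeeze K true N u) := rfl

theorem trunc_stage : trunc N (stage hK N u) = trunc N u := by
  rw [stage_apply, trunc_turn, trunc_squeeze]

theorem tail_stage : tail N (stage hK N u) = tail N u := by
  rw [stage_apply, tail_turn, tail_squeeze (hK N u)]

theorem tail_stage_of_ge {M : ℕ} (hM : 3 * N ≤ M) :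
    tail M (stage hK N u) = tail M (squeeze K true N u) := by
  rw [stage_apply, tail_turn_of_ge hM]

theorem tail_stage_le {M : ℕ} (hM : 3 * N ≤ M) : tail M (stage hK N u) ≤ tail M u := by
  rw [tail_stage_of_ge hK hM]
  exact tail_mono_of_le fun i hi => norm_squeeze_apply_le (hK N u) (by omega)

theorem stage_of_angle (h : angle K N (squeeze K true N u) = 0) :
    stage hK N u = squeeze K true N u := by rw [stage_apply, h, turn_zero]

theorem stage_of_tail_le (h : tail (2 * N) u ≤ gap K N u) : stage hK N u = u := by
  have h1 : squeeze K true N u = u := squeeze_of_exc (hK N u) (max_eq_right (by linarith))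
  have h2 : tail (3 * N) u ≤ tail (2 * N) u := tail_antitone u (by omega)
  rw [stage_of_angle, h1]
  rw [h1, angle_of_le (hK N u) (by linarith [hK N u])]

theorem tail_two_stage (h : tail (2 * N) u ≤ blockNorm N u) :
    stage hK N u = squeeze K true N u ∧ tail (2 * N) (stage hK N u) ≤ 2 * gap K N u := by
  have h1 := tail_squeeze_le_gap (hK N u) h
  have h2 : tail (3 * N) (squeeze K true N u) ≤ tail (2 * N) (squeeze K true N u) :=
    tail_antitone _ (by omega)
  have h3 : stage hK N u = squeeze K true N u := stage_of_angle hK <|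
    angle_of_le (hK N _) (by rw [gap_squeeze (hK N u)]; linarith)
  exact ⟨h3, by rwa [h3]⟩

end Stage

section Flow

variable {K : Set (L1 ℕ ℝ)} (hK : ∀ N u, 0 < gap K N u)

/-- The composition of the first `n` stages. -/
noncomputable def flow : ℕ → (L1 ℕ ℝ ≃ₜ L1 ℕ ℝ)
  | 0 => Homeomorph.refl _
  | n + 1 => (flow n).trans (stage hK (2 ^ n))

variable (u : L1 ℕ ℝ)

theorem flow_zero : flow hK 0 u = u := rfl

theorem flow_succ (n : ℕ) : flow hK (n + 1) u = stage hK (2 ^ n) (flow hK n u) := rfl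

theorem trunc_eq_of_le {x y : L1 ℕ ℝ} {n m : ℕ} (hnm : n ≤ m)
    (h : trunc m x = trunc m y) (ht : tail m x = tail m y) :
    trunc n x = trunc n y ∧ tail n x = tail n y := by
  have h1 : ∀ j < m, x j = y j := fun j hj => by
    have := congrArg (fun z : L1 ℕ ℝ => z j) h
    simpa [hj] using this
  refine ⟨?_, ?_⟩
  · ext j
    rw [trunc_apply, trunc_apply]
    split_ifs with hj
    · exact h1 j (by omega)
    · rfl
  · linarith [tail_sub_tail hnm h1]

theorem flow_stable {n m : ℕ} (hnm : n ≤ m) :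
    trunc (2 ^ n) (flow hK m u) = trunc (2 ^ n) (flow hK n u) ∧
      tail (2 ^ n) (flow hK m u) = tail (2 ^ n) (flow hK n u) := by
  induction m, hnm using Nat.le_induction with
  | base => exact ⟨rfl, rfl⟩
  | succ m hm ih =>
    have h := trunc_eq_of_le (Nat.pow_le_pow_right (n := 2) (by norm_num) hm)
      (trunc_stage hK (N := 2 ^ m) (u := flow hK m u)) (tail_stage hK)
    rw [flow_succ, h.1, h.2]
    exact ih

theorem tail_flow_le (m : ℕ) : tail (2 * 2 ^ m) (flow hK m u) ≤ tail (2 * 2 ^ m) u := by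
  have key : ∀ j ≤ m, tail (2 * 2 ^ m) (flow hK j u) ≤ tail (2 * 2 ^ m) u := fun j => by
    induction j with
    | zero => intro; rfl
    | succ j ih =>
      intro hj
      rw [flow_succ]
      refine (tail_stage_le hK ?_).trans (ih (by omega))
      have := Nat.pow_le_pow_right (n := 2) (by norm_num) hj
      rw [pow_succ] at this
      omega
  exact key m le_rfl

theorem tendsto_tail_pow (x : L1 ℕ ℝ) : Tendsto (fun m : ℕ => tail (2 ^ m) x) atTop (𝓝 0) :=
  (tendsto_tail x).comp (tendsto_pow_atTop_atTop_of_one_lt (by norm_num))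

theorem tendsto_tail_flow :
    Tendsto (fun m : ℕ => tail (2 * 2 ^ m) (flow hK m u)) atTop (𝓝 0) :=
  squeeze_zero (fun _ => tail_nonneg _ _)
    (fun m => (tail_flow_le hK u m).trans (tail_antitone u (by omega)))
    (tendsto_tail_pow u)

variable (K) in
/-- The points left fixed by the stages from the `n`-th on. -/
def settled (n : ℕ) : Set (L1 ℕ ℝ) := {u | tail (2 ^ n) u < infDist (trunc (2 ^ n) u) K / 17}

variable (K) in
/-- The points whose tail is at most half the distance of the truncation to `K`. -/
def nearly (n : ℕ) : Set (L1 ℕ ℝ) := {u | tail (2 ^ n) u ≤ infDist (trunc (2 ^ n) u) K / 2}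

theorem continuous_infDist_trunc (n : ℕ) : Continuous fun u => infDist (trunc n u) K :=
  (continuous_infDist_pt K).comp (trunc n).continuous

theorem isOpen_settled (n : ℕ) : IsOpen (settled K n) :=
  isOpen_lt (continuous_tail _) ((continuous_infDist_trunc _).div_const _)

theorem isClosed_nearly (n : ℕ) : IsClosed (nearly K n) :=
  isClosed_le (continuous_tail _) ((continuous_infDist_trunc _).div_const _)

theorem settled_subset_nearly (n : ℕ) : settled K n ⊆ nearly K n := fun x hx => by
  have h1 : tail (2 ^ n) x < infDist (trunc (2 ^ n) x) K / 17 := hx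
  have h2 : 0 ≤ infDist (trunc (2 ^ n) x) K := infDist_nonneg
  change tail (2 ^ n) x ≤ infDist (trunc (2 ^ n) x) K / 2
  linarith

theorem monotone_settled : Monotone (settled K) := monotone_nat_of_le_succ fun n x hx => by
  have h1 : tail (2 ^ n) x < infDist (trunc (2 ^ n) x) K / 17 := hx
  have h2 : 2 ^ n ≤ 2 ^ (n + 1) := Nat.pow_le_pow_right (by norm_num) (by omega)
  have h3 := infDist_trunc_le K h2 x
  have h4 := tail_antitone x h2
  change tail (2 ^ (n + 1)) x < infDist (trunc (2 ^ (n + 1)) x) K / 17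
  change tail (2 ^ (n + 1)) x ≤ tail (2 ^ n) x at h4
  linarith

theorem notMem_of_mem_nearly (hfin : ∀ m x, trunc m x ∉ K) {n : ℕ} {x : L1 ℕ ℝ}
    (hx : x ∈ nearly K n) : x ∉ K := fun hxK => by
  have h1 : tail (2 ^ n) x ≤ infDist (trunc (2 ^ n) x) K / 2 := hx
  have h2 := infDist_le_dist_of_mem (x := trunc (2 ^ n) x) hxK
  rw [dist_comm, dist_eq_norm, norm_sub_trunc] at h2
  have h3 := tail_nonneg (2 ^ n) x
  have h4 : x - trunc (2 ^ n) x = 0 := norm_eq_zero.1 (by rw [norm_sub_trunc]; linarith)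
  exact hfin (2 ^ n) x (by rwa [← sub_eq_zero.1 h4])

theorem mem_iUnion_settled (hcl : IsClosed K) (hne : K.Nonempty) {x : L1 ℕ ℝ} (hx : x ∉ K) :
    ∃ n, x ∈ settled K n := by
  have h0 : 0 < infDist x K := (hcl.notMem_iff_infDist_pos hne).1 hx
  obtain ⟨n, hn⟩ := ((tendsto_tail_pow x).eventually_lt_const
    (u := infDist x K / 18) (by positivity)).exists
  refine ⟨n, ?_⟩
  have h2 := infDist_le_infDist_add_dist (s := K) (x := x) (y := trunc (2 ^ n) x)
  rw [dist_eq_norm, norm_sub_trunc] at h2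
  change tail (2 ^ n) x < infDist (trunc (2 ^ n) x) K / 17
  linarith

theorem stage_of_settled {n : ℕ} {v : L1 ℕ ℝ} (hv : v ∈ settled K n) :
    stage hK (2 ^ n) v = v := by
  have h1 : tail (2 ^ n) v < infDist (trunc (2 ^ n) v) K / 17 := hv
  have h2 := le_gap (K := K) (N := 2 ^ n) v
  have h3 : tail (2 * 2 ^ n) v ≤ tail (2 ^ n) v := tail_antitone v (by omega)
  exact stage_of_tail_le hK (by linarith)

variable {u} in
theorem flow_of_settled {n m : ℕ} (hnm : n ≤ m) (h : flow hK n u ∈ settled K n) :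
    flow hK m u = flow hK n u := by
  induction m, hnm using Nat.le_induction with
  | base => rfl
  | succ m hm ih =>
    rw [flow_succ, ih, stage_of_settled hK (monotone_settled hm h)]

variable {u} in
/-- A point which is nearly settled eventually settles. -/
theorem exists_settled_of_nearly {m : ℕ} (h : flow hK m u ∈ nearly K m)
    (hfin : ∀ m x, trunc m x ∉ K) (hcl : IsClosed K) (hne : K.Nonempty) :
    ∃ n, flow hK n u ∈ settled K n := by
  have h1 : tail (2 ^ m) (flow hK m u) ≤ infDist (trunc (2 ^ m) (flow hK m u)) K / 2 := h
  set d := infDist (trunc (2 ^ m) (flow hK m u)) K with hd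
  have h0 : 0 < d := (hcl.notMem_iff_infDist_pos hne).1 (hfin _ _)
  obtain ⟨l, hlt, hml⟩ := (((tendsto_tail_flow hK u).eventually_lt_const
    (u := d / 64) (by positivity)).and (eventually_ge_atTop m)).exists
  obtain ⟨h2, h3⟩ := flow_stable hK u hml
  have h4 : d / 2 ≤ infDist (trunc (2 ^ l) (flow hK l u)) K - tail (2 ^ l) (flow hK l u) := by
    refine le_trans ?_ (infDist_trunc_le K (Nat.pow_le_pow_right (n := 2) (by norm_num) hml) _)
    rw [h2, h3]
    linarith
  have h5 := le_gap (K := K) (N := 2 ^ l) (flow hK l u)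
  have h6 : flow hK (l + 1) u = flow hK l u := by
    rw [flow_succ]
    exact stage_of_tail_le hK (by linarith)
  refine ⟨l + 1, ?_⟩
  have h7 := infDist_trunc_le K (show 2 ^ l ≤ 2 * 2 ^ l by omega) (flow hK l u)
  have h8 := tail_nonneg (2 * 2 ^ l) (flow hK l u)
  change tail (2 ^ (l + 1)) (flow hK (l + 1) u) <
    infDist (trunc (2 ^ (l + 1)) (flow hK (l + 1) u)) K / 17
  rw [h6, pow_succ']
  linarith

variable (K) in
/-- The `n`-th stage rotates by a right angle. -/
def FullTurn (n : ℕ) (v : L1 ℕ ℝ) : Prop :=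
  angle K (2 ^ n) (squeeze K true (2 ^ n) v) = Real.pi / 2

variable {u} in
theorem nearly_of_not_fullTurn {n : ℕ} (h : ¬ FullTurn K n (flow hK n u)) :
    flow hK (n + 1) u ∈ nearly K (n + 1) ∨ flow hK (n + 2) u ∈ nearly K (n + 2) := by
  have e1 := flow_succ hK u n
  have e2 := flow_succ hK u (n + 1)
  generalize flow hK (n + 2) u = x at *
  generalize flow hK (n + 1) u = w at *
  generalize flow hK n u = v at *
  have hN : 2 ^ (n + 1) = 2 * 2 ^ n := pow_succ' 2 n
  have h1 : tail (3 * 2 ^ n) (squeeze K true (2 ^ n) v) < 4 * gap K (2 ^ n) v := by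
    by_contra! h1
    exact h (angle_of_ge (hK _ _) (by rwa [gap_squeeze (hK _ _)]))
  have h2 : gap K (2 ^ n) w = gap K (2 ^ n) v := by
    rw [e1]
    exact gap_congr (trunc_stage hK) (tail_stage hK)
  have h3 := gap_le (K := K) (N := 2 ^ n) w
  have h4 : tail (3 * 2 ^ n) w = tail (3 * 2 ^ n) (squeeze K true (2 ^ n) v) := by
    rw [e1]
    exact tail_stage_of_ge hK le_rfl
  have h5 : tail (2 * 2 ^ (n + 1)) w ≤ tail (3 * 2 ^ n) w := tail_antitone w (by omega)
  rcases lt_or_ge (blockNorm (2 ^ (n + 1)) w) (tail (2 * 2 ^ (n + 1)) w) with h6 | h6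
  · left
    change tail (2 ^ (n + 1)) w ≤ infDist (trunc (2 ^ (n + 1)) w) K / 2
    rw [blockNorm] at h6
    rw [hN] at h6 h5 ⊢
    linarith
  · right
    have h8 := (tail_two_stage hK h6).2
    have h9 : gap K (2 ^ (n + 1)) x = gap K (2 ^ (n + 1)) w := by
      rw [e2]
      exact gap_congr (trunc_stage hK) (tail_stage hK)
    rw [← e2] at h8
    have h10 := gap_le (K := K) (N := 2 ^ (n + 1)) x
    change tail (2 ^ (n + 2)) x ≤ infDist (trunc (2 ^ (n + 2)) x) K / 2
    rw [show 2 ^ (n + 2) = 2 * 2 ^ (n + 1) from pow_succ' 2 _]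
    have h12 : 0 ≤ infDist (trunc (2 * 2 ^ (n + 1)) x) K := infDist_nonneg
    linarith

variable {u} in
theorem stage_of_fullTurn {n : ℕ} {v : L1 ℕ ℝ} (h : FullTurn K n v) :
    stage hK (2 ^ n) v = turn (2 ^ n) (Real.pi / 2) (squeeze K true (2 ^ n) v) := by
  rw [stage_apply, h]

/-- A quarter turn moves the first block into the next one. -/
theorem blockNorm_turn_half_ge (N : ℕ) (v : L1 ℕ ℝ) :
    blockNorm N v ≤ blockNorm (2 * N) (turn N (Real.pi / 2) v) := by
  have h1 : ∀ (M : ℕ) (x : L1 ℕ ℝ), blockNorm M x = ∑ j ∈ Finset.range M, ‖x (M + j)‖ :=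
    fun M x => by
      have := sum_add_tail M M x
      rw [← two_mul] at this
      rw [blockNorm]
      linarith
  have h2 : ∑ j ∈ Finset.range N, ‖v (N + j)‖ =
      ∑ j ∈ Finset.range N, ‖turn N (Real.pi / 2) v (2 * N + j)‖ :=
    Finset.sum_congr rfl fun j hj => by
      have hj := Finset.mem_range.1 hj
      rw [show 2 * N + j = N + j + N by ring, turn_half_right (by omega) (by omega), norm_neg]
  rw [h1, h1, h2]
  exact Finset.sum_le_sum_of_subset_of_nonneg
    (Finset.range_subset_range.2 (by omega)) fun _ _ _ => norm_nonneg _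

variable {u} in
theorem blockNorm_squeeze_le_flow {n : ℕ} (h : FullTurn K n (flow hK n u)) :
    blockNorm (2 ^ n) (squeeze K true (2 ^ n) (flow hK n u)) ≤
      blockNorm (2 ^ (n + 1)) (flow hK (n + 1) u) := by
  rw [flow_succ, stage_of_fullTurn hK h, pow_succ']
  exact blockNorm_turn_half_ge _ _

end Flow

section Absorb

variable {K : Set (L1 ℕ ℝ)} (hK : ∀ N u, 0 < gap K N u)

theorem mem_settled_congr {n : ℕ} {x y : L1 ℕ ℝ}
    (h : trunc (2 ^ n) x = trunc (2 ^ n) y ∧ tail (2 ^ n) x = tail (2 ^ n) y) :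
    x ∈ settled K n ↔ y ∈ settled K n := by
  change tail (2 ^ n) x < infDist (trunc (2 ^ n) x) K / 17 ↔
    tail (2 ^ n) y < infDist (trunc (2 ^ n) y) K / 17
  rw [h.1, h.2]

theorem mem_nearly_congr {n : ℕ} {x y : L1 ℕ ℝ}
    (h : trunc (2 ^ n) x = trunc (2 ^ n) y ∧ tail (2 ^ n) x = tail (2 ^ n) y) :
    x ∈ nearly K n ↔ y ∈ nearly K n := by
  change tail (2 ^ n) x ≤ infDist (trunc (2 ^ n) x) K / 2 ↔
    tail (2 ^ n) y ≤ infDist (trunc (2 ^ n) y) K / 2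
  rw [h.1, h.2]

theorem apply_eq_of_trunc_eq {m i : ℕ} (hi : i < m) {x y : L1 ℕ ℝ} (h : trunc m x = trunc m y) :
    x i = y i := by
  have := congrArg (fun z : L1 ℕ ℝ => z i) h
  simpa [hi] using this

theorem eq_of_trunc_eq {x y : L1 ℕ ℝ} (h : ∀ᶠ n in atTop, trunc (2 ^ n) x = trunc (2 ^ n) y) :
    x = y := by
  ext i
  obtain ⟨n, hn, hi⟩ := (h.and (eventually_gt_atTop i)).exists
  exact apply_eq_of_trunc_eq (hi.trans Nat.lt_two_pow_self) hn

variable {u : L1 ℕ ℝ}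

theorem blockNorm_le_flow_succ {n : ℕ} (h : FullTurn K n (flow hK n u)) :
    blockNorm (2 ^ n) (flow hK n u) ≤ blockNorm (2 ^ (n + 1)) (flow hK (n + 1) u) :=
  (blockNorm_le_squeeze (hK _ _)).trans (blockNorm_squeeze_le_flow hK h)

theorem blockNorm_flow_eq_zero (h : ∀ n, FullTurn K n (flow hK n u)) (n : ℕ) :
    blockNorm (2 ^ n) (flow hK n u) = 0 := by
  have hmono : Monotone fun n => blockNorm (2 ^ n) (flow hK n u) :=
    monotone_nat_of_le_succ fun n => blockNorm_le_flow_succ hK (h n)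
  by_contra hne
  have hpos : 0 < blockNorm (2 ^ n) (flow hK n u) :=
    lt_of_le_of_ne blockNorm_nonneg (Ne.symm hne)
  obtain ⟨m, hm, hnm⟩ := (((tendsto_tail_flow hK u).eventually_lt_const hpos).and
    (eventually_ge_atTop n)).exists
  have h1 := tail_squeeze_le_gap (hK (2 ^ m) (flow hK m u)) (hm.le.trans (hmono hnm))
  have h2 : tail (3 * 2 ^ m) (squeeze K true (2 ^ m) (flow hK m u)) ≤
      tail (2 * 2 ^ m) (squeeze K true (2 ^ m) (flow hK m u)) := tail_antitone _ (by omega)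
  have h3 : angle K (2 ^ m) (squeeze K true (2 ^ m) (flow hK m u)) = 0 :=
    angle_of_le (hK _ _) (by rw [gap_squeeze (hK _ _)]; linarith)
  have h4 := h m
  rw [FullTurn, h3] at h4
  linarith [Real.pi_pos]

theorem flow_succ_of_fullTurn (h : ∀ n, FullTurn K n (flow hK n u)) (n : ℕ) :
    flow hK (n + 1) u = turn (2 ^ n) (Real.pi / 2) (flow hK n u) := by
  rw [flow_succ, stage_of_fullTurn hK (h n),
    squeeze_of_block (hK _ _) (blockNorm_flow_eq_zero hK h n)]

theorem apply_eq_zero_of_blockNorm {N : ℕ} {x : L1 ℕ ℝ} (h : blockNorm N x = 0) {i : ℕ}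
    (h1 : N ≤ i) (h2 : i < 2 * N) : x i = 0 := by
  rw [← norm_block, norm_eq_zero, sub_eq_zero] at h
  have := congrArg (fun z : L1 ℕ ℝ => z i) h
  simpa [h2, not_lt.2 h1] using this

/-- If all rotations are by a right angle, the point is spread. -/
theorem exists_spreadExt (h : ∀ n, FullTurn K n (flow hK n u)) : ∃ x, u = spreadExt 0 x := by
  have h1 : ∀ n i, 3 * 2 ^ n ≤ 2 * i → flow hK n u i = u i := fun n => by
    induction n with
    | zero => intro i _; rfl
    | succ n ih =>
      intro i hi
      rw [pow_succ'] at hi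
      rw [flow_succ_of_fullTurn hK h, turn_apply_of_ge (by omega), ih i (by omega)]
  have h2 : ∀ n i, 2 ^ n ≤ i → i < 2 * 2 ^ n → flow hK n u i = 0 := fun n i h3 h4 =>
    apply_eq_zero_of_blockNorm (blockNorm_flow_eq_zero hK h n) h3 h4
  refine ⟨restrict (spread_injective 0) u, (ext0_restrict _ _ fun i hi => ?_).symm⟩
  have hi0 : i ≠ 0 := by
    rintro rfl
    exact hi ⟨0, spread_of_lt (by norm_num)⟩
  have h5 := Nat.pow_log_le_self 2 hi0
  have h6 := Nat.lt_pow_succ_log_self (b := 2) (by norm_num) i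
  rw [pow_succ'] at h6
  rcases hn : Nat.log 2 i with _ | m
  · rw [hn] at h5 h6
    exact h2 0 i h5 h6
  · rw [hn] at h5 h6
    rw [← h1 (m + 1) i ?_]
    · exact h2 (m + 1) i h5 h6
    · by_contra! hlt
      rw [pow_succ'] at h5 h6 hlt
      have h7 := Nat.two_pow_pos m
      have h8 : Nat.log 2 (i - 2 ^ m) = m :=
        (Nat.log_eq_iff (Or.inr ⟨by norm_num, by omega⟩)).2 ⟨by omega, by rw [pow_succ']; omega⟩
      refine hi ⟨i - 2 ^ m, ?_⟩
      rw [spread, if_neg (by rw [pow_zero]; omega), h8]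
      omega

theorem spreadExt_congr (n : ℕ) (x : L1 ℕ ℝ) :
    trunc (2 ^ n) (spreadExt n x) = trunc (2 ^ n) x ∧
      tail (2 ^ n) (spreadExt n x) = tail (2 ^ n) x :=
  ⟨trunc_spreadExt n x, tail_spreadExt n x⟩

theorem blockNorm_spreadExt (n : ℕ) (x : L1 ℕ ℝ) : blockNorm (2 ^ n) (spreadExt n x) = 0 := by
  rw [blockNorm, tail_spreadExt, tail_two_spreadExt, sub_self]

include hK in
theorem fullTurn_spreadExt {k : L1 ℕ ℝ} (hk : k ∈ K) (n : ℕ) : FullTurn K n (spreadExt n k) := by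
  rw [FullTurn, squeeze_of_block (hK _ _) (blockNorm_spreadExt n k)]
  refine angle_of_ge (hK _ _) ?_
  rw [tail_three_spreadExt, gap_congr (trunc_spreadExt n k) (tail_spreadExt n k)]
  have h1 := gap_le (K := K) (N := 2 ^ n) k
  have h2 := infDist_le_dist_of_mem (x := trunc (2 * 2 ^ n) k) hk
  rw [dist_comm, dist_eq_norm, norm_sub_trunc] at h2
  linarith [tail_nonneg (2 * 2 ^ n) k]

theorem flow_spreadExt {k : L1 ℕ ℝ} (hk : k ∈ K) (n : ℕ) :
    flow hK n (spreadExt 0 k) = spreadExt n k := by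
  induction n with
  | zero => rfl
  | succ n ih =>
    rw [flow_succ, ih, stage_of_fullTurn hK (fullTurn_spreadExt hK hk n),
      squeeze_of_block (hK _ _) (blockNorm_spreadExt n k), turn_spreadExt]

variable (hfin : ∀ m x, trunc m x ∉ K) (hcl : IsClosed K) (hne : K.Nonempty)

include hfin hcl hne in
theorem exists_settled_or_mem (u : L1 ℕ ℝ) :
    (∃ n, flow hK n u ∈ settled K n) ∨ ∃ x ∈ K, u = spreadExt 0 x := by
  by_cases h : ∀ n, FullTurn K n (flow hK n u)
  · obtain ⟨x, rfl⟩ := exists_spreadExt hK h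
    by_cases hx : x ∈ K
    · exact Or.inr ⟨x, hx, rfl⟩
    have h1 : ∀ n, flow hK n (spreadExt 0 x) = spreadExt n x := fun n => by
      induction n with
      | zero => rfl
      | succ n ih => rw [flow_succ_of_fullTurn hK h, ih, turn_spreadExt]
    obtain ⟨n, hn⟩ := mem_iUnion_settled hcl hne hx
    refine Or.inl ⟨n, ?_⟩
    rw [h1]
    exact (mem_settled_congr (spreadExt_congr n x)).2 hn
  · push Not at h
    obtain ⟨n, hn⟩ := h
    rcases nearly_of_not_fullTurn hK hn with h1 | h1
    · exact Or.inl (exists_settled_of_nearly hK h1 hfin hcl hne)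
    · exact Or.inl (exists_settled_of_nearly hK h1 hfin hcl hne)

/-- The flow carries `u` to `z` in the limit. -/
def FlowTo (u z : L1 ℕ ℝ) : Prop := ∀ n, trunc (2 ^ n) (flow hK n u) = trunc (2 ^ n) z ∧
  tail (2 ^ n) (flow hK n u) = tail (2 ^ n) z

variable {hK} {z : L1 ℕ ℝ}

theorem FlowTo.norm_eq (h : FlowTo hK u z) : ‖u‖ = ‖z‖ := norm_eq_of_trunc_tail (h 0).1 (h 0).2

theorem FlowTo.right_unique {z' : L1 ℕ ℝ} (h : FlowTo hK u z) (h' : FlowTo hK u z') : z = z' :=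
  eq_of_trunc_eq (Eventually.of_forall fun n => (h n).1.symm.trans (h' n).1)

theorem flowTo_of_settled {n : ℕ} (h : flow hK n u ∈ settled K n) : FlowTo hK u (flow hK n u) := by
  intro m
  rcases le_total n m with hnm | hnm
  · rw [flow_of_settled hK hnm h]
    exact ⟨rfl, rfl⟩
  · have := flow_stable hK u hnm
    exact ⟨this.1.symm, this.2.symm⟩

theorem flowTo_spreadExt {k : L1 ℕ ℝ} (hk : k ∈ K) : FlowTo hK (spreadExt 0 k) k := fun n => by
  rw [flow_spreadExt hK hk]
  exact spreadExt_congr n k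

theorem FlowTo.flow_eq (h : FlowTo hK u z) {n m : ℕ} (hz : z ∈ settled K n) (hnm : n ≤ m) :
    flow hK m u = z := by
  have h1 : flow hK n u ∈ settled K n := (mem_settled_congr (h n)).2 hz
  rw [flow_of_settled hK hnm h1]
  exact (flowTo_of_settled h1).right_unique h

include hfin hcl hne in
theorem FlowTo.eq_spreadExt (h : FlowTo hK u z) (hz : z ∈ K) : u = spreadExt 0 z := by
  rcases exists_settled_or_mem hK hfin hcl hne u with ⟨n, hn⟩ | ⟨x, hx, rfl⟩
  · have h1 := (mem_settled_congr (h n)).1 hn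
    exact absurd hz (notMem_of_mem_nearly hfin (settled_subset_nearly n h1))
  · rw [(flowTo_spreadExt hx).right_unique h]

include hfin hcl hne in
theorem FlowTo.left_unique {u' : L1 ℕ ℝ} (h : FlowTo hK u z) (h' : FlowTo hK u' z) : u = u' := by
  by_cases hz : z ∈ K
  · rw [h.eq_spreadExt hfin hcl hne hz, h'.eq_spreadExt hfin hcl hne hz]
  · obtain ⟨n, hn⟩ := mem_iUnion_settled hcl hne hz
    exact (flow hK n).injective ((h.flow_eq hn le_rfl).trans (h'.flow_eq hn le_rfl).symm)

include hfin hcl hne in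
theorem exists_flowTo_right (u : L1 ℕ ℝ) : ∃ z, FlowTo hK u z := by
  rcases exists_settled_or_mem hK hfin hcl hne u with ⟨n, hn⟩ | ⟨x, hx, rfl⟩
  · exact ⟨_, flowTo_of_settled hn⟩
  · exact ⟨x, flowTo_spreadExt hx⟩

include hcl hne in
theorem exists_flowTo_left (z : L1 ℕ ℝ) : ∃ u, FlowTo hK u z := by
  by_cases hz : z ∈ K
  · exact ⟨_, flowTo_spreadExt hz⟩
  · obtain ⟨n, hn⟩ := mem_iUnion_settled hcl hne hz
    have h1 : flow hK n ((flow hK n).symm z) = z := (flow hK n).apply_symm_apply z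
    refine ⟨(flow hK n).symm z, ?_⟩
    have h2 := flowTo_of_settled (hK := hK) (u := (flow hK n).symm z) (by rwa [h1])
    rwa [h1] at h2

theorem norm_sub_le_of_trunc (N : ℕ) (x y : L1 ℕ ℝ) :
    ‖x - y‖ ≤ ‖trunc N x - trunc N y‖ + tail N x + tail N y := by
  have h : x - y = (trunc N x - trunc N y) + (x - trunc N x) - (y - trunc N y) := by abel
  rw [← norm_sub_trunc, ← norm_sub_trunc]
  conv_lhs => rw [h]
  exact (_root_.norm_sub_le _ _).trans (add_le_add_left (norm_add_le _ _) _)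

theorem FlowTo.norm_sub_le (h : FlowTo hK u z) {k : L1 ℕ ℝ} (n : ℕ)
    (hz : ∀ j ≤ n + 1, z ∉ nearly K j) :
    ‖u - spreadExt 0 k‖ ≤ ‖z - k‖ + 3 * tail (2 ^ n) z + tail (2 ^ n) k := by
  have hfull : ∀ j < n, FullTurn K j (flow hK j u) := fun j hj => by
    by_contra hno
    rcases nearly_of_not_fullTurn hK hno with h1 | h1
    · exact hz (j + 1) (by omega) ((mem_nearly_congr (h _)).1 h1)
    · exact hz (j + 2) (by omega) ((mem_nearly_congr (h _)).1 h1)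
  have key : ∀ j ≤ n, ‖u - spreadExt 0 k‖ ≤ ‖flow hK j u - spreadExt j k‖ +
      2 * blockNorm (2 ^ j) (flow hK j u) := fun j => by
    induction j with
    | zero =>
      intro _
      have : 0 ≤ blockNorm (2 ^ 0) (flow hK 0 u) := blockNorm_nonneg
      rw [flow_zero] at this ⊢
      linarith
    | succ j ih =>
      intro hj
      have h1 := ih (by omega)
      have h2 := hfull j (by omega)
      have h3 := blockNorm_squeeze_le_flow hK h2
      have h4 := norm_squeeze_sub_le (hK (2 ^ j) (flow hK j u))
      have h5 : ‖flow hK (j + 1) u - spreadExt (j + 1) k‖ =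
          ‖squeeze K true (2 ^ j) (flow hK j u) - spreadExt j k‖ := by
        rw [flow_succ, stage_of_fullTurn hK h2, ← turn_spreadExt, ← turn_half_sub, norm_turn]
      have h6 : ‖flow hK j u - spreadExt j k‖ ≤
          ‖squeeze K true (2 ^ j) (flow hK j u) - flow hK j u‖ +
          ‖squeeze K true (2 ^ j) (flow hK j u) - spreadExt j k‖ := by
        rw [norm_sub_rev (squeeze K true (2 ^ j) (flow hK j u)) (flow hK j u)]
        exact norm_sub_le_norm_sub_add_norm_sub _ _ _
      linarith
  have h1 := key n le_rfl
  have h2 := norm_sub_le_of_trunc (2 ^ n) (flow hK n u) (spreadExt n k)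
  rw [(h n).1, (h n).2, trunc_spreadExt, tail_spreadExt, ← map_sub] at h2
  have h3 := norm_trunc_le (2 ^ n) (z - k)
  have h4 : blockNorm (2 ^ n) (flow hK n u) ≤ tail (2 ^ n) z := by
    rw [blockNorm, (h n).2]
    linarith [tail_nonneg (2 * 2 ^ n) (flow hK n u)]
  linarith

/-- A closed set which misses all finitely supported sequences can be moved into the sequences
which vanish off the range of `spread 0`. -/
theorem exists_homeo_spreadExt (hfin : ∀ m x, trunc m x ∉ K) (hcl : IsClosed K)
    (hne : K.Nonempty) : ∃ h : L1 ℕ ℝ ≃ₜ L1 ℕ ℝ, ∀ k ∈ K, h k = spreadExt 0 k := by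
  have hK : ∀ N u, 0 < gap K N u := fun N u => gap_pos hcl hne hfin u
  choose F hF using exists_flowTo_right (hK := hK) hfin hcl hne
  choose G hG using exists_flowTo_left (hK := hK) hcl hne
  have hcF : Continuous F := by
    refine continuous_of_norm (fun i => ?_) ?_
    · have : (fun u => F u i) = fun u => flow hK i u i := by
        funext u
        exact (apply_eq_of_trunc_eq Nat.lt_two_pow_self (hF u i).1).symm
      rw [this]
      exact (L1.continuous_apply i).comp (flow hK i).continuous
    · have : (fun u => ‖F u‖) = fun u => ‖u‖ := funext fun u => (hF u).norm_eq.symm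
      rw [this]
      exact continuous_norm
  have hGk : ∀ k ∈ K, G k = spreadExt 0 k := fun k hk => (hG k).eq_spreadExt hfin hcl hne hk
  have hcG : Continuous G := continuous_iff_continuousAt.2 fun z => by
    by_cases hz : z ∈ K
    · rw [Metric.continuousAt_iff']
      intro ε hε
      obtain ⟨n, hn⟩ := ((tendsto_tail_pow z).eventually_lt_const
        (u := ε / 8) (by positivity)).exists
      have h1 : ∀ᶠ x in 𝓝 z, tail (2 ^ n) x < ε / 8 :=
        (continuous_tail (2 ^ n)).continuousAt.eventually_lt_const hn
      have h2 : ∀ᶠ x in 𝓝 z, dist x z < ε / 8 := Metric.ball_mem_nhds z (by positivity)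
      have h3 : ∀ᶠ x in 𝓝 z, ∀ j ∈ Finset.range (n + 2), x ∉ nearly K j :=
        (Finset.eventually_all _).2 fun j _ =>
          (isClosed_nearly j).isOpen_compl.mem_nhds fun hj => notMem_of_mem_nearly hfin hj hz
      filter_upwards [h1, h2, h3] with x h1 h2 h3
      have h4 := (hG x).norm_sub_le (k := z) n fun j hj => h3 j (by simp; omega)
      rw [hGk z hz, dist_eq_norm]
      rw [dist_eq_norm] at h2
      linarith
    · obtain ⟨n, hn⟩ := mem_iUnion_settled hcl hne hz
      have h1 : G =ᶠ[𝓝 z] (flow hK n).symm := by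
        filter_upwards [(isOpen_settled n).mem_nhds hn] with x hx
        exact (flow hK n).injective
          (((hG x).flow_eq hx le_rfl).trans ((flow hK n).apply_symm_apply x).symm)
      exact (flow hK n).symm.continuous.continuousAt.congr h1.symm
  exact ⟨{ toFun := G, invFun := F
           left_inv := fun z => (hF _).right_unique (hG z)
           right_inv := fun u => (hG _).left_unique hfin hcl hne (hF u)
           continuous_toFun := hcG, continuous_invFun := hcF }, hGk⟩

end Absorb

section Split

variable {g g' : ℕ → ℕ} (hg : g.Injective) (hg' : g'.Injective)

theorem norm_restrict_le (x : L1 ℕ ℝ) : ‖restrict hg x‖ ≤ ‖x‖ := by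
  refine norm_le_of_sum_le fun s => ?_
  have h := sum_le_norm x (s.map ⟨g, hg⟩)
  rw [Finset.sum_map] at h
  exact h

theorem continuous_restrict : Continuous (restrict hg) := by
  refine (LipschitzWith.of_dist_le_mul (K := 1) fun x y => ?_).continuous
  rw [NNReal.coe_one, one_mul, dist_eq_norm, dist_eq_norm]
  exact norm_restrict_le hg (x - y)

/-- The splitting of a sequence into two subsequences. -/
noncomputable def splitHomeo (hgg : IsCompl (range g) (range g')) :
    L1 ℕ ℝ ≃ₜ L1 ℕ ℝ × L1 ℕ ℝ where
  toFun x := (restrict hg x, restrict hg' x)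
  invFun p := ext0 hg p.1 + ext0 hg' p.2
  left_inv x := by
    ext i
    change ext0 hg _ i + ext0 hg' _ i = _
    by_cases hi : i ∈ range g
    · have h' : i ∉ range g' := fun h => hgg.disjoint.le_bot ⟨hi, h⟩
      obtain ⟨j, rfl⟩ := hi
      rw [ext0_apply_of_notMem _ _ h', ext0_apply, add_zero]
      rfl
    · have h' : i ∈ range g' := by
        have := hgg.compl_eq
        rw [← this]
        exact hi
      rw [ext0_apply_of_notMem _ _ hi, zero_add]
      obtain ⟨j, rfl⟩ := h'
      rw [ext0_apply]
      rfl
  right_inv p := by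
    refine Prod.ext ?_ ?_
    · ext i
      have h' : g i ∉ range g' := fun h => hgg.disjoint.le_bot ⟨mem_range_self i, h⟩
      change ext0 hg _ (g i) + ext0 hg' _ (g i) = _
      rw [ext0_apply, ext0_apply_of_notMem _ _ h', add_zero]
    · ext i
      have h' : g' i ∉ range g := fun h => hgg.disjoint.le_bot ⟨h, mem_range_self i⟩
      change ext0 hg _ (g' i) + ext0 hg' _ (g' i) = _
      rw [ext0_apply, ext0_apply_of_notMem _ _ h', zero_add]
  continuous_toFun := (continuous_restrict hg).prodMk (continuous_restrict hg')
  continuous_invFun := ((isometry_ext0 hg).continuous.comp continuous_fst).add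
    ((isometry_ext0 hg').continuous.comp continuous_snd)

theorem splitHomeo_ext0 (hgg : IsCompl (range g) (range g')) (x : L1 ℕ ℝ) :
    splitHomeo hg hg' hgg (ext0 hg x) = (x, 0) := by
  rw [← Homeomorph.eq_symm_apply]
  have h0 : ext0 hg' 0 = 0 := norm_eq_zero.1 (by rw [norm_ext0, norm_zero])
  change _ = ext0 hg x + ext0 hg' 0
  rw [h0, add_zero]

theorem three_mul_two_pow_notMem_range_spread (m : ℕ) : 3 * 2 ^ m ∉ range (spread 0) := by
  rintro ⟨j, hj⟩
  have hm := Nat.two_pow_pos m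
  rcases Nat.eq_zero_or_pos j with rfl | h0
  · rw [spread_of_lt (by norm_num)] at hj
    omega
  rw [spread, if_neg (by rw [pow_zero]; omega)] at hj
  have h5 := Nat.pow_log_le_self 2 h0.ne'
  have h6 := Nat.lt_pow_succ_log_self (b := 2) (by norm_num) j
  rw [pow_succ'] at h6
  rcases le_or_gt (Nat.log 2 j) m with h | h
  · have := Nat.pow_le_pow_right (n := 2) (by norm_num) h
    omega
  · have := Nat.pow_le_pow_right (n := 2) (by norm_num) (Nat.succ_le_of_lt h)
    rw [Nat.succ_eq_add_one, pow_succ'] at this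
    omega

/-- Splitting along the range of `spread 0`. -/
theorem exists_split : ∃ h : L1 ℕ ℝ ≃ₜ L1 ℕ ℝ × L1 ℕ ℝ, ∀ x, h (spreadExt 0 x) = (x, 0) := by
  have hinf : Infinite ((range (spread 0))ᶜ : Set ℕ) := by
    refine Infinite.of_injective
      (fun m : ℕ => (⟨3 * 2 ^ m, three_mul_two_pow_notMem_range_spread m⟩ :
        ((range (spread 0))ᶜ : Set ℕ))) fun m n h => ?_
    have h1 : 3 * 2 ^ m = 3 * 2 ^ n := congrArg Subtype.val h
    exact Nat.pow_right_injective le_rfl (Nat.eq_of_mul_eq_mul_left (by norm_num) h1)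
  obtain ⟨e⟩ : Nonempty (ℕ ≃ ((range (spread 0))ᶜ : Set ℕ)) := nonempty_equiv_of_countable
  have hr : range (Subtype.val ∘ e) = (range (spread 0))ᶜ := by
    rw [e.surjective.range_comp, Subtype.range_coe]
  exact ⟨splitHomeo (spread_injective 0) (Subtype.val_injective.comp e.injective)
    (by rw [hr]; exact isCompl_compl), fun x => splitHomeo_ext0 _ _ _ x⟩

end Split

/-- A `Z`-set is carried into the first factor of a product decomposition. -/
theorem exists_homeo_prod {K : Set L2Space} (hK : IsZSet K) :
    ∃ (h : L2Space ≃ₜ L1 ℕ ℝ × L1 ℕ ℝ) (j : K → L1 ℕ ℝ), IsClosedEmbedding j ∧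
      ∀ k : K, h k = (j k, 0) := by
  obtain ⟨s, hs⟩ := exists_split
  obtain ⟨μ⟩ : Nonempty (L2Space ≃ₜ L1 ℕ ℝ) := ⟨mazur⟩
  rcases K.eq_empty_or_nonempty with rfl | hne
  · exact ⟨μ.trans s, fun k => k.2.elim,
      ⟨.of_subsingleton _, by rw [range_eq_empty]; exact isClosed_empty⟩, fun k => k.2.elim⟩
  obtain ⟨h, hh⟩ := exists_homeo_trunc_notMem (hK.1.preimage μ.symm.continuous)
    (IsZType.preimage hK.2 μ.symm)
  obtain ⟨a, ha⟩ := exists_homeo_spreadExt (K := h ⁻¹' (μ.symm ⁻¹' K)) (fun m x => hh m x)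
    ((hK.1.preimage μ.symm.continuous).preimage h.continuous)
    ((hne.preimage μ.symm.surjective).preimage h.surjective)
  refine ⟨μ.trans (h.symm.trans (a.trans s)), fun k => h.symm (μ k),
    h.symm.isClosedEmbedding.comp (μ.isClosedEmbedding.comp hK.1.isClosedEmbedding_subtypeVal),
    fun k => ?_⟩
  change s (a (h.symm (μ k))) = _
  rw [ha, hs]
  change μ.symm (h (h.symm (μ k))) ∈ K
  rw [h.apply_symm_apply, μ.symm_apply_apply]
  exact k.2

/-- Two closed embeddings into the first factor differ by a homeomorphism of the product. -/
theorem exists_homeo_of_isClosedEmbedding {K : Type*} [TopologicalSpace K] {i j : K → L1 ℕ ℝ}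
    (hi : IsClosedEmbedding i) (hj : IsClosedEmbedding j) :
    ∃ h : L1 ℕ ℝ × L1 ℕ ℝ ≃ₜ L1 ℕ ℝ × L1 ℕ ℝ, ∀ k, h (j k, 0) = (i k, 0) := by
  have hext : ∀ {i j : K → L1 ℕ ℝ}, IsClosedEmbedding i → IsClosedEmbedding j →
      ∃ f : L1 ℕ ℝ → L1 ℕ ℝ, Continuous f ∧ ∀ k, f (j k) = i k := fun {i j} hi hj => by
    rcases isEmpty_or_nonempty K with hK | hK
    · exact ⟨0, continuous_zero, fun k => hK.elim k⟩
    have h1 : ContinuousOn (Function.extend j i 0) (range j) := by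
      rw [continuousOn_iff_continuous_domRestrict,
        ← hj.isEmbedding.toHomeomorph.comp_continuous_iff']
      convert hi.continuous using 1
      exact funext fun k => hj.injective.extend_apply i 0 k
    obtain ⟨f, hf, hfj, -⟩ := exists_dugundji hj.isClosed_range (range_nonempty j) h1
    exact ⟨f, hf, fun k => (hfj _ (mem_range_self k)).trans (hj.injective.extend_apply i 0 k)⟩
  obtain ⟨f, hf, hfj⟩ := hext hi hj
  obtain ⟨g, hg, hgi⟩ := hext hj hi
  let α : L1 ℕ ℝ × L1 ℕ ℝ ≃ₜ L1 ℕ ℝ × L1 ℕ ℝ :=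
    { toFun := fun p => (p.2 + f p.1, p.1)
      invFun := fun p => (p.2, p.1 - f p.2)
      left_inv := fun p => by simp
      right_inv := fun p => by simp
      continuous_toFun := by fun_prop
      continuous_invFun := by fun_prop }
  let β : L1 ℕ ℝ × L1 ℕ ℝ ≃ₜ L1 ℕ ℝ × L1 ℕ ℝ :=
    { toFun := fun p => (p.1, p.2 - g p.1)
      invFun := fun p => (p.1, p.2 + g p.1)
      left_inv := fun p => by simp
      right_inv := fun p => by simp
      continuous_toFun := by fun_prop
      continuous_invFun := by fun_prop }
  refine ⟨α.trans β, fun k => ?_⟩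
  change ((0 : L1 ℕ ℝ) + f (j k), j k - g (0 + f (j k))) = _
  rw [hfj, zero_add, hgi, sub_self]

/-- Every closed embedding of a `Z`-set in a factor homeomorphic to `ℓ¹` comes from a
homeomorphism of the ambient space. -/
theorem exists_homeo_extend {K : Set L2Space} (hK : IsZSet K) {Y : Type*} [TopologicalSpace Y]
    (e : Y ≃ₜ L1 ℕ ℝ) {i : K → Y} (hi : IsClosedEmbedding i) :
    ∃ H : L2Space ≃ₜ Y × L1 ℕ ℝ, ∀ k : K, H k = (i k, 0) := by
  obtain ⟨h, j, hj, hh⟩ := exists_homeo_prod hK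
  obtain ⟨t, ht⟩ := exists_homeo_of_isClosedEmbedding (e.isClosedEmbedding.comp hi) hj
  refine ⟨(h.trans t).trans (e.symm.prodCongr (Homeomorph.refl _)), fun k => ?_⟩
  change (e.symm (t (h k)).1, (t (h k)).2) = _
  rw [hh, ht]
  simp

end Continuation

namespace Continuation

open Filter L1 Metric MeasureTheory

section Cover

variable {X : Type*} [MetricSpace X] [Nonempty X] [SecondCountableTopology X]

/-- The bump function of radius `r` at the `n`-th point of a dense sequence. -/
noncomputable def bump (r : ℝ) (n : ℕ) (x : X) : ℝ :=
  max 0 (min 1 (2 - dist x (TopologicalSpace.denseSeq X n) / r))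

/-- The maximum of the first `n` bump functions of radius `r`. -/
noncomputable def bumpMax (r : ℝ) : ℕ → X → ℝ
  | 0, _ => 0
  | n + 1, x => max (bumpMax r n x) (bump r n x)

/-- A partition of unity subordinate to balls of radius `2 r`. -/
noncomputable def part (r : ℝ) (n : ℕ) (x : X) : ℝ := bumpMax r (n + 1) x - bumpMax r n x

variable {r : ℝ} (n : ℕ) (x : X)

theorem continuous_bump : Continuous (bump r n : X → ℝ) := by unfold bump; fun_prop

theorem continuous_bumpMax : ∀ n, Continuous (bumpMax r n : X → ℝ)
  | 0 => continuous_const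
  | n + 1 => (continuous_bumpMax n).max (continuous_bump n)

theorem continuous_part : Continuous (part r n : X → ℝ) :=
  (continuous_bumpMax _).sub (continuous_bumpMax _)

theorem bump_le_one : bump r n x ≤ 1 := max_le zero_le_one (min_le_left _ _)

theorem bumpMax_le_one : ∀ n, bumpMax r n x ≤ 1
  | 0 => zero_le_one
  | n + 1 => max_le (bumpMax_le_one n) (bump_le_one n x)

theorem part_nonneg : 0 ≤ part r n x := sub_nonneg.2 (le_max_left _ _)

theorem monotone_bumpMax : Monotone fun n => bumpMax r n x :=
  monotone_nat_of_le_succ fun n => sub_nonneg.1 (part_nonneg n x)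

theorem bumpMax_nonneg : 0 ≤ bumpMax r n x := monotone_bumpMax x n.zero_le

theorem dist_lt_of_part_ne_zero (hr : 0 < r) (h : part r n x ≠ 0) :
    dist x (TopologicalSpace.denseSeq X n) < 2 * r := by
  by_contra! h'
  have h1 : bump r n x = 0 := by
    refine max_eq_left ((min_le_right _ _).trans ?_)
    rw [sub_nonpos, le_div_iff₀ hr]
    exact h'
  refine h ?_
  rw [part, bumpMax, h1, max_eq_left (bumpMax_nonneg n x), sub_self]

theorem sum_part : ∑ i ∈ Finset.range n, part r i x = bumpMax r n x := by
  have := Finset.sum_range_sub (fun i => bumpMax r i x) n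
  rw [show bumpMax r 0 x = 0 from rfl, sub_zero] at this
  exact this

theorem exists_bumpMax_eq_one (hr : 0 < r) : ∃ N, ∀ n ≥ N, bumpMax r n x = 1 := by
  obtain ⟨k, hk⟩ := (TopologicalSpace.denseRange_denseSeq X).exists_dist_lt x hr
  refine ⟨k + 1, fun n hn => le_antisymm (bumpMax_le_one x n) ?_⟩
  refine le_trans ?_ (monotone_bumpMax x hn)
  refine le_trans (le_max_of_le_right (le_min le_rfl ?_)) (le_max_right _ _)
  have : dist x (TopologicalSpace.denseSeq X k) / r ≤ 1 := (div_le_one hr).2 hk.le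
  linarith

theorem hasSum_part (hr : 0 < r) : HasSum (fun n => part r n x) 1 := by
  rw [hasSum_iff_tendsto_nat_of_nonneg fun n => part_nonneg n x]
  obtain ⟨N, hN⟩ := exists_bumpMax_eq_one x hr
  refine tendsto_const_nhds.congr' ?_
  filter_upwards [eventually_ge_atTop N] with n hn
  rw [sum_part, hN n hn]

theorem part_le_one : part r n x ≤ 1 :=
  (sub_le_self _ (bumpMax_nonneg n x)).trans (bumpMax_le_one x _)

/-- A sequence of functions merging partitions of unity of radius `2⁻ˡ`. -/
noncomputable def code (i : ℕ) (x : X) : ℝ :=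
  (1 / 2) ^ i.unpair.1 * part ((1 / 2) ^ i.unpair.1) i.unpair.2 x

theorem code_pair (l n : ℕ) : code (Nat.pair l n) x = (1 / 2) ^ l * part ((1 / 2) ^ l) n x := by
  simp [code]

theorem continuous_code : Continuous (code n : X → ℝ) := continuous_const.mul (continuous_part _)

theorem code_nonneg : 0 ≤ code n x := mul_nonneg (by positivity) (part_nonneg _ x)

theorem code_le_one : code n x ≤ 1 :=
  mul_le_one₀ (pow_le_one₀ (by norm_num) (by norm_num)) (part_nonneg _ x) (part_le_one _ x)

theorem hasSum_code : HasSum (fun i => code i x) 2 := by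
  have h1 : ∀ l : ℕ, HasSum (fun n => (1 / 2 : ℝ) ^ l * part ((1 / 2) ^ l) n x) ((1 / 2) ^ l) :=
    fun l => by simpa using (hasSum_part x (r := (1 / 2) ^ l) (by positivity)).mul_left _
  have h0 : ∀ p : ℕ × ℕ, 0 ≤ (1 / 2 : ℝ) ^ p.1 * part ((1 / 2) ^ p.1) p.2 x :=
    fun p => mul_nonneg (by positivity) (part_nonneg _ x)
  have h2 : Summable fun p : ℕ × ℕ => (1 / 2 : ℝ) ^ p.1 * part ((1 / 2) ^ p.1) p.2 x := by
    rw [summable_prod_of_nonneg h0]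
    refine ⟨fun l => (h1 l).summable, ?_⟩
    have : (fun l : ℕ => ∑' n, (1 / 2 : ℝ) ^ l * part ((1 / 2) ^ l) n x) = fun l => (1 / 2) ^ l :=
      funext fun l => (h1 l).tsum_eq
    rw [this]
    exact summable_geometric_two
  have h3 := h2.hasSum.prod_fiberwise h1
  have h4 := h2.hasSum
  rw [h3.unique hasSum_geometric_two] at h4
  have h5 := (Nat.pairEquiv.symm.hasSum_iff (a := 2)).2 h4
  exact h5

/-- The sequence `code` as a map to `ℓ¹`. -/
noncomputable def codeMap (x : X) : L1 ℕ ℝ :=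
  mk (fun i => code i x) (by
    simpa only [Real.norm_of_nonneg (code_nonneg _ x)] using (hasSum_code x).summable)

@[simp] theorem codeMap_apply : codeMap x n = code n x := rfl

theorem norm_codeMap : ‖codeMap x‖ = 2 := by
  rw [norm_eq]
  simpa only [codeMap_apply, Real.norm_of_nonneg (code_nonneg _ x)] using (hasSum_code x).tsum_eq

theorem tail_codeMap (N : ℕ) : tail N (codeMap x) = 2 - ∑ i ∈ Finset.range N, code i x := by
  rw [tail, norm_codeMap]
  simp only [codeMap_apply, Real.norm_of_nonneg (code_nonneg _ x)]

theorem continuous_codeMap : Continuous (codeMap : X → L1 ℕ ℝ) :=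
  continuous_of_norm continuous_code (by simpa only [norm_codeMap] using continuous_const)

theorem exists_dist_lt_of_tail_lt {M l : ℕ} (h : tail M (codeMap x) < (1 / 2) ^ l) :
    ∃ n < M, dist x (TopologicalSpace.denseSeq X n) < 2 * (1 / 2) ^ l := by
  by_contra! h'
  have h0 : ∀ n < M, part ((1 / 2) ^ l) n x = 0 := fun n hn => by
    by_contra h2
    exact absurd (dist_lt_of_part_ne_zero n x (by positivity) h2) (h' n hn).not_gt
  obtain ⟨N, hN⟩ := exists_bumpMax_eq_one x (r := (1 / 2) ^ l) (by positivity)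
  classical
  set s := ((Finset.range N).filter fun n => M ≤ n).image (Nat.pair l)
  have hs : ∑ i ∈ s, code i x = (1 / 2) ^ l := by
    rw [Finset.sum_image fun a _ b _ h => (Nat.pair_eq_pair.1 h).2]
    simp only [code_pair]
    rw [← Finset.mul_sum, Finset.sum_filter_of_ne, sum_part, hN N le_rfl, mul_one]
    intro n _ hn
    by_contra! h2
    exact hn (h0 n h2)
  have hd : Disjoint (Finset.range M) s := by
    rw [Finset.disjoint_left]
    intro i hi his
    obtain ⟨n, hn, rfl⟩ := Finset.mem_image.1 his
    have := (Finset.mem_filter.1 hn).2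
    have := Finset.mem_range.1 hi
    have := Nat.right_le_pair l n
    omega
  have h3 := sum_le_hasSum (Finset.range M ∪ s) (fun i _ => code_nonneg i x) (hasSum_code x)
  rw [Finset.sum_union hd, hs] at h3
  rw [tail_codeMap] at h
  linarith

theorem isCompact_tail_codeMap [CompleteSpace X] {M : ℕ → ℕ} {c : ℕ → ℝ}
    (hc : ∀ l, c l < (1 / 2) ^ l) : IsCompact {x : X | ∀ l, tail (M l) (codeMap x) ≤ c l} := by
  have hcl : IsClosed {x : X | ∀ l, tail (M l) (codeMap x) ≤ c l} := by
    simp only [ofPred_forall]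
    exact isClosed_iInter fun l =>
      isClosed_le ((continuous_tail _).comp continuous_codeMap) continuous_const
  refine isCompact_iff_totallyBounded_isComplete.2 ⟨?_, hcl.isComplete⟩
  refine Metric.totallyBounded_iff.2 fun ε hε => ?_
  obtain ⟨l, hl⟩ := exists_pow_lt_of_lt_one (half_pos hε) (show (1 / 2 : ℝ) < 1 by norm_num)
  refine ⟨TopologicalSpace.denseSeq X '' Iio (M l), (finite_Iio _).image _, fun x hx => ?_⟩
  obtain ⟨n, hn, hd⟩ := exists_dist_lt_of_tail_lt x ((hx l).trans_lt (hc l))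
  rw [biUnion_image]
  exact mem_biUnion (mem_Iio.2 hn) (mem_ball.2 (hd.trans (by linarith)))

theorem isProperMap_codeMap [CompleteSpace X] : IsProperMap (codeMap : X → L1 ℕ ℝ) := by
  refine isProperMap_iff_isCompact_preimage.2 ⟨continuous_codeMap, fun C hC => ?_⟩
  have hpos : ∀ l : ℕ, (0 : ℝ) < (1 / 2) ^ l / 2 := fun l => by positivity
  choose M hM using fun l => exists_tail_lt hC (hpos l)
  exact (isCompact_tail_codeMap fun l => half_lt_self (by positivity)).of_isClosed_subset
    (hC.isClosed.preimage continuous_codeMap) fun x hx l => (hM l _ hx).le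

end Cover

end Continuation

namespace Continuation

open Filter L1 Metric MeasureTheory
open scoped ENNReal NNReal BoundedContinuousFunction

/-! ### Spaces of probability measures are homeomorphic to the Hilbert space -/

section Approx

variable {X : Type*} [MetricSpace X] [Nonempty X] [SecondCountableTopology X]

theorem abs_code_le (n : ℕ) (x : X) : |code n x| ≤ 1 := by
  rw [abs_of_nonneg (code_nonneg n x)]
  exact code_le_one n x

theorem abs_part_le {r : ℝ} (n : ℕ) (x : X) : |part r n x| ≤ 1 := by
  rw [abs_of_nonneg (part_nonneg n x)]
  exact part_le_one n x

theorem summable_smul_part (g : X →ᵇ ℝ) (l : ℕ) (x : X) :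
    Summable fun n => g (TopologicalSpace.denseSeq X n) * part ((1 / 2) ^ l) n x := by
  refine .of_norm_bounded ((hasSum_part x (r := (1 / 2) ^ l) (by positivity)).summable.mul_left ‖g‖)
    fun n => ?_
  rw [norm_mul, Real.norm_of_nonneg (part_nonneg n x)]
  exact mul_le_mul_of_nonneg_right (g.norm_coe_le_norm _) (part_nonneg n x)

theorem tendsto_tsum_part (g : X →ᵇ ℝ) (x : X) :
    Tendsto (fun l : ℕ => ∑' n, g (TopologicalSpace.denseSeq X n) * part ((1 / 2) ^ l) n x)
      atTop (𝓝 (g x)) := by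
  refine Metric.tendsto_atTop.2 fun ε hε => ?_
  obtain ⟨δ, hδ, hg⟩ := Metric.continuousAt_iff.1 (g.continuous.continuousAt (x := x)) (ε / 2)
    (half_pos hε)
  obtain ⟨L, hL⟩ := exists_pow_lt_of_lt_one (half_pos hδ) (show (1 / 2 : ℝ) < 1 by norm_num)
  refine ⟨L, fun l hl => lt_of_le_of_lt ?_ (half_lt_self hε)⟩
  have hp := hasSum_part x (r := (1 / 2) ^ l) (by positivity)
  have h1 := (summable_smul_part g l x).hasSum.sub (hp.mul_left (g x))
  rw [mul_one] at h1
  rw [Real.dist_eq, ← h1.tsum_eq, ← Real.norm_eq_abs]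
  have h2 := hp.mul_left (ε / 2)
  rw [mul_one] at h2
  refine tsum_of_norm_bounded h2 fun n => ?_
  rw [← sub_mul, norm_mul, Real.norm_of_nonneg (part_nonneg n x)]
  by_cases h : part ((1 / 2) ^ l) n x = 0
  · rw [h, mul_zero, mul_zero]
  refine mul_le_mul_of_nonneg_right (hg ?_).le (part_nonneg n x)
  have h3 := dist_lt_of_part_ne_zero n x (by positivity) h
  have h4 : (1 / 2 : ℝ) ^ l ≤ (1 / 2) ^ L := pow_le_pow_of_le_one (by norm_num) (by norm_num) hl
  rw [dist_comm]
  linarith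

theorem norm_tsum_part_le (g : X →ᵇ ℝ) (l : ℕ) (x : X) :
    ‖∑' n, g (TopologicalSpace.denseSeq X n) * part ((1 / 2) ^ l) n x‖ ≤ ‖g‖ := by
  have h2 := (hasSum_part x (r := (1 / 2) ^ l) (by positivity)).mul_left ‖g‖
  rw [mul_one] at h2
  refine tsum_of_norm_bounded h2 fun n => ?_
  rw [norm_mul, Real.norm_of_nonneg (part_nonneg n x)]
  exact mul_le_mul_of_nonneg_right (g.norm_coe_le_norm _) (part_nonneg n x)

end Approx

theorem integrable_of_bounded {X : Type*} [TopologicalSpace X] [SecondCountableTopology X]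
    [MeasurableSpace X] [OpensMeasurableSpace X] {μ : Measure X} [IsFiniteMeasure μ] {f : X → ℝ}
    (hf : Continuous f) {C : ℝ} (hC : ∀ x, |f x| ≤ C) : Integrable f μ :=
  .of_bound hf.aestronglyMeasurable C (.of_forall hC)

/-- Integrating a series of nonnegative functions with constant sum. -/
theorem hasSum_integral_of_hasSum_const {X : Type*} [MeasurableSpace X]
    (μ : ProbabilityMeasure X) {f : ℕ → X → ℝ}
    (hf : ∀ n, Integrable (f n) (μ : Measure X)) (h0 : ∀ n x, 0 ≤ f n x) {c : ℝ}
    (hs : ∀ x, HasSum (fun n => f n x) c) :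
    HasSum (fun n => ∫ x, f n x ∂(μ : Measure X)) c := by
  have h1 : Summable fun n => ∫ x, ‖f n x‖ ∂(μ : Measure X) := by
    simp only [Real.norm_of_nonneg (h0 _ _)]
    refine summable_of_sum_le (c := c) (fun n => integral_nonneg (h0 n)) fun s => ?_
    rw [← integral_finsetSum s fun n _ => hf n]
    calc ∫ x, ∑ n ∈ s, f n x ∂(μ : Measure X) ≤ ∫ x, c ∂(μ : Measure X) :=
          integral_mono (integrable_finsetSum s fun n _ => hf n) (integrable_const c)
            fun x => sum_le_hasSum s (fun n _ => h0 n x) (hs x)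
      _ = c := by simp
  have h2 := hasSum_integral_of_summable_integral_norm hf h1
  simp only [fun x => (hs x).tsum_eq] at h2
  simpa using h2

theorem norm_integral_code {X : Type*} [MetricSpace X] [Nonempty X] [SecondCountableTopology X]
    [MeasurableSpace X] (μ : ProbabilityMeasure X) (n : ℕ) :
    ‖∫ x, code n x ∂(μ : Measure X)‖ = ∫ x, code n x ∂(μ : Measure X) :=
  Real.norm_of_nonneg (integral_nonneg (code_nonneg n))

section Prob

variable {X : Type*} [MetricSpace X] [Nonempty X] [SecondCountableTopology X]
  [MeasurableSpace X] [BorelSpace X]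

theorem integrable_code (μ : Measure X) [IsFiniteMeasure μ] (n : ℕ) : Integrable (code n) μ :=
  integrable_of_bounded (continuous_code n) (abs_code_le n)

theorem integrable_part (μ : Measure X) [IsFiniteMeasure μ] {r : ℝ} (n : ℕ) :
    Integrable (part r n) μ :=
  integrable_of_bounded (continuous_part n) (abs_part_le n)

theorem hasSum_integral_code (μ : ProbabilityMeasure X) :
    HasSum (fun n => ∫ x, code n x ∂(μ : Measure X)) 2 :=
  hasSum_integral_of_hasSum_const μ (integrable_code _) code_nonneg hasSum_code

/-- The barycentre of the image of a probability measure under `codeMap`. -/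
noncomputable def bary (μ : ProbabilityMeasure X) : L1 ℕ ℝ :=
  mk (fun n => ∫ x, code n x ∂(μ : Measure X)) (by
    simpa only [norm_integral_code] using (hasSum_integral_code μ).summable)

theorem bary_apply (μ : ProbabilityMeasure X) (n : ℕ) :
    bary μ n = ∫ x, code n x ∂(μ : Measure X) := rfl

theorem norm_bary (μ : ProbabilityMeasure X) : ‖bary μ‖ = 2 := by
  rw [norm_eq]
  simpa only [bary_apply, norm_integral_code] using (hasSum_integral_code μ).tsum_eq

theorem continuous_bary : Continuous (bary : ProbabilityMeasure X → L1 ℕ ℝ) := by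
  refine continuous_of_norm (fun n => ?_) (by simpa only [norm_bary] using continuous_const)
  exact ProbabilityMeasure.continuous_integral_boundedContinuousFunction
    (BoundedContinuousFunction.ofNormedAddCommGroup (code n) (continuous_code n) 1 (abs_code_le n))

theorem tail_bary (μ : ProbabilityMeasure X) (N : ℕ) :
    tail N (bary μ) = ∫ x, tail N (codeMap x) ∂(μ : Measure X) := by
  simp only [tail_codeMap]
  rw [integral_sub (integrable_const _) (integrable_finsetSum _ fun n _ => integrable_code _ n),
    integral_finsetSum _ fun n _ => integrable_code _ n, tail, norm_bary]
  simp only [bary_apply, norm_integral_code, integral_const, probReal_univ, one_smul]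

theorem bary_diracProba (x : X) : bary (diracProba x) = codeMap x := by
  ext n
  rw [bary_apply, codeMap_apply]
  exact integral_dirac _ _

theorem hasSum_integral_smul_part (μ : ProbabilityMeasure X) (g : X →ᵇ ℝ) (l : ℕ) :
    HasSum (fun n => g (TopologicalSpace.denseSeq X n) *
        ∫ x, part ((1 / 2) ^ l) n x ∂(μ : Measure X))
      (∫ x, ∑' n, g (TopologicalSpace.denseSeq X n) * part ((1 / 2) ^ l) n x ∂(μ : Measure X)) := by
  have hi : ∀ n, Integrable
      (fun x => g (TopologicalSpace.denseSeq X n) * part ((1 / 2) ^ l) n x) (μ : Measure X) :=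
    fun n => (integrable_part _ n).const_mul _
  have h := hasSum_integral_of_summable_integral_norm hi ?_
  · simpa only [integral_const_mul] using h
  · have h1 := hasSum_integral_of_hasSum_const μ (f := fun n => part ((1 / 2) ^ l) n)
      (fun n => integrable_part _ n) part_nonneg fun x => hasSum_part x (by positivity)
    refine .of_nonneg_of_le (fun n => integral_nonneg fun x => norm_nonneg _) (fun n => ?_)
      (h1.summable.mul_left ‖g‖)
    rw [← integral_const_mul]
    refine integral_mono (hi n).norm ((integrable_part _ n).const_mul _) fun x => ?_
    simp only [norm_mul, Real.norm_of_nonneg (part_nonneg n x)]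
    exact mul_le_mul_of_nonneg_right (g.norm_coe_le_norm _) (part_nonneg n x)

theorem tendsto_integral_tsum_part (μ : ProbabilityMeasure X) (g : X →ᵇ ℝ) :
    Tendsto (fun l : ℕ => ∫ x, ∑' n, g (TopologicalSpace.denseSeq X n) * part ((1 / 2) ^ l) n x
      ∂(μ : Measure X)) atTop (𝓝 (∫ x, g x ∂(μ : Measure X))) := by
  refine tendsto_integral_of_dominated_convergence (fun _ => ‖g‖) (fun l => ?_)
    (integrable_const _) (fun l => .of_forall (norm_tsum_part_le g l))
    (.of_forall (tendsto_tsum_part g))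
  refine (Measurable.tsum fun n => ?_).aestronglyMeasurable
  exact ((continuous_part n).measurable.const_mul _)

theorem injective_bary : Function.Injective (bary : ProbabilityMeasure X → L1 ℕ ℝ) := by
  intro μ ν h
  have h1 : ∀ l n, ∫ x, part ((1 / 2) ^ l) n x ∂(μ : Measure X) =
      ∫ x, part ((1 / 2) ^ l) n x ∂(ν : Measure X) := fun l n => by
    have := congrArg (fun y : L1 ℕ ℝ => y (Nat.pair l n)) h
    simp only [bary_apply, code_pair, integral_const_mul] at this
    exact mul_left_cancel₀ (by positivity) this
  suffices h2 : (μ : Measure X) = (ν : Measure X) from Subtype.ext h2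
  refine ext_of_forall_integral_eq_of_IsFiniteMeasure fun g => ?_
  refine tendsto_nhds_unique (tendsto_integral_tsum_part μ g) ?_
  convert tendsto_integral_tsum_part ν g using 2 with l
  have h2 := hasSum_integral_smul_part μ g l
  simp only [h1] at h2
  exact h2.unique (hasSum_integral_smul_part ν g l)

theorem isProperMap_bary [CompleteSpace X] :
    IsProperMap (bary : ProbabilityMeasure X → L1 ℕ ℝ) := by
  refine isProperMap_iff_isCompact_preimage.2 ⟨continuous_bary, fun C hC => ?_⟩
  have hcl : IsClosed (bary ⁻¹' C : Set (ProbabilityMeasure X)) := hC.isClosed.preimage continuous_bary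
  rw [← hcl.closure_eq]
  refine isCompact_closure_of_isTightMeasureSet
    (isTightMeasureSet_iff_exists_isCompact_measure_compl_le.2 fun ε hε => ?_)
  obtain ⟨e, he, hes⟩ := ENNReal.exists_pos_sum_of_countable hε.ne' ℕ
  have hpos : ∀ l, 0 < (1 / 2 : ℝ) ^ l / 2 * e l := fun l =>
    mul_pos (by positivity) (NNReal.coe_pos.2 (he l))
  choose M hM using fun l => exists_tail_lt hC (hpos l)
  refine ⟨_, isCompact_tail_codeMap (M := M) (c := fun l => (1 / 2) ^ l / 2)
    fun l => half_lt_self (by positivity), ?_⟩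
  rintro _ ⟨μ, hμ, rfl⟩
  have hsub : {x : X | ∀ l, tail (M l) (codeMap x) ≤ (1 / 2) ^ l / 2}ᶜ ⊆
      ⋃ l, {x | (1 / 2) ^ l / 2 ≤ tail (M l) (codeMap x)} := fun x hx => by
    simp only [mem_compl_iff, Set.mem_ofPred_eq, not_forall, not_le] at hx
    obtain ⟨l, hl⟩ := hx
    exact mem_iUnion.2 ⟨l, hl.le⟩
  refine (measure_mono hsub).trans ((measure_iUnion_le _).trans (le_trans ?_ hes.le))
  refine ENNReal.tsum_le_tsum fun l => ?_
  have hint : Integrable (fun x => tail (M l) (codeMap x)) (μ : Measure X) :=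
    integrable_of_bounded ((continuous_tail _).comp continuous_codeMap) (C := 2) fun x => by
      rw [abs_of_nonneg (tail_nonneg _ _)]
      exact (tail_le_norm _ _).trans (norm_codeMap x).le
  have h1 := mul_meas_ge_le_integral_of_nonneg (μ := (μ : Measure X))
    (.of_forall fun x => tail_nonneg (M l) (codeMap x)) hint ((1 / 2) ^ l / 2)
  rw [← tail_bary] at h1
  have h2 := h1.trans (hM l _ hμ).le
  have h3 := le_of_mul_le_mul_left h2 (by positivity)
  rw [← ENNReal.ofReal_coe_nnreal]
  exact (ENNReal.le_ofReal_iff_toReal_le (measure_ne_top _ _) (NNReal.coe_nonneg _)).2 h3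

theorem isClosedEmbedding_bary [CompleteSpace X] :
    IsClosedEmbedding (bary : ProbabilityMeasure X → L1 ℕ ℝ) :=
  .of_continuous_injective_isClosedMap continuous_bary injective_bary isProperMap_bary.isClosedMap

theorem injective_codeMap : Function.Injective (codeMap : X → L1 ℕ ℝ) := fun x y h => by
  rw [← bary_diracProba, ← bary_diracProba] at h
  exact injective_diracProba (injective_bary h)

theorem convex_range_bary : Convex ℝ (range (bary : ProbabilityMeasure X → L1 ℕ ℝ)) := by
  rintro _ ⟨μ, rfl⟩ _ ⟨ν, rfl⟩ a b ha hb hab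
  let ρ : Measure X := ENNReal.ofReal a • (μ : Measure X) + ENNReal.ofReal b • (ν : Measure X)
  have hρ : IsProbabilityMeasure ρ := ⟨by
    simp only [ρ, Measure.add_apply, Measure.smul_apply, measure_univ, smul_eq_mul, mul_one]
    rw [← ENNReal.ofReal_add ha hb, hab, ENNReal.ofReal_one]⟩
  refine ⟨⟨ρ, hρ⟩, ?_⟩
  ext n
  change ∫ x, code n x ∂ρ = a * ∫ x, code n x ∂(μ : Measure X) + b * ∫ x, code n x ∂(ν : Measure X)
  rw [integral_add_measure ((integrable_code _ n).smul_measure ENNReal.ofReal_ne_top)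
    ((integrable_code _ n).smul_measure ENNReal.ofReal_ne_top), integral_smul_measure,
    integral_smul_measure, ENNReal.toReal_ofReal ha, ENNReal.toReal_ofReal hb, smul_eq_mul,
    smul_eq_mul]

end Prob

section Polish

variable (X : Type*) [TopologicalSpace X] [PolishSpace X] [Nonempty X]
  [MeasurableSpace X] [BorelSpace X]

theorem isClosedEmbedding_diracProba :
    IsClosedEmbedding (diracProba : X → ProbabilityMeasure X) := by
  let _ := TopologicalSpace.upgradeIsCompletelyMetrizable X
  have h : IsClosedEmbedding (bary ∘ (diracProba : X → ProbabilityMeasure X)) := by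
    rw [show bary ∘ (diracProba : X → ProbabilityMeasure X) = codeMap from funext bary_diracProba]
    exact .of_continuous_injective_isClosedMap continuous_codeMap injective_codeMap
      isProperMap_codeMap.isClosedMap
  exact isClosedEmbedding_bary.of_comp_iff.1 h

theorem nonempty_homeo_probabilityMeasure :
    Nonempty (ProbabilityMeasure X × L1 ℕ ℝ ≃ₜ L1 ℕ ℝ) := by
  let _ := TopologicalSpace.upgradeIsCompletelyMetrizable X
  have hne : Nonempty (ProbabilityMeasure X) := ⟨diracProba (Classical.arbitrary X)⟩
  obtain ⟨R, -⟩ := exists_pointedRetract_of_convex (isClosedEmbedding_bary (X := X)).isClosed_range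
    convex_range_bary (range_nonempty _)
  obtain ⟨h⟩ := R.nonempty_homeo
  exact ⟨(isClosedEmbedding_bary.isEmbedding.toHomeomorph.prodCongr (.refl _)).trans h⟩

end Polish

end Continuation

namespace Continuation

open Filter Metric MeasureTheory
open scoped ENNReal NNReal

/-! ### Push-forward of probability measures -/

section Lift

/-- A continuous map on the Cantor space has a Borel section over its image. -/
theorem exists_measurable_section_cantor {Y : Type*} [TopologicalSpace Y] [T2Space Y]
    [MeasurableSpace Y] [OpensMeasurableSpace Y] {h : (ℕ → Bool) → Y} (hh : Continuous h) :
    ∃ t : Y → (ℕ → Bool), Measurable t ∧ ∀ y ∈ range h, h (t y) = y := by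
  classical
  let c : (ℕ → Bool) → ℝ := fun b => cantorSetHomeomorphNatToBool.symm b
  have hc : Continuous c := continuous_subtype_val.comp cantorSetHomeomorphNatToBool.symm.continuous
  have hci : Function.Injective c :=
    Subtype.val_injective.comp cantorSetHomeomorphNatToBool.symm.injective
  have hex : ∀ y : Y, ∃ b : ℕ → Bool, if y ∈ range h then h b = y ∧ ∀ b', h b' = y → c b ≤ c b'
      else b = fun _ => false := fun y => by
    split_ifs with hy
    · have hK : IsCompact (h ⁻¹' {y}) := (isClosed_singleton.preimage hh).isCompact
      obtain ⟨b, hb, hmin⟩ := hK.exists_isMinOn hy hc.continuousOn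
      exact ⟨b, hb, fun b' hb' => hmin hb'⟩
    · exact ⟨_, rfl⟩
  choose t ht using hex
  refine ⟨t, ?_, fun y hy => ?_⟩
  · have hm : MeasurableEmbedding c := (hc.isClosedEmbedding hci).measurableEmbedding
    rw [← hm.measurable_comp_iff]
    refine measurable_of_Iic fun a => ?_
    have hA : MeasurableSet (h '' {b | c b ≤ a}) :=
      ((isClosed_le hc continuous_const).isCompact.image hh).isClosed.measurableSet
    have hR : MeasurableSet (range h) := (isCompact_range hh).isClosed.measurableSet
    have heq : (c ∘ t) ⁻¹' Iic a =
        h '' {b | c b ≤ a} ∪ ((range h)ᶜ ∩ {_y | c (fun _ => false) ≤ a}) := by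
      ext y
      have hty := ht y
      by_cases hy : y ∈ range h
      · rw [if_pos hy] at hty
        simp only [mem_preimage, Function.comp, mem_Iic, mem_union, mem_image, Set.mem_ofPred_eq,
          mem_inter_iff, mem_compl_iff, hy, not_true_eq_false, false_and, or_false]
        exact ⟨fun h1 => ⟨t y, h1, hty.1⟩, fun ⟨b, hb, hby⟩ => (hty.2 b hby).trans hb⟩
      · rw [if_neg hy] at hty
        have : ¬ ∃ b, c b ≤ a ∧ h b = y := fun ⟨b, _, hb⟩ => hy ⟨b, hb⟩
        simp only [mem_preimage, Function.comp, mem_Iic, mem_union, mem_image, Set.mem_ofPred_eq,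
          mem_inter_iff, mem_compl_iff, hy, not_false_eq_true, true_and, hty, this, false_or]
    rw [heq]
    exact hA.union (hR.compl.inter (.const _))
  · have hty := ht y
    rw [if_pos hy] at hty
    exact hty.1

theorem exists_measurable_section_compact {D Y : Type*} [TopologicalSpace D] [CompactSpace D]
    [TopologicalSpace.MetrizableSpace D] [Nonempty D] [MeasurableSpace D] [BorelSpace D]
    [TopologicalSpace Y] [T2Space Y] [MeasurableSpace Y] [OpensMeasurableSpace Y] {h : D → Y}
    (hh : Continuous h) : ∃ t : Y → D, Measurable t ∧ ∀ y ∈ range h, h (t y) = y := by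
  let _ := TopologicalSpace.metrizableSpaceMetric D
  obtain ⟨g, hg, hgs⟩ := exists_nat_bool_continuous_surjective_of_compact D
  obtain ⟨t, ht, hts⟩ := exists_measurable_section_cantor (hh.comp hg)
  refine ⟨g ∘ t, hg.measurable.comp ht, fun y hy => hts y ?_⟩
  rwa [hgs.range_comp]

/-- A compact box in the Baire space. -/
def box (n : ℕ → ℕ) : Set (ℕ → ℕ) := {s | ∀ i, s i ≤ n i}

/-- Restricting only the first `j` coordinates. -/
def preBox (n : ℕ → ℕ) (j : ℕ) : Set (ℕ → ℕ) := {s | ∀ i < j, s i ≤ n i}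

theorem isCompact_box (n : ℕ → ℕ) : IsCompact (box n) := by
  have : box n = Set.pi univ fun i => Iic (n i) := by ext s; simp [box, Pi.le_def]
  rw [this]
  exact isCompact_univ_pi fun i => (finite_Iic _).isCompact

theorem exists_preBox_subset (n : ℕ → ℕ) {U : Set (ℕ → ℕ)} (hU : IsOpen U) (h : box n ⊆ U) :
    ∃ j, preBox n j ⊆ U := by
  by_contra! hj
  choose s hs hsU using fun j => not_subset.1 (hj j)
  obtain ⟨t, ht, φ, hφ, hlim⟩ := (isCompact_box n).tendsto_subseq
    (x := fun j i => min (s j i) (n i)) fun j i => min_le_right _ _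
  have hlim' : Tendsto (fun k => s (φ k)) atTop (𝓝 t) := by
    refine tendsto_pi_nhds.2 fun i => (tendsto_pi_nhds.1 hlim i).congr' ?_
    filter_upwards [eventually_gt_atTop i] with k hk
    exact min_eq_left (hs (φ k) i (hk.trans_le hφ.le_apply))
  obtain ⟨k, hk⟩ := (hlim'.eventually (hU.mem_nhds (h ht))).exists
  exact hsU _ hk

/-- Finite measures are concentrated up to `ε` on images of compact boxes. -/
theorem exists_box_measure {Y : Type*} [TopologicalSpace Y] [T2Space Y] [MeasurableSpace Y]
    [BorelSpace Y] (ν : Measure Y) [IsFiniteMeasure ν] [ν.OuterRegular] {h : (ℕ → ℕ) → Y}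
    (hh : Continuous h) (hs : Function.Surjective h) {c : ℝ≥0∞} (hc : c < ν univ) :
    ∃ n, c ≤ ν (h '' box n) := by
  have step : ∀ (j : ℕ) (n : ℕ → ℕ), c < ν (h '' preBox n j) →
      ∃ k, c < ν (h '' preBox (Function.update n j k) (j + 1)) := fun j n hn => by
    have hu : h '' preBox n j = ⋃ k, h '' preBox (Function.update n j k) (j + 1) := by
      rw [← image_iUnion]
      congr 1
      ext s
      simp only [mem_iUnion, preBox, Set.mem_ofPred_eq]
      refine ⟨fun H => ⟨s j, fun i hi => ?_⟩, fun ⟨k, H⟩ i hi => ?_⟩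
      · rcases Nat.lt_succ_iff_lt_or_eq.1 hi with hi | rfl
        · rw [Function.update_of_ne hi.ne]; exact H i hi
        · rw [Function.update_self]
      · simpa [hi.ne] using H i (hi.trans (Nat.lt_succ_self j))
    have hm : Monotone fun k => h '' preBox (Function.update n j k) (j + 1) :=
      fun k k' hk => image_mono fun s H i hi => by
        rcases Nat.lt_succ_iff_lt_or_eq.1 hi with hi' | rfl
        · simpa [hi'.ne] using H i hi
        · have := H i hi
          rw [Function.update_self] at this ⊢
          exact this.trans hk
    rw [hu, hm.measure_iUnion, lt_iSup_iff] at hn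
    exact hn
  choose! K hK using step
  let N : ℕ → ℕ → ℕ := fun j => Nat.rec (fun _ => 0) (fun i n => Function.update n i (K i n)) j
  have hN : ∀ j, N (j + 1) = Function.update (N j) j (K j (N j)) := fun j => rfl
  have hpos : ∀ j, c < ν (h '' preBox (N j) j) := by
    intro j
    induction j with
    | zero =>
      have : preBox (N 0) 0 = univ := by ext s; simp [preBox]
      rwa [this, image_univ, hs.range_eq]
    | succ j ih => rw [hN]; exact hK j _ ih
  let n : ℕ → ℕ := fun i => N (i + 1) i
  have hstab : ∀ j i, i < j → N j i = n i := by
    intro j i hij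
    induction j with
    | zero => omega
    | succ j ih =>
      rcases Nat.lt_succ_iff_lt_or_eq.1 hij with h1 | rfl
      · rw [hN, Function.update_of_ne h1.ne, ih h1]
      · rfl
  have hbox : ∀ j, preBox (N j) j = preBox n j := fun j => by
    ext s
    exact forall₂_congr fun i hi => by rw [hstab j i hi]
  refine ⟨n, le_of_not_gt fun hlt => ?_⟩
  obtain ⟨U, hU, hUo, hUc⟩ := Set.exists_isOpen_lt_of_lt _ _ hlt
  obtain ⟨j, hj⟩ := exists_preBox_subset n (hUo.preimage hh) (image_subset_iff.1 hU)
  have h1 := hpos j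
  rw [hbox] at h1
  exact absurd (h1.trans_le (measure_mono (image_subset_iff.2 hj))) hUc.not_gt

/-- A continuous surjection between Polish spaces has a measurable almost everywhere section. -/
theorem exists_measurable_ae_section {X Y : Type*} [TopologicalSpace X] [PolishSpace X]
    [MeasurableSpace X] [BorelSpace X] [TopologicalSpace Y] [T2Space Y] [MeasurableSpace Y]
    [BorelSpace Y] {f : X → Y} (hf : Continuous f) (hs : Function.Surjective f)
    (ν : Measure Y) [IsProbabilityMeasure ν] [ν.OuterRegular] :
    ∃ t : Y → X, Measurable t ∧ ∀ᵐ y ∂ν, f (t y) = y := by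
  have hY : Nonempty Y := nonempty_of_isProbabilityMeasure ν
  have hX : Nonempty X := hs.nonempty
  obtain ⟨g, hg, hgs⟩ := PolishSpace.exists_nat_nat_continuous_surjective X
  have hfg := hf.comp hg
  have hb : ∀ k : ℕ, ∃ n, 1 - ((k : ℝ≥0∞) + 1)⁻¹ ≤ ν ((f ∘ g) '' box n) := fun k =>
    exists_box_measure ν hfg (hs.comp hgs) (by
      rw [measure_univ]
      exact ENNReal.sub_lt_self ENNReal.one_ne_top one_ne_zero (by simp))
  choose n hn using hb
  have hne : ∀ k, Nonempty (box (n k)) := fun k => ⟨⟨fun _ => 0, fun _ => Nat.zero_le _⟩⟩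
  have hcs : ∀ k, CompactSpace (box (n k)) := fun k => isCompact_iff_compactSpace.1 (isCompact_box _)
  have hsec := fun k => exists_measurable_section_compact (D := box (n k))
    (hfg.comp continuous_subtype_val)
  choose t ht hts using hsec
  let A : ℕ → Set Y := fun k => (f ∘ g) '' box (n k)
  have hA : ∀ k, MeasurableSet (A k) := fun k =>
    ((isCompact_box _).image hfg).isClosed.measurableSet
  obtain ⟨T, hT, hTe⟩ := exists_measurable_piecewise (disjointed A) (.disjointed hA)
    (fun k y => g (t k y)) (fun k => hg.measurable.comp (measurable_subtype_coe.comp (ht k)))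
    fun i j hij y hy => ((disjoint_disjointed A hij).le_bot hy).elim
  refine ⟨T, hT, ?_⟩
  have hcover : ∀ y ∈ ⋃ k, A k, f (T y) = y := fun y hy => by
    rw [← iUnion_disjointed] at hy
    obtain ⟨k, hk⟩ := mem_iUnion.1 hy
    rw [hTe k hk]
    refine hts k y ?_
    rw [range_comp, Subtype.range_coe]
    exact disjointed_subset A k hk
  have hfull : ν (⋃ k, A k) = 1 := by
    refine le_antisymm prob_le_one ?_
    have hlim : Tendsto (fun k : ℕ => (1 : ℝ≥0∞) - ((k : ℝ≥0∞) + 1)⁻¹) atTop (𝓝 (1 - 0)) := by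
      refine ENNReal.Tendsto.sub tendsto_const_nhds ?_ (.inl ENNReal.one_ne_top)
      have := (tendsto_add_atTop_iff_nat 1).2 ENNReal.tendsto_inv_nat_nhds_zero
      simpa using this
    rw [tsub_zero] at hlim
    exact le_of_tendsto hlim (.of_forall fun k => (hn k).trans (measure_mono (subset_iUnion A k)))
  have : ∀ᵐ y ∂ν, y ∈ ⋃ k, A k := (mem_ae_iff_prob_eq_one (.iUnion hA)).2 hfull
  filter_upwards [this] with y hy using hcover y hy

end Lift

section Map

variable {X Y Z : Type*} [TopologicalSpace X] [MeasurableSpace X] [BorelSpace X]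
  [TopologicalSpace Y] [MeasurableSpace Y] [BorelSpace Y]
  [TopologicalSpace Z] [MeasurableSpace Z] [BorelSpace Z]

/-- The action of a continuous map on probability measures. -/
noncomputable def pmap (f : C(X, Y)) (μ : ProbabilityMeasure X) : ProbabilityMeasure Y :=
  μ.map f.continuous.measurable.aemeasurable

theorem coe_pmap (f : C(X, Y)) (μ : ProbabilityMeasure X) :
    (pmap f μ : Measure Y) = (μ : Measure X).map f := rfl

theorem continuous_pmap (f : C(X, Y)) : Continuous (pmap f) :=
  ProbabilityMeasure.continuous_map f.continuous

theorem pmap_id (μ : ProbabilityMeasure X) : pmap (.id X) μ = μ :=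
  Subtype.ext (by rw [← ProbabilityMeasure.toMeasure, coe_pmap]; exact Measure.map_id)

theorem pmap_comp (g : C(Y, Z)) (f : C(X, Y)) (μ : ProbabilityMeasure X) :
    pmap (g.comp f) μ = pmap g (pmap f μ) :=
  Subtype.ext (Measure.map_map g.continuous.measurable f.continuous.measurable).symm

theorem pmap_diracProba (f : C(X, Y)) (x : X) : pmap f (diracProba x) = diracProba (f x) :=
  Subtype.ext (Measure.map_dirac' f.continuous.measurable x)

theorem injective_pmap [PolishSpace X] [PolishSpace Y] {f : C(X, Y)} (hf : Function.Injective f) :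
    Function.Injective (pmap f) := fun μ ν h => by
  have hm : MeasurableEmbedding f := f.continuous.measurableEmbedding hf
  have h1 : (μ : Measure X).map f = (ν : Measure X).map f := congrArg Subtype.val h
  have h2 : (μ : Measure X) = (ν : Measure X) := by rw [← hm.comap_map μ, h1, hm.comap_map]
  exact Subtype.ext h2

theorem surjective_pmap [PolishSpace X] [PolishSpace Y] {f : C(X, Y)}
    (hf : Function.Surjective f) : Function.Surjective (pmap f) := fun ν => by
  obtain ⟨t, ht, hft⟩ := exists_measurable_ae_section f.continuous hf (ν : Measure Y)
  refine ⟨ν.map ht.aemeasurable, Subtype.ext ?_⟩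
  calc ((ν : Measure Y).map t).map f = (ν : Measure Y).map (f ∘ t) :=
        Measure.map_map f.continuous.measurable ht
    _ = (ν : Measure Y).map id := Measure.map_congr hft
    _ = ν := Measure.map_id

theorem isEmbedding_pmap [PolishSpace X] [PolishSpace Y] [Nonempty Y] {f : C(X, Y)}
    (hf : IsEmbedding f) : IsEmbedding (pmap f) := by
  refine ⟨isInducing_iff_nhds.2 fun μ => le_antisymm
    ((continuous_pmap f).tendsto μ).le_comap ?_, injective_pmap hf.injective⟩
  let _ := TopologicalSpace.upgradeIsCompletelyMetrizable Y
  have : FirstCountableTopology (ProbabilityMeasure Y) :=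
    isClosedEmbedding_bary.isInducing.firstCountableTopology
  have h := tendsto_of_forall_isOpen_le_liminf' (L := comap (pmap f) (𝓝 (pmap f μ))) (μ := μ)
    (μs := id) fun G hG => ?_
  · exact h
  obtain ⟨U, hU, rfl⟩ := hf.isInducing.isOpen_iff.1 hG
  have h1 := ProbabilityMeasure.le_liminf_measure_open_of_tendsto
    (tendsto_comap (f := pmap f) (x := 𝓝 (pmap f μ))) hU
  simpa only [coe_pmap, id, Measure.map_apply f.continuous.measurable hU.measurableSet] using h1

end Map

end Continuation

namespace Continuation

open Filter MeasureTheory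

/-! ### The model of the Hilbert space over a `Z`-set -/

/-- The space `K` with an isolated point added. -/
def Pointed (K : Type*) : Type _ := K ⊕ Unit

namespace Pointed

variable {K L M : Type*} [TopologicalSpace K] [TopologicalSpace L] [TopologicalSpace M]

instance : TopologicalSpace (Pointed K) := inferInstanceAs (TopologicalSpace (K ⊕ Unit))

instance [PolishSpace K] : PolishSpace (Pointed K) := inferInstanceAs (PolishSpace (K ⊕ Unit))

instance : MeasurableSpace (Pointed K) := borel _

instance : BorelSpace (Pointed K) := ⟨rfl⟩

instance : Nonempty (Pointed K) := ⟨.inr ()⟩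

/-- The inclusion of a space in the space with an added point. -/
def inl (k : K) : Pointed K := Sum.inl k

theorem isClosedEmbedding_inl : IsClosedEmbedding (inl : K → Pointed K) := IsClosedEmbedding.inl

/-- The extension of a map to the added point. -/
def map (f : C(K, L)) : C(Pointed K, Pointed L) where
  toFun := Sum.map f id
  continuous_toFun := f.continuous.sumMap continuous_id

theorem map_inl (f : C(K, L)) (k : K) : map f (inl k) = inl (f k) := rfl

theorem map_id : map (.id K) = .id (Pointed K) := by
  ext x
  exact congrFun Sum.map_id_id x

theorem map_comp (g : C(L, M)) (f : C(K, L)) : map (g.comp f) = (map g).comp (map f) := by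
  ext x
  rcases x with x | x <;> rfl

theorem injective_map {f : C(K, L)} (hf : Function.Injective f) : Function.Injective (map f) :=
  Sum.map_injective.2 ⟨hf, Function.injective_id⟩

theorem surjective_map {f : C(K, L)} (hf : Function.Surjective f) : Function.Surjective (map f) :=
  Sum.map_surjective.2 ⟨hf, Function.surjective_id⟩

theorem surjective_of_map {f : C(K, L)} (h : ∀ y, inl y ∈ range (map f)) :
    Function.Surjective f := fun y => by
  obtain ⟨x | x, hx⟩ := h y
  · exact ⟨x, Sum.inl_injective hx⟩
  · exact absurd hx Sum.inr_ne_inl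

theorem isEmbedding_map {f : C(K, L)} (hf : IsEmbedding f) : IsEmbedding (map f) :=
  (IsEmbedding.inl.comp hf).sumElim_of_separatedNhds (IsEmbedding.inr.comp .id)
    ⟨range Sum.inl, range Sum.inr, isOpen_range_inl, isOpen_range_inr, range_comp_subset_range _ _,
      range_comp_subset_range _ _, isCompl_range_inl_range_inr.disjoint⟩

end Pointed

/-- The model of the Hilbert space attached to `K`. -/
abbrev Model (K : Type*) [TopologicalSpace K] : Type _ :=
  (ProbabilityMeasure (Pointed K) × L1 ℕ ℝ) × L1 ℕ ℝ

namespace Model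

variable {K L M : Type*} [TopologicalSpace K] [TopologicalSpace L] [TopologicalSpace M]

/-- The inclusion of a space in its model. -/
noncomputable def incl (k : K) : Model K := ((diracProba (Pointed.inl k), 0), 0)

/-- The action of a continuous map on models. -/
noncomputable def map (f : C(K, L)) : Model K → Model L :=
  Prod.map (Prod.map (pmap (Pointed.map f)) id) id

theorem continuous_map (f : C(K, L)) : Continuous (map f) :=
  ((continuous_pmap _).prodMap continuous_id).prodMap continuous_id

theorem map_incl (f : C(K, L)) (k : K) : map f (incl k) = incl (f k) := by
  simp only [map, incl, Prod.map, pmap_diracProba, Pointed.map_inl, id]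

theorem map_id : map (.id K) = id := by
  ext1 x
  simp only [map, Pointed.map_id, Prod.map, pmap_id, id]

theorem map_comp (g : C(L, M)) (f : C(K, L)) : map (g.comp f) = map g ∘ map f := by
  ext1 x
  simp only [map, Pointed.map_comp, Prod.map, pmap_comp, id, Function.comp]

theorem surjective_of_map [PolishSpace L] {f : C(K, L)} (h : Function.Surjective (map f)) :
    Function.Surjective f := by
  refine Pointed.surjective_of_map fun y => ?_
  obtain ⟨μ, hμ⟩ := h (incl y)
  have h1 : pmap (Pointed.map f) μ.1.1 = diracProba (Pointed.inl y) :=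
    congrArg (fun p : Model L => p.1.1) hμ
  by_contra hy
  have h2 := congrArg (fun ρ : ProbabilityMeasure (Pointed L) =>
    (ρ : Measure (Pointed L)) {Pointed.inl y}) h1
  have h3 : Pointed.map f ⁻¹' {Pointed.inl y} = ∅ := by
    rw [preimage_singleton_eq_empty]; exact hy
  rw [coe_pmap, Measure.map_apply (Pointed.map f).continuous.measurable
    (measurableSet_singleton _), h3, measure_empty] at h2
  have h4 : (diracProba (Pointed.inl y) : Measure (Pointed L)) {Pointed.inl y} = 1 :=
    Measure.dirac_apply_of_mem rfl
  rw [h4] at h2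
  exact zero_ne_one h2

variable [PolishSpace K] [PolishSpace L]

theorem injective_map {f : C(K, L)} (hf : Function.Injective f) : Function.Injective (map f) :=
  ((injective_pmap (Pointed.injective_map hf)).prodMap Function.injective_id).prodMap
    Function.injective_id

theorem surjective_map {f : C(K, L)} (hf : Function.Surjective f) : Function.Surjective (map f) :=
  ((surjective_pmap (Pointed.surjective_map hf)).prodMap Function.surjective_id).prodMap
    Function.surjective_id

theorem isEmbedding_map {f : C(K, L)} (hf : IsEmbedding f) : IsEmbedding (map f) :=
  ((isEmbedding_pmap (Pointed.isEmbedding_map hf)).prodMap .id).prodMap .id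

end Model

instance : PolishSpace L2Space := by
  have h : TopologicalSpace.IsSeparable (univ : Set L2Space) := by
    have hs := ((countable_range fun i : ℕ =>
      (lp.single 2 i (1 : ℝ) : L2Space)).isSeparable.span (R := ℝ)).closure
    refine hs.mono fun x _ => ?_
    refine mem_closure_of_tendsto (lp.hasSum_single (by simp) x) (.of_forall fun s => ?_)
    refine Submodule.sum_mem _ fun i _ => ?_
    rw [show lp.single 2 i (x i) = x i • (lp.single 2 i (1 : ℝ) : L2Space) by
      rw [← lp.single_smul, smul_eq_mul, mul_one]]
    exact Submodule.smul_mem _ _ (Submodule.subset_span (mem_range_self i))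
  have : TopologicalSpace.SeparableSpace L2Space := TopologicalSpace.isSeparable_univ_iff.1 h
  have : SecondCountableTopology L2Space := UniformSpace.secondCountable_of_separable _
  infer_instance

theorem exists_homeo_model {K : Set L2Space} (hK : IsZSet K) :
    ∃ H : L2Space ≃ₜ Model K, ∀ k : K, H k = Model.incl k := by
  have : PolishSpace K := hK.1.polishSpace
  obtain ⟨e⟩ := nonempty_homeo_probabilityMeasure (Pointed K)
  have hi : IsClosedEmbedding fun k : K => (diracProba (Pointed.inl k), (0 : L1 ℕ ℝ)) := by
    refine .comp (g := fun μ : ProbabilityMeasure (Pointed K) => (μ, (0 : L1 ℕ ℝ))) ?_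
      ((isClosedEmbedding_diracProba (Pointed K)).comp Pointed.isClosedEmbedding_inl)
    exact IsClosedEmbedding.of_continuous_injective_isClosedMap (by fun_prop)
      (fun _ _ h => (Prod.ext_iff.1 h).1) fun s hs => by
        rw [← prod_singleton]; exact hs.prod isClosed_singleton
  exact exists_homeo_extend hK e hi

end Continuation

/-- **Functor of continuation in the Hilbert space `ℓ²(ℕ,ℝ)`: properties (a)-(c).**
There is an assignment `(φ, L) ↦ E φ L`, sending a continuous map `φ : K → L` between
`Z`-sets of `ℓ²` to a continuous map `ℓ² → ℓ²`, which preserves identities and compositions,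
extends `φ`, and preserves and reflects injectivity, surjectivity and being an embedding;
in particular it sends homeomorphisms of `K` onto `L` to homeomorphisms of `ℓ²` onto `ℓ²`. -/
theorem continuation_functor_hilbert_space :
    ∃ E : ∀ K L : Set L2Space, (K → L) → (L2Space → L2Space),
      (∀ L : Set L2Space, IsZSet L → E L L id = id) ∧
      ∀ K L : Set L2Space, IsZSet K → IsZSet L → ∀ φ : K → L, Continuous φ →
        Continuous (E K L φ) ∧
        (∀ M : Set L2Space, IsZSet M → ∀ ψ : L → M, Continuous ψ →
          E K M (ψ ∘ φ) = E L M ψ ∘ E K L φ) ∧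
        (∀ x : K, E K L φ ↑x = ↑(φ x)) ∧
        (Function.Injective φ ↔ Function.Injective (E K L φ)) ∧
        (Function.Surjective φ ↔ Function.Surjective (E K L φ)) ∧
        (IsEmbedding φ ↔ IsEmbedding (E K L φ)) ∧
        (IsHomeomorph φ → IsHomeomorph (E K L φ)) := by
  classical
  choose H hH using @Continuation.exists_homeo_model
  let E : ∀ K L : Set L2Space, (K → L) → (L2Space → L2Space) := fun K L φ =>
    if h : IsZSet K ∧ IsZSet L ∧ Continuous φ then
      (H h.2.1).symm ∘ Continuation.Model.map ⟨φ, h.2.2⟩ ∘ H h.1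
    else id
  have hE : ∀ {K L : Set L2Space} (hK : IsZSet K) (hL : IsZSet L) {φ : K → L} (hφ : Continuous φ),
      E K L φ = (H hL).symm ∘ Continuation.Model.map ⟨φ, hφ⟩ ∘ H hK := fun hK hL φ hφ =>
    dif_pos ⟨hK, hL, hφ⟩
  refine ⟨E, fun L hL => ?_, fun K L hK hL φ hφ => ?_⟩
  · rw [hE hL hL continuous_id]
    ext1 x
    exact (H hL).symm_apply_eq.2 (congrFun Continuation.Model.map_id _)
  have hPK : PolishSpace K := hK.1.polishSpace
  have hPL : PolishSpace L := hL.1.polishSpace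
  have hext : ∀ x : K, E K L φ ↑x = ↑(φ x) := fun x => by
    rw [hE hK hL hφ, Function.comp_apply, Function.comp_apply, hH, Continuation.Model.map_incl]
    exact (H hL).symm_apply_eq.2 (hH hL _).symm
  have hinj : Function.Injective φ → Function.Injective (E K L φ) := fun h => by
    rw [hE hK hL hφ]
    exact (H hL).symm.injective.comp
      ((Continuation.Model.injective_map (f := ⟨φ, hφ⟩) h).comp (H hK).injective)
  have hsurj : Function.Surjective φ → Function.Surjective (E K L φ) := fun h => by
    rw [hE hK hL hφ]
    exact (H hL).symm.surjective.comp
      ((Continuation.Model.surjective_map (f := ⟨φ, hφ⟩) h).comp (H hK).surjective)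
  have hemb : IsEmbedding φ → IsEmbedding (E K L φ) := fun h => by
    rw [hE hK hL hφ]
    exact (H hL).symm.isEmbedding.comp
      ((Continuation.Model.isEmbedding_map (f := ⟨φ, hφ⟩) h).comp (H hK).isEmbedding)
  have hcont : Continuous (E K L φ) := by
    rw [hE hK hL hφ]
    exact (H hL).symm.continuous.comp
      ((Continuation.Model.continuous_map _).comp (H hK).continuous)
  have hcomp : E K L φ ∘ Subtype.val = Subtype.val ∘ φ := funext hext
  refine ⟨hcont, fun M hM ψ hψ => ?_, hext, ⟨hinj, fun h => ?_⟩, ⟨hsurj, fun h => ?_⟩,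
    ⟨hemb, fun h => ?_⟩, fun h => ?_⟩
  · rw [hE hK hM (hψ.comp hφ), hE hL hM hψ, hE hK hL hφ]
    ext1 x
    have := congrFun (Continuation.Model.map_comp (⟨ψ, hψ⟩ : C(L, M)) (⟨φ, hφ⟩ : C(K, L))) (H hK x)
    simp only [Function.comp_apply, Homeomorph.apply_symm_apply]
    exact congrArg (H hM).symm this
  · refine Function.Injective.of_comp (f := (Subtype.val : L → L2Space)) ?_
    rw [← hcomp]
    exact h.comp Subtype.val_injective
  · rw [hE hK hL hφ] at h
    refine Continuation.Model.surjective_of_map (f := ⟨φ, hφ⟩) fun y => ?_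
    obtain ⟨x, hx⟩ := h ((H hL).symm y)
    exact ⟨H hK x, (H hL).symm.injective hx⟩
  · refine .of_comp hφ continuous_subtype_val ?_
    rw [← hcomp]
    exact h.comp .subtypeVal
  · exact isHomeomorph_iff_isEmbedding_surjective.2 ⟨hemb h.isEmbedding, hsurj h.surjective⟩
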